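/- arXiv:1911.07287 — 2 statements merged into one kernel-verified Lean document; each statement's English description precedes it below -/
import Mathlib

section
/- There exists a constant C > 0 such that every 2-intersecting family of n pairwise intersecting closed Jordan curves in general position in the plane has at most C · n touching pairs. -/
noncomputable section

abbrev Plane : Type := EuclideanSpace ℝ (Fin 2)

/-- A closed Jordan curve: a subset of the plane homeomorphic to the unit circle. -/
def IsJordanCurve (γ : Set Plane) : Prop :=
  Nonempty (γ ≃ₜ Metric.sphere (0 : Plane) 1)

/-- A Jordan arc: a subset of the plane homeomorphic to the closed unit interval. -/
def IsJordanArc (γ : Set Plane) : Prop :=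
  Nonempty (γ ≃ₜ unitInterval)

/-- General position: any two distinct members intersect in a finite set, and no point
of the plane lies on three distinct members. -/
def GenPos {n : ℕ} (γ : Fin n → Set Plane) : Prop :=
  (∀ i j : Fin n, i ≠ j → (γ i ∩ γ j).Finite) ∧
  (∀ p : Plane, ∀ i j k : Fin n, p ∈ γ i → p ∈ γ j → p ∈ γ k → i = j ∨ i = k ∨ j = k)

/-- `m`-intersecting: any two distinct members intersect in at most `m` points. -/
def MIntersecting {n : ℕ} (m : ℕ) (γ : Fin n → Set Plane) : Prop :=
  ∀ i j : Fin n, i ≠ j → (γ i ∩ γ j).ncard ≤ m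

/-- Two curves touch if their intersection is a singleton. -/
def Touches (a b : Set Plane) : Prop := ∃ x, a ∩ b = {x}

/-- The number of touching pairs of the family. -/
def touchingPairs {n : ℕ} (γ : Fin n → Set Plane) : ℕ :=
  {p : Fin n × Fin n | p.1 < p.2 ∧ Touches (γ p.1) (γ p.2)}.ncard

/-- The set of intersection points of the family: points lying on at least two
distinct members. -/
def interPoints {n : ℕ} (γ : Fin n → Set Plane) : Set Plane :=
  {x : Plane | ∃ i j : Fin n, i ≠ j ∧ x ∈ γ i ∧ x ∈ γ j}


namespace PC
open Set

/-- normalized complex exponential -/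
def ee (z : ℂ) : ℂ := Complex.exp (2 * Real.pi * Complex.I * z)

lemma ee_ne (z : ℂ) : ee z ≠ 0 := Complex.exp_ne_zero _
lemma ee_add (a b : ℂ) : ee (a + b) = ee a * ee b := by
  unfold ee; rw [mul_add, Complex.exp_add]
lemma ee_zero : ee 0 = 1 := by simp [ee]
lemma ee_neg (a : ℂ) : ee (-a) = (ee a)⁻¹ := by
  unfold ee; rw [mul_neg, Complex.exp_neg]
lemma ee_sub (a b : ℂ) : ee (a - b) = ee a / ee b := by
  rw [sub_eq_add_neg, ee_add, ee_neg, div_eq_mul_inv]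
lemma ee_half : ee (1/2) = -1 := by
  unfold ee
  rw [show 2 * (Real.pi:ℂ) * Complex.I * (1/2) = Real.pi * Complex.I by ring, Complex.exp_pi_mul_I]
lemma ee_eq_iff (a b : ℂ) : ee a = ee b ↔ ∃ m : ℤ, a = b + m := by
  unfold ee
  rw [Complex.exp_eq_exp_iff_exists_int]
  have h : (2 * (Real.pi:ℂ) * Complex.I) ≠ 0 := by simp [Real.pi_ne_zero]
  constructor
  · rintro ⟨n, hn⟩
    refine ⟨n, mul_left_cancel₀ h ?_⟩
    rw [hn]; ring
  · rintro ⟨n, rfl⟩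
    exact ⟨n, by ring⟩
lemma ee_eq_one_iff (a : ℂ) : ee a = 1 ↔ ∃ m : ℤ, a = m := by
  rw [← ee_zero, ee_eq_iff]; simp
lemma ee_surj {z : ℂ} (hz : z ≠ 0) : ∃ a, ee a = z := by
  refine ⟨Complex.log z / (2 * Real.pi * Complex.I), ?_⟩
  have h : (2 * (Real.pi:ℂ) * Complex.I) ≠ 0 := by simp [Real.pi_ne_zero]
  unfold ee
  rw [mul_div_cancel₀ _ h, Complex.exp_log hz]

lemma exists_log2 {U : Set (ℝ × ℝ)} (hU : IsOpen U) (hc : Convex ℝ U) (hne : U.Nonempty)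
    {F : ℝ × ℝ → ℂ} (hF : ContinuousOn F U) (h0 : ∀ x ∈ U, F x ≠ 0) :
    ∃ L : ℝ × ℝ → ℂ, ContinuousOn L U ∧ ∀ x ∈ U, ee (L x) = F x := by
  have hs : IsSimplyConnected U := by
    have := hc.contractibleSpace hne
    exact (inferInstance : SimplyConnectedSpace U)
  obtain ⟨f, hf, hf'⟩ := Complex.exists_continuousOn_eqOn_exp_comp hs hU hF
    (by rintro ⟨x, hx, hx'⟩; exact h0 x hx hx')
  refine ⟨fun x => f x / (2 * Real.pi * Complex.I), hf.div_const _, fun x hx => ?_⟩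
  have h : (2 * (Real.pi:ℂ) * Complex.I) ≠ 0 := by simp [Real.pi_ne_zero]
  unfold ee
  rw [mul_div_cancel₀ _ h]
  exact hf' hx


def cl (a b t : ℝ) : ℝ := max (min a b) (min (max a b) t)
lemma cl_cont (a b : ℝ) : Continuous (cl a b) := by unfold cl; fun_prop
lemma cl_mem (a b t : ℝ) : cl a b t ∈ uIcc a b := by
  unfold cl uIcc
  exact ⟨le_max_left _ _, max_le (min_le_max) (min_le_left _ _)⟩
lemma cl_id {a b t : ℝ} (h : t ∈ uIcc a b) : cl a b t = t := by
  unfold cl; unfold uIcc at h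
  rw [min_eq_right h.2, max_eq_right h.1]

def IsLift (f : ℝ → ℂ) (a b : ℝ) (q : ℂ) (L : ℝ → ℂ) : Prop :=
  ContinuousOn L (uIcc a b) ∧ ∀ t ∈ uIcc a b, ee (L t) = f t - q

lemma exists_lift2 {f h : ℝ → ℂ} (hf : Continuous f) (hh : Continuous h) {a b c d : ℝ}
    (hd : ∀ s ∈ uIcc a b, ∀ t ∈ uIcc c d, f s ≠ h t) :
    ∃ L : ℝ × ℝ → ℂ, Continuous L ∧ ∀ s ∈ uIcc a b, ∀ t ∈ uIcc c d, ee (L (s, t)) = f s - h t := by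
  obtain ⟨L, hL, hL'⟩ := exists_log2 (U := univ) isOpen_univ convex_univ univ_nonempty
    (F := fun p => f (cl a b p.1) - h (cl c d p.2))
    (by
      have := cl_cont a b
      have := cl_cont c d
      apply Continuous.continuousOn
      fun_prop)
    (fun p _ => sub_ne_zero.2 (hd _ (cl_mem _ _ _) _ (cl_mem _ _ _)))
  refine ⟨L, continuousOn_univ.1 hL, fun s hs t ht => ?_⟩
  rw [hL' _ (mem_univ _)]; simp [cl_id hs, cl_id ht]

lemma exists_lift {f : ℝ → ℂ} (hf : Continuous f) {a b : ℝ} {q : ℂ}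
    (hq : ∀ t ∈ uIcc a b, f t ≠ q) : ∃ L, IsLift f a b q L := by
  obtain ⟨L, hL, hL'⟩ := exists_lift2 (h := fun _ => q) hf continuous_const (c := 0) (d := 0)
    (fun s hs t _ => hq s hs)
  exact ⟨fun t => L (t, 0), by fun_prop, fun t ht => hL' t ht 0 (by simp)⟩

lemma int_const {D : ℝ → ℂ} {a b : ℝ} (hD : ContinuousOn D (uIcc a b))
    (hi : ∀ t ∈ uIcc a b, ∃ m : ℤ, D t = m) : D a = D b := by
  have hdisc : DiscreteTopology (range ((↑) : ℤ → ℝ)) :=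
    (Int.isClosedEmbedding_coe_real.isEmbedding.toHomeomorph.symm.isEmbedding).discreteTopology
  have h1 : (D a).re = (D b).re := by
    have hp : IsPreconnected (uIcc a b) := isPreconnected_uIcc
    refine hp.constant_of_mapsTo (T := range ((↑) : ℤ → ℝ)) (f := fun t => (D t).re) ⟨hdisc⟩
      (Complex.continuous_re.comp_continuousOn hD) ?_ left_mem_uIcc right_mem_uIcc
    intro t ht
    obtain ⟨m, hm⟩ := hi t ht
    exact ⟨m, by simp [hm]⟩
  obtain ⟨m, hm⟩ := hi a left_mem_uIcc
  obtain ⟨k, hk⟩ := hi b right_mem_uIcc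
  rw [hm, hk] at h1 ⊢
  simp at h1
  simp [h1]

lemma lift_unique {f : ℝ → ℂ} {a b : ℝ} {q : ℂ} {L L' : ℝ → ℂ} (h : IsLift f a b q L)
    (h' : IsLift f a b q L') : L b - L a = L' b - L' a := by
  have := int_const (D := fun t => L t - L' t) (a := a) (b := b) (h.1.sub h'.1) (fun t ht => by
    have h1 := h.2 t ht
    rw [← h'.2 t ht, ee_eq_iff] at h1
    obtain ⟨m, hm⟩ := h1
    exact ⟨m, by rw [hm]; ring⟩)
  linear_combination -this

open Classical in
/-- normalized logarithmic variation -/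
def V (f : ℝ → ℂ) (a b : ℝ) (q : ℂ) : ℂ :=
  if h : ∃ L, IsLift f a b q L then h.choose b - h.choose a else 0

lemma V_eq {f : ℝ → ℂ} {a b : ℝ} {q : ℂ} {L : ℝ → ℂ} (h : IsLift f a b q L) :
    V f a b q = L b - L a := by
  have h' : ∃ L, IsLift f a b q L := ⟨L, h⟩
  unfold V
  rw [dif_pos h']
  exact lift_unique h'.choose_spec h

lemma V_ee {f : ℝ → ℂ} (hf : Continuous f) {a b : ℝ} {q : ℂ}
    (hq : ∀ t ∈ uIcc a b, f t ≠ q) : ee (V f a b q) = (f b - q) / (f a - q) := by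
  obtain ⟨L, hL⟩ := exists_lift hf hq
  rw [V_eq hL, ee_sub, hL.2 _ left_mem_uIcc, hL.2 _ right_mem_uIcc]

lemma IsLift.mono {f : ℝ → ℂ} {a b c d : ℝ} {q : ℂ} {L : ℝ → ℂ} (h : IsLift f a b q L)
    (hs : uIcc c d ⊆ uIcc a b) : IsLift f c d q L :=
  ⟨h.1.mono hs, fun t ht => h.2 t (hs ht)⟩

lemma V_same (f : ℝ → ℂ) (a : ℝ) (q : ℂ) : V f a a q = 0 := by
  unfold V; split_ifs <;> simp

/-- additivity -/
lemma V_add {f : ℝ → ℂ} (hf : Continuous f) {x y a b c : ℝ} {q : ℂ}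
    (hq : ∀ t ∈ uIcc x y, f t ≠ q) (ha : a ∈ uIcc x y) (hb : b ∈ uIcc x y) (hc : c ∈ uIcc x y) :
    V f a b q + V f b c q = V f a c q := by
  obtain ⟨L, hL⟩ := exists_lift hf hq
  rw [V_eq (hL.mono (uIcc_subset_uIcc ha hb)), V_eq (hL.mono (uIcc_subset_uIcc hb hc)),
    V_eq (hL.mono (uIcc_subset_uIcc ha hc))]
  ring

lemma V_swap {f : ℝ → ℂ} (hf : Continuous f) {a b : ℝ} {q : ℂ}
    (hq : ∀ t ∈ uIcc a b, f t ≠ q) : V f b a q = - V f a b q := by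
  have := V_add hf hq left_mem_uIcc right_mem_uIcc left_mem_uIcc
  rw [V_same] at this
  linear_combination this

/-- affine reparametrization -/
lemma V_comp {f : ℝ → ℂ} (hf : Continuous f) {a b : ℝ} {q : ℂ} (s k : ℝ)
    (hq : ∀ t ∈ uIcc (s * a + k) (s * b + k), f t ≠ q) :
    V (fun t => f (s * t + k)) a b q = V f (s * a + k) (s * b + k) q := by
  obtain ⟨L, hL⟩ := exists_lift hf hq
  have hm : ∀ t ∈ uIcc a b, s * t + k ∈ uIcc (s * a + k) (s * b + k) := by
    intro t ht
    rw [mem_uIcc] at ht ⊢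
    rcases le_total 0 s with h | h
    · rcases ht with ht | ht
      · left; constructor <;> nlinarith
      · right; constructor <;> nlinarith
    · rcases ht with ht | ht
      · right; constructor <;> nlinarith
      · left; constructor <;> nlinarith
  rw [V_eq hL, V_eq (L := fun t => L (s * t + k))]
  refine ⟨?_, fun t ht => hL.2 _ (hm t ht)⟩
  exact hL.1.comp (by fun_prop) hm

/-- crossing number of two arcs -/
def cr (f : ℝ → ℂ) (a b : ℝ) (h : ℝ → ℂ) (c d : ℝ) : ℂ :=
  V f a b (h c) - V f a b (h d) + V h c d (f b) - V h c d (f a)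

/-- disjoint arcs have crossing number zero -/
lemma cr_disj {f h : ℝ → ℂ} (hf : Continuous f) (hh : Continuous h) {a b c d : ℝ}
    (hd : ∀ s ∈ uIcc a b, ∀ t ∈ uIcc c d, f s ≠ h t) : cr f a b h c d = 0 := by
  obtain ⟨L, hL, hL'⟩ := exists_lift2 hf hh hd
  have h1 : ∀ t ∈ uIcc c d, IsLift f a b (h t) (fun s => L (s, t)) := fun t ht =>
    ⟨by fun_prop, fun s hs => hL' s hs t ht⟩
  have h2 : ∀ s ∈ uIcc a b, IsLift h c d (f s) (fun t => L (s, t) + 1/2) := fun s hs =>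
    ⟨by fun_prop, fun t ht => by rw [ee_add, ee_half, hL' s hs t ht]; ring⟩
  unfold cr
  rw [V_eq (h1 _ left_mem_uIcc), V_eq (h1 _ right_mem_uIcc), V_eq (h2 _ left_mem_uIcc),
    V_eq (h2 _ right_mem_uIcc)]
  ring

lemma cr_int {f h : ℝ → ℂ} (hf : Continuous f) (hh : Continuous h) {a b c d : ℝ}
    (h1 : ∀ s ∈ uIcc a b, f s ≠ h c) (h2 : ∀ s ∈ uIcc a b, f s ≠ h d)
    (h3 : ∀ t ∈ uIcc c d, h t ≠ f a) (h4 : ∀ t ∈ uIcc c d, h t ≠ f b) :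
    ∃ m : ℤ, cr f a b h c d = m := by
  rw [← ee_eq_one_iff]
  unfold cr
  rw [ee_sub, ee_add, ee_sub, V_ee hf h1, V_ee hf h2, V_ee hh h3, V_ee hh h4]
  have e1 := sub_ne_zero.2 (h1 a left_mem_uIcc)
  have e2 := sub_ne_zero.2 (h1 b right_mem_uIcc)
  have e3 := sub_ne_zero.2 (h2 a left_mem_uIcc)
  have e4 := sub_ne_zero.2 (h2 b right_mem_uIcc)
  have e1' := sub_ne_zero.2 (h1 a left_mem_uIcc).symm
  have e2' := sub_ne_zero.2 (h1 b right_mem_uIcc).symm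
  have e3' := sub_ne_zero.2 (h2 a left_mem_uIcc).symm
  have e4' := sub_ne_zero.2 (h2 b right_mem_uIcc).symm
  field_simp
  ring

lemma cr_add_left {f : ℝ → ℂ} (hf : Continuous f) {x y a b m : ℝ} {h : ℝ → ℂ} {c d : ℝ}
    (h1 : ∀ s ∈ uIcc x y, f s ≠ h c) (h2 : ∀ s ∈ uIcc x y, f s ≠ h d)
    (ha : a ∈ uIcc x y) (hb : b ∈ uIcc x y) (hm : m ∈ uIcc x y) :
    cr f a b h c d + cr f b m h c d = cr f a m h c d := by
  unfold cr
  rw [← V_add hf h1 ha hb hm, ← V_add hf h2 ha hb hm]; ring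

lemma cr_add_right {f : ℝ → ℂ} {a b : ℝ} {h : ℝ → ℂ} (hh : Continuous h) {x y c d m : ℝ}
    (h1 : ∀ s ∈ uIcc x y, h s ≠ f a) (h2 : ∀ s ∈ uIcc x y, h s ≠ f b)
    (hc : c ∈ uIcc x y) (hd : d ∈ uIcc x y) (hm : m ∈ uIcc x y) :
    cr f a b h c d + cr f a b h d m = cr f a b h c m := by
  unfold cr
  rw [← V_add hh h1 hc hd hm, ← V_add hh h2 hc hd hm]; ring

end PC

namespace PC
open Set

/-- parametrized Jordan curve -/
structure JC (g : ℝ → ℂ) : Prop where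
  cont : Continuous g
  per : ∀ t, g (t + 1) = g t
  inj : ∀ s t, g s = g t → ∃ m : ℤ, s = t + m

lemma JC.perZ {g : ℝ → ℂ} (h : JC g) (t : ℝ) (m : ℤ) : g (t + m) = g t := by
  have hp : Function.Periodic g 1 := h.per
  have := hp.int_mul m t
  simpa using this

lemma JC.inj1 {g : ℝ → ℂ} (h : JC g) {s t : ℝ} (hg : g s = g t) (h1 : s < t + 1) (h2 : t < s + 1) :
    s = t := by
  obtain ⟨m, hm⟩ := h.inj s t hg
  have h3 : (m:ℝ) < 1 := by linarith
  have h4 : (-1:ℝ) < m := by linarith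
  have h3' : m < 1 := by exact_mod_cast h3
  have h4' : -1 < m := by exact_mod_cast h4
  have : m = 0 := by omega
  simpa [this] using hm

lemma JC.shift {g : ℝ → ℂ} (h : JC g) (k : ℝ) : JC (fun t => g (t + k)) where
  cont := h.cont.comp (by fun_prop)
  per t := by rw [show t + 1 + k = (t + k) + 1 by ring, h.per]
  inj s t hst := by
    obtain ⟨m, hm⟩ := h.inj _ _ hst
    exact ⟨m, by linarith⟩

lemma JC.rev {g : ℝ → ℂ} (h : JC g) : JC (fun t => g (-t)) where
  cont := h.cont.comp (by fun_prop)
  per t := by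
    have := h.perZ (-(t+1)) 1
    rw [← this]; congr 1; push_cast; ring
  inj s t hst := by
    obtain ⟨m, hm⟩ := h.inj _ _ hst
    exact ⟨-m, by push_cast; linarith⟩

lemma range_shift (g : ℝ → ℂ) (k : ℝ) : range (fun t => g (t + k)) = range g := by
  ext x; constructor
  · rintro ⟨t, rfl⟩; exact ⟨t + k, rfl⟩
  · rintro ⟨t, rfl⟩; exact ⟨t - k, by simp⟩

lemma range_rev (g : ℝ → ℂ) : range (fun t => g (-t)) = range g := by
  ext x; constructor
  · rintro ⟨t, rfl⟩; exact ⟨-t, rfl⟩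
  · rintro ⟨t, rfl⟩; exact ⟨-t, by simp⟩

lemma JC.exists_Ico {g : ℝ → ℂ} (h : JC g) (s : ℝ) {x : ℂ} (hx : x ∈ range g) :
    ∃ t, s ≤ t ∧ t < s + 1 ∧ g t = x := by
  obtain ⟨t, rfl⟩ := hx
  refine ⟨t + ((-⌊t - s⌋ : ℤ) : ℝ), ?_, ?_, h.perZ _ _⟩
  · push_cast; linarith [Int.floor_le (t - s)]
  · push_cast; linarith [Int.lt_floor_add_one (t - s)]

lemma off {g : ℝ → ℂ} {q : ℂ} (hq : q ∉ range g) (t : ℝ) : g t ≠ q := fun h => hq ⟨t, h⟩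

/-- winding number -/
def w (g : ℝ → ℂ) (q : ℂ) : ℤ := round (V g 0 1 q).re

lemma w_spec {g : ℝ → ℂ} (h : JC g) {q : ℂ} (hq : q ∉ range g) : V g 0 1 q = w g q := by
  have := V_ee h.cont (a := 0) (b := 1) (q := q) (fun t _ => off hq t)
  have h1 : g 1 = g 0 := by simpa using h.per 0
  rw [h1, div_self (sub_ne_zero.2 (off hq 0)), ee_eq_one_iff] at this
  obtain ⟨m, hm⟩ := this
  rw [w, hm]; simp

lemma V_shift {g : ℝ → ℂ} (h : Continuous g) {q : ℂ} (hq : q ∉ range g) (a b k : ℝ) :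
    V (fun t => g (t + k)) a b q = V g (a + k) (b + k) q := by
  have := V_comp h (a := a) (b := b) (q := q) 1 k (fun t _ => off hq t)
  simpa using this

lemma V_rev {g : ℝ → ℂ} (h : Continuous g) {q : ℂ} (hq : q ∉ range g) (a b : ℝ) :
    V (fun t => g (-t)) a b q = V g (-a) (-b) q := by
  have := V_comp h (a := a) (b := b) (q := q) (-1) 0 (fun t _ => off hq t)
  simpa using this

lemma V_add' {g : ℝ → ℂ} (h : Continuous g) {q : ℂ} (hq : q ∉ range g) (a b c : ℝ) :
    V g a b q + V g b c q = V g a c q := by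
  refine V_add h (x := min a (min b c)) (y := max a (max b c)) (fun t _ => off hq t) ?_ ?_ ?_ <;>
  · rw [mem_uIcc]; left; simp

lemma V_full {g : ℝ → ℂ} (h : JC g) {q : ℂ} (hq : q ∉ range g) (s : ℝ) :
    V g s (s + 1) q = w g q := by
  have h1 := V_add' h.cont hq 0 s (s+1)
  have h2 := V_add' h.cont hq 0 1 (s+1)
  have h3 := V_shift h.cont hq 0 s 1
  have h4 : (fun t => g (t + 1)) = g := funext h.per
  rw [h4] at h3
  rw [zero_add] at h3
  rw [← w_spec h hq]
  linear_combination h1 - h2 - h3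

lemma w_shift {g : ℝ → ℂ} (h : JC g) {q : ℂ} (hq : q ∉ range g) (k : ℝ) :
    w (fun t => g (t + k)) q = w g q := by
  have h1 := w_spec (h.shift k) (q := q) (by rwa [range_shift])
  rw [V_shift h.cont hq, zero_add, add_comm, V_full h hq] at h1
  exact_mod_cast h1.symm

lemma w_rev {g : ℝ → ℂ} (h : JC g) {q : ℂ} (hq : q ∉ range g) :
    w (fun t => g (-t)) q = - w g q := by
  have h1 := w_spec (h.rev) (q := q) (by rwa [range_rev])
  have h2 := V_full h hq (-1)
  rw [V_rev h.cont hq] at h1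
  have h3 := V_add' h.cont hq (-0) (-1) (-0)
  rw [V_same] at h3
  have h4 : V g (-1) (-0) q = w g q := by rw [← h2]; norm_num
  have : ((w (fun t => g (-t)) q : ℤ) : ℂ) = ((-w g q : ℤ) : ℂ) := by
    push_cast
    linear_combination h3 - h1 - h4
  exact_mod_cast this

lemma cr_full_left {g : ℝ → ℂ} (h : JC g) {f : ℝ → ℂ} {c d : ℝ} (s : ℝ)
    (h1 : f c ∉ range g) (h2 : f d ∉ range g) :
    cr g s (s+1) f c d = w g (f c) - w g (f d) := by
  unfold cr
  rw [V_full h h1, V_full h h2, h.per]; ring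

lemma cr_full_right {g : ℝ → ℂ} (h : JC g) {f : ℝ → ℂ} {c d : ℝ} (s : ℝ)
    (h1 : f c ∉ range g) (h2 : f d ∉ range g) :
    cr f c d g s (s+1) = w g (f d) - w g (f c) := by
  unfold cr
  rw [V_full h h1, V_full h h2, h.per]; ring

/-- the winding number is constant along arcs avoiding the curve -/
lemma w_const {g : ℝ → ℂ} (h : JC g) {f : ℝ → ℂ} (hf : Continuous f) {c d : ℝ}
    (hd : ∀ t ∈ uIcc c d, f t ∉ range g) : w g (f c) = w g (f d) := by
  have h1 := cr_disj h.cont hf (a := 0) (b := 0 + 1) (c := c) (d := d)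
    (fun s _ t ht => off (hd t ht) s)
  rw [cr_full_left h 0 (hd _ left_mem_uIcc) (hd _ right_mem_uIcc)] at h1
  have : ((w g (f c) : ℤ) : ℂ) = w g (f d) := by linear_combination h1
  exact_mod_cast this

def AtMost2 (S : Set ℂ) : Prop := ∀ x ∈ S, ∀ y ∈ S, ∀ z ∈ S, x = y ∨ x = z ∨ y = z

lemma quad {a c : ℝ → ℂ} (ha : JC a) (hc : JC c) {θ φ : ℝ} (hθ : θ ∈ Icc (0:ℝ) 1)
    (hφ : φ ∈ Icc (0:ℝ) 1) (a0 : a 0 ∉ range c) (aθ : a θ ∉ range c) (c0 : c 0 ∉ range a)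
    (cφ : c φ ∉ range a) :
    ∃ x : ℤ, cr a 0 θ c 0 φ = x ∧ cr a θ 1 c 0 φ = ((w a (c 0) - w a (c φ) - x : ℤ) : ℂ) ∧
      cr a 0 θ c φ 1 = ((w c (a θ) - w c (a 0) - x : ℤ) : ℂ) ∧
      cr a θ 1 c φ 1 = ((x - (w c (a θ) - w c (a 0)) - (w a (c 0) - w a (c φ)) : ℤ) : ℂ) := by
  have a1 : a 1 = a 0 := by simpa using ha.per 0
  have c1 : c 1 = c 0 := by simpa using hc.per 0
  obtain ⟨x, hx⟩ := cr_int ha.cont hc.cont (a := 0) (b := θ) (c := 0) (d := φ)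
    (fun s _ => off c0 s) (fun s _ => off cφ s) (fun s _ => off a0 s) (fun s _ => off aθ s)
  have m0 : (0:ℝ) ∈ uIcc (0:ℝ) 1 := left_mem_uIcc
  have m1 : (1:ℝ) ∈ uIcc (0:ℝ) 1 := right_mem_uIcc
  have mθ : θ ∈ uIcc (0:ℝ) 1 := by rwa [uIcc_of_le zero_le_one]
  have mφ : φ ∈ uIcc (0:ℝ) 1 := by rwa [uIcc_of_le zero_le_one]
  have e1 := cr_add_left ha.cont (h := c) (c := 0) (d := φ) (fun s _ => off c0 s) (fun s _ => off cφ s)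
    m0 mθ m1
  have e2 := cr_add_right (f := a) (a := 0) (b := θ) hc.cont (fun s _ => off a0 s)
    (fun s _ => off aθ s) m0 mφ m1
  have e3 := cr_add_right (f := a) (a := θ) (b := 1) hc.cont (fun s _ => off aθ s)
    (fun s _ => off (by rwa [a1]) s) m0 mφ m1
  have f1 := cr_full_left ha (f := c) (c := 0) (d := φ) 0 c0 cφ
  have f2 := cr_full_right hc (f := a) (c := 0) (d := θ) 0 a0 aθ
  have f3 := cr_full_right hc (f := a) (c := θ) (d := 1) 0 aθ (by rwa [a1])
  rw [zero_add] at f1 f2 f3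
  rw [a1] at f3
  refine ⟨x, hx, ?_, ?_, ?_⟩
  · push_cast; linear_combination e1 + f1 - hx
  · push_cast; linear_combination e2 + f2 - hx
  · push_cast; linear_combination e3 + f3 - e1 - f1 + hx

lemma cell {a c : ℝ → ℂ} (ha : JC a) (hc : JC c) {s s' t t' : ℝ} (hs : s < s') (ht : t < t')
    (h0 : cr a s s' c t t' ≠ 0) :
    ∃ x y, s ≤ x ∧ x ≤ s' ∧ t ≤ y ∧ y ≤ t' ∧ a x = c y := by
  by_contra hcon
  push Not at hcon
  apply h0
  apply cr_disj ha.cont hc.cont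
  intro x hx y hy
  rw [uIcc_of_le hs.le] at hx
  rw [uIcc_of_le ht.le] at hy
  exact hcon x y hx.1 hx.2 hy.1 hy.2

section Par
variable {a c : ℝ → ℂ}

/-- a common point in one cell; different cells give different points -/
lemma cell' (ha : JC a) (hc : JC c) {s s' t t' : ℝ} (hs : s < s') (ht : t < t')
    (h1 : a s ∉ range c) (h2 : a s' ∉ range c) (h3 : c t ∉ range a) (h4 : c t' ∉ range a)
    (h0 : cr a s s' c t t' ≠ 0) :
    ∃ x y, s < x ∧ x < s' ∧ t < y ∧ y < t' ∧ a x = c y := by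
  obtain ⟨x, y, hx, hx', hy, hy', h⟩ := cell ha hc hs ht h0
  refine ⟨x, y, lt_of_le_of_ne hx ?_, lt_of_le_of_ne hx' ?_, lt_of_le_of_ne hy ?_,
    lt_of_le_of_ne hy' ?_, h⟩
  · rintro rfl; exact h1 ⟨y, h.symm⟩
  · rintro rfl; exact h2 ⟨y, h.symm⟩
  · rintro rfl; exact h3 ⟨x, h⟩
  · rintro rfl; exact h4 ⟨x, h⟩

lemma P0 (ha : JC a) (hc : JC c) (h2 : AtMost2 (range a ∩ range c)) {θ φ : ℝ}
    (hθ : θ ∈ Ioo (0:ℝ) 1)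
    (hφ : φ ∈ Ioo (0:ℝ) 1) (a0 : a 0 ∉ range c) (aθ : a θ ∉ range c) (c0 : c 0 ∉ range a)
    (cφ : c φ ∉ range a) (wa : (w a (c 0) - w a (c φ)) % 2 = 0)
    (wc : (w c (a 0) - w c (a θ)) % 2 = 0) :
    ∃ x : ℤ, cr a 0 θ c 0 φ = x ∧ x % 2 = 0 := by
  obtain ⟨x, q1, q2, q3, q4⟩ := quad ha hc ⟨hθ.1.le, hθ.2.le⟩ ⟨hφ.1.le, hφ.2.le⟩ a0 aθ c0 cφ
  refine ⟨x, q1, ?_⟩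
  by_contra hx
  have a1 : a 1 = a 0 := by simpa using ha.per 0
  have c1 : c 1 = c 0 := by simpa using hc.per 0
  obtain ⟨x1, y1, r1, r1', s1, s1', e1⟩ := cell' ha hc hθ.1 hφ.1 a0 aθ c0 cφ (by
    rw [q1]; norm_cast; intro h; omega)
  obtain ⟨x2, y2, r2, r2', s2, s2', e2⟩ := cell' ha hc hθ.2 hφ.1 aθ (by rwa [a1]) c0 cφ (by
    rw [q2]; norm_cast; intro h; omega)
  obtain ⟨x3, y3, r3, r3', s3, s3', e3⟩ := cell' ha hc hθ.1 hφ.2 a0 aθ cφ (by rwa [c1]) (by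
    rw [q3]; norm_cast; intro h; omega)
  have hθ1 := hθ.2
  have hφ1 := hφ.2
  rcases h2 (a x1) ⟨⟨_, rfl⟩, ⟨_, e1.symm⟩⟩ (a x2) ⟨⟨_, rfl⟩, ⟨_, e2.symm⟩⟩ (a x3)
    ⟨⟨_, rfl⟩, ⟨_, e3.symm⟩⟩ with h | h | h
  · have := ha.inj1 h (by linarith) (by linarith); linarith
  · rw [e1, e3] at h
    have := hc.inj1 h (by linarith) (by linarith); linarith
  · have := ha.inj1 h (by linarith) (by linarith); linarith

lemma P1 (ha : JC a) (hc : JC c) (h2 : AtMost2 (range a ∩ range c)) {θ φ : ℝ}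
    (hθ : θ ∈ Ioo (0:ℝ) 1)
    (hφ : φ ∈ Ioo (0:ℝ) 1) (a0 : a 0 ∉ range c) (aθ : a θ ∉ range c) (c0 : c 0 ∉ range a)
    (cφ : c φ ∉ range a) (wa : (w a (c 0) - w a (c φ)) % 2 = 0)
    (wc : (w c (a 0) - w c (a θ)) % 2 = 1) {ψ : ℝ} (hψ : ψ ∈ Ioo (0:ℝ) 1) (hψ' : c ψ ∈ range a) :
    ∃ x : ℤ, cr a 0 θ c 0 φ = x ∧ (x % 2 = 1 ↔ ψ < φ) := by
  obtain ⟨x, q1, q2, q3, q4⟩ := quad ha hc ⟨hθ.1.le, hθ.2.le⟩ ⟨hφ.1.le, hφ.2.le⟩ a0 aθ c0 cφ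
  refine ⟨x, q1, ?_⟩
  have a1 : a 1 = a 0 := by simpa using ha.per 0
  have c1 : c 1 = c 0 := by simpa using hc.per 0
  have hθ1 := hθ.2
  have hφ1 := hφ.2
  obtain ⟨hψ0, hψ1⟩ := hψ
  constructor
  · intro hx
    by_contra hlt
    have hlt : φ < ψ := lt_of_le_of_ne (not_lt.1 hlt) (by rintro rfl; exact cφ hψ')
    obtain ⟨x1, y1, r1, r1', s1, s1', e1⟩ := cell' ha hc hθ.1 hφ.1 a0 aθ c0 cφ (by
      rw [q1]; norm_cast; intro h; omega)
    obtain ⟨x2, y2, r2, r2', s2, s2', e2⟩ := cell' ha hc hθ.2 hφ.1 aθ (by rwa [a1]) c0 cφ (by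
      rw [q2]; norm_cast; intro h; omega)
    rcases h2 (a x1) ⟨⟨_, rfl⟩, ⟨_, e1.symm⟩⟩ (a x2) ⟨⟨_, rfl⟩, ⟨_, e2.symm⟩⟩ (c ψ)
      ⟨hψ', ⟨_, rfl⟩⟩ with h | h | h
    · have := ha.inj1 h (by linarith) (by linarith); linarith
    · rw [e1] at h
      have := hc.inj1 h (by linarith) (by linarith); linarith
    · rw [e2] at h
      have := hc.inj1 h (by linarith) (by linarith); linarith
  · intro hlt
    by_contra hx
    obtain ⟨x1, y1, r1, r1', s1, s1', e1⟩ := cell' ha hc hθ.1 hφ.2 a0 aθ cφ (by rwa [c1]) (by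
      rw [q3]; norm_cast; intro h; omega)
    obtain ⟨x2, y2, r2, r2', s2, s2', e2⟩ := cell' ha hc hθ.2 hφ.2 aθ (by rwa [a1]) cφ
      (by rwa [c1]) (by rw [q4]; norm_cast; intro h; omega)
    rcases h2 (a x1) ⟨⟨_, rfl⟩, ⟨_, e1.symm⟩⟩ (a x2) ⟨⟨_, rfl⟩, ⟨_, e2.symm⟩⟩ (c ψ)
      ⟨hψ', ⟨_, rfl⟩⟩ with h | h | h
    · have := ha.inj1 h (by linarith) (by linarith); linarith
    · rw [e1] at h
      have := hc.inj1 h (by linarith) (by linarith); linarith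
    · rw [e2] at h
      have := hc.inj1 h (by linarith) (by linarith); linarith
end Par

/-- Lemma E1 -/
lemma E1 {g : ℝ → ℂ} (hg : JC g) {ρ : ℝ → ℂ} (hρ : Continuous ρ) {σ σ' θ : ℝ}
    (hθ : θ ∈ Ioo (0:ℝ) 1)
    (h1 : ρ σ ∉ range g) (h2 : ρ σ' ∉ range g) (hw : (w g (ρ σ) - w g (ρ σ')) % 2 = 0)
    (h0 : ∀ t ∈ uIcc σ σ', ρ t ≠ g 0) (hθ' : ∀ t ∈ uIcc σ σ', ρ t ≠ g θ)
    (hone : ∀ t ∈ uIcc σ σ', ∀ t' ∈ uIcc σ σ', ρ t ∈ range g → ρ t' ∈ range g → t = t') :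
    ∃ x : ℤ, cr g 0 θ ρ σ σ' = x ∧ x % 2 = 0 := by
  have g1 : g 1 = g 0 := by simpa using hg.per 0
  obtain ⟨x, hx⟩ := cr_int hg.cont hρ (a := 0) (b := θ) (c := σ) (d := σ')
    (fun s _ => off h1 s) (fun s _ => off h2 s) h0 hθ'
  have m0 : (0:ℝ) ∈ uIcc (0:ℝ) 1 := left_mem_uIcc
  have m1 : (1:ℝ) ∈ uIcc (0:ℝ) 1 := right_mem_uIcc
  have mθ : θ ∈ uIcc (0:ℝ) 1 := by rw [uIcc_of_le zero_le_one]; exact ⟨hθ.1.le, hθ.2.le⟩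
  have e1 := cr_add_left hg.cont (h := ρ) (c := σ) (d := σ') (fun s _ => off h1 s)
    (fun s _ => off h2 s) m0 mθ m1
  have f1 := cr_full_left hg (f := ρ) 0 h1 h2
  rw [zero_add] at f1
  refine ⟨x, hx, ?_⟩
  by_contra hodd
  have k1 : cr g 0 θ ρ σ σ' ≠ 0 := by rw [hx]; norm_cast; intro h; omega
  have k2 : cr g θ 1 ρ σ σ' ≠ 0 := by
    have : cr g θ 1 ρ σ σ' = ((w g (ρ σ) - w g (ρ σ') - x : ℤ) : ℂ) := by
      push_cast; linear_combination e1 + f1 - hx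
    rw [this]; norm_cast; intro h; omega
  have j1 : ∃ s ∈ uIcc 0 θ, ∃ t ∈ uIcc σ σ', g s = ρ t := by
    by_contra hcon; push Not at hcon
    exact k1 (cr_disj hg.cont hρ hcon)
  have j2 : ∃ s ∈ uIcc θ 1, ∃ t ∈ uIcc σ σ', g s = ρ t := by
    by_contra hcon; push Not at hcon
    exact k2 (cr_disj hg.cont hρ hcon)
  obtain ⟨s, hs, t, ht, hst⟩ := j1
  obtain ⟨s', hs', t', ht', hst'⟩ := j2
  rw [uIcc_of_le hθ.1.le] at hs
  rw [uIcc_of_le hθ.2.le] at hs'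
  have htt := hone t ht t' ht' ⟨s, hst⟩ ⟨s', hst'⟩
  subst htt
  have hs0 : s ≠ 0 := by rintro rfl; exact h0 t ht hst.symm
  have hsp : 0 < s := lt_of_le_of_ne hs.1 (Ne.symm hs0)
  have hss := hg.inj1 (hst.trans hst'.symm) (by linarith [hs.2, hs'.1]) (by linarith [hs'.2])
  have : s = θ := le_antisymm hs.2 (by rw [hss]; exact hs'.1)
  subst this
  exact hθ' t ht hst.symm

end PC

namespace PC
open Finset

structure Good {α : Type*} (adj : α → α → Prop) (s : α → α → ℤ) (x : α → α → α → ℤ) : Prop where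
  symm : ∀ a b, adj a b → adj b a
  irr : ∀ a, ¬ adj a a
  santi : ∀ a b, a ≠ b → (s a b + s b a) % 2 = 1
  xsymm : ∀ a b c, adj a b → a ≠ c → b ≠ c → (x a b c - x b a c) % 2 = 0
  main : ∀ a b c d, a ≠ c → a ≠ d → b ≠ c → b ≠ d → adj a b → adj c d →
    (s a c + s a d + s b c + s b d - (x a b c + x a b d + x c d a + x c d b)) % 2 = 0

variable {α : Type*}

lemma Good.noK5 {adj : α → α → Prop} {s : α → α → ℤ} {x : α → α → α → ℤ} (h : Good adj s x)
    {a b c d e : α} (ab : adj a b) (ac : adj a c) (ad : adj a d) (ae : adj a e) (bc : adj b c)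
    (bd : adj b d) (be : adj b e) (cd : adj c d) (ce : adj c e) (de : adj d e) : False := by
  have ne : ∀ {p q}, adj p q → p ≠ q := fun hpq => by rintro rfl; exact h.irr _ hpq
  have nab := ne ab
  have nac := ne ac
  have nad := ne ad
  have nae := ne ae
  have nbc := ne bc
  have nbd := ne bd
  have nbe := ne be
  have ncd := ne cd
  have nce := ne ce
  have nde := ne de
  have key : ∀ p q r t, p ≠ q → p ≠ r → p ≠ t → q ≠ r → q ≠ t → r ≠ t → adj p q → adj p r →
      adj p t → adj q r → adj q t → adj r t →
      ((x p q r + x p q t + x r t p + x r t q) + (x p r q + x p r t + x q t p + x q t r) +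
        (x p t q + x p t r + x q r p + x q r t)) % 2 = 1 := by
    intro p q r t n1 n2 n3 n4 n5 n6 a1 a2 a3 a4 a5 a6
    have m1 := h.main p q r t n2 n3 n4 n5 a1 a6
    have m2 := h.main p r q t n1 n3 n4.symm n6 a2 a5
    have m3 := h.main p t q r n1 n2 n5.symm n6.symm a3 a4
    have s1 := h.santi q r n4
    have s2 := h.santi q t n5
    have s3 := h.santi r t n6
    omega
  have k1 := key a b c d nab nac nad nbc nbd ncd ab ac ad bc bd cd
  have k2 := key a b c e nab nac nae nbc nbe nce ab ac ae bc be ce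
  have k3 := key a b d e nab nad nae nbd nbe nde ab ad ae bd be de
  have k4 := key a c d e nac nad nae ncd nce nde ac ad ae cd ce de
  have k5 := key b c d e nbc nbd nbe ncd nce nde bc bd be cd ce de
  omega

/-- contraction of the edge `u v` into `u` -/
def cAdj (adj : α → α → Prop) (u v : α) (a b : α) : Prop :=
  a ≠ v ∧ b ≠ v ∧ (adj a b ∨ (a = u ∧ b ≠ u ∧ adj v b) ∨ (b = u ∧ a ≠ u ∧ adj v a))

open Classical in
def cX (adj : α → α → Prop) (u v : α) (x : α → α → α → ℤ) (a b c : α) : ℤ :=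
  if adj a b then x a b c else if a = u then x v b c + x u v c else x v a c + x u v c

lemma Good.contract {adj : α → α → Prop} {s : α → α → ℤ} {x : α → α → α → ℤ} (h : Good adj s x)
    {u v : α} (uv : adj u v) : Good (cAdj adj u v) s (cX adj u v x) where
  symm := by
    rintro a b ⟨h1, h2, h3⟩
    refine ⟨h2, h1, ?_⟩
    rcases h3 with h3 | h3 | h3
    · exact Or.inl (h.symm _ _ h3)
    · exact Or.inr (Or.inr h3)
    · exact Or.inr (Or.inl h3)
  irr := by
    rintro a ⟨h1, h2, h3⟩
    rcases h3 with h3 | h3 | h3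
    · exact h.irr _ h3
    · exact h3.2.1 h3.1
    · exact h3.2.1 h3.1
  santi := h.santi
  xsymm := by
    rintro a b c ⟨h1, h2, h3⟩ hac hbc
    by_cases hab : adj a b
    · rw [cX, cX, if_pos hab, if_pos (h.symm _ _ hab)]
      exact h.xsymm a b c hab hac hbc
    · have hba : ¬ adj b a := fun h' => hab (h.symm _ _ h')
      rw [cX, cX, if_neg hab, if_neg hba]
      rcases h3 with h3 | ⟨rfl, h3, -⟩ | ⟨rfl, h3, -⟩
      · exact absurd h3 hab
      · rw [if_pos rfl, if_neg h3]; simp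
      · rw [if_pos rfl, if_neg h3]; simp
  main := by
    have key : ∀ y c d, u ≠ c → u ≠ d → y ≠ c → y ≠ d → u ≠ v → y ≠ v → c ≠ v → d ≠ v → y ≠ u →
        adj v y → adj c d →
        (s u c + s u d + s y c + s y d - (x v y c + x u v c + (x v y d + x u v d) +
          x c d u + x c d y)) % 2 = 0 := by
      intro y c d n1 n2 n3 n4 n5 n6 n7 n8 n9 hy hcd
      have m1 := h.main v y c d n7.symm n8.symm n3 n4 hy hcd
      have m2 := h.main u v c d n1 n2 n7.symm n8.symm uv hcd
      omega
    have nuv : u ≠ v := by rintro rfl; exact h.irr _ uv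
    rintro a b c d ac ad bc bd ⟨av, bv, hab⟩ ⟨cv, dv, hcd⟩
    by_cases h1 : adj a b
    · by_cases h2 : adj c d
      · simp only [cX, if_pos h1, if_pos h2]
        exact h.main a b c d ac ad bc bd h1 h2
      · simp only [cX, if_pos h1, if_neg h2]
        have q1 := h.santi
        rcases hcd with hcd | ⟨rfl, hcd, hc⟩ | ⟨rfl, hcd, hc⟩
        · exact absurd hcd h2
        · simp only [if_true]
          have := key d a b ac.symm bc.symm ad.symm bd.symm nuv dv av bv hcd hc h1
          have := q1 a c ac
          have := q1 a d ad
          have := q1 b c bc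
          have := q1 b d bd
          omega
        · simp only [if_neg hcd]
          have := key c a b ad.symm bd.symm ac.symm bc.symm nuv cv av bv hcd hc h1
          have := q1 a c ac
          have := q1 a d ad
          have := q1 b c bc
          have := q1 b d bd
          omega
    · rcases hab with hab | ⟨rfl, hab, hb⟩ | ⟨rfl, hab, hb⟩
      · exact absurd hab h1
      · rcases hcd with hcd | ⟨rfl, hcd, hc⟩ | ⟨rfl, hcd, hc⟩
        · simp only [cX, if_pos hcd, if_neg h1, if_true]
          have := key b c d ac ad bc bd nuv bv cv dv hab hb hcd
          omega
        · exact absurd rfl ac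
        · exact absurd rfl ad
      · rcases hcd with hcd | ⟨rfl, hcd, hc⟩ | ⟨rfl, hcd, hc⟩
        · simp only [cX, if_pos hcd, if_neg h1, if_neg hab]
          have := key a c d bc bd ac ad nuv av cv dv hab hb hcd
          omega
        · exact absurd rfl bc
        · exact absurd rfl bd

open Classical in
/-- ordered number of edges inside `H` -/
def eN (adj : α → α → Prop) (H : Finset α) : ℕ := ((H ×ˢ H).filter (fun p => adj p.1 p.2)).card

open Classical in
lemma eN_contract {adj : α → α → Prop} (hsymm : ∀ a b, adj a b → adj b a) (hirr : ∀ a, ¬ adj a a)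
    {H : Finset α} {u v : α} (hu : u ∈ H) (hv : v ∈ H) (uv : adj u v) :
    eN adj H ≤ eN (cAdj adj u v) (H.erase v) + 2 * (1 + (H.filter (fun y => adj u y ∧ adj v y)).card) := by
  set D := H.filter (fun y => adj v y) with hD
  set K := H.filter (fun y => adj u y ∧ adj v y) with hK
  set Y := H.filter (fun y => adj v y ∧ y ≠ u ∧ ¬ adj u y) with hY
  have nuv : u ≠ v := by rintro rfl; exact hirr _ uv
  have h1 : eN adj H ≤ eN adj (H.erase v) + 2 * D.card := by
    have : ((H ×ˢ H).filter (fun p => adj p.1 p.2)) ⊆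
        (((H.erase v) ×ˢ (H.erase v)).filter (fun p => adj p.1 p.2)) ∪
        (D.image (fun y => (v, y)) ∪ D.image (fun y => (y, v))) := by
      rintro ⟨p, q⟩ hp
      simp only [mem_filter, mem_product] at hp
      obtain ⟨⟨hp, hq⟩, ha⟩ := hp
      simp only [mem_union, mem_filter, mem_product, mem_erase, mem_image, hD, Prod.mk.injEq]
      by_cases e1 : p = v
      · subst e1
        exact Or.inr (Or.inl ⟨q, ⟨hq, ha⟩, rfl, rfl⟩)
      · by_cases e2 : q = v
        · subst e2
          exact Or.inr (Or.inr ⟨p, ⟨hp, hsymm _ _ ha⟩, rfl, rfl⟩)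
        · exact Or.inl ⟨⟨⟨e1, hp⟩, ⟨e2, hq⟩⟩, ha⟩
    have h2 := card_le_card this
    have h3 := card_union_le (((H.erase v) ×ˢ (H.erase v)).filter (fun p => adj p.1 p.2))
        (D.image (fun y => (v, y)) ∪ D.image (fun y => (y, v)))
    have h4 := card_union_le (D.image (fun y => (v, y))) (D.image (fun y => (y, v)))
    have h5 := card_image_le (s := D) (f := fun y => (v, y))
    have h6 := card_image_le (s := D) (f := fun y => (y, v))
    unfold eN
    omega
  have h2 : D.card ≤ 1 + K.card + Y.card := by
    have : D ⊆ ({u} ∪ K) ∪ Y := by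
      intro y hy
      simp only [hD, mem_filter] at hy
      simp only [mem_union, mem_singleton, hK, hY, mem_filter]
      by_cases e1 : y = u
      · tauto
      · by_cases e2 : adj u y <;> tauto
    have h3 := card_le_card this
    have h4 := card_union_le ({u} ∪ K) Y
    have h5 := card_union_le {u} K
    simp only [card_singleton] at h5
    omega
  have h3 : eN adj (H.erase v) + 2 * Y.card ≤ eN (cAdj adj u v) (H.erase v) := by
    have hd1 : Disjoint (((H.erase v) ×ˢ (H.erase v)).filter (fun p => adj p.1 p.2))
        (Y.image (fun y => (u, y))) := by
      rw [disjoint_left]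
      rintro ⟨p, q⟩ hp hq
      simp only [mem_filter, mem_image, hY, Prod.mk.injEq] at hp hq
      obtain ⟨y, hy, rfl, rfl⟩ := hq
      exact hy.2.2.2 hp.2
    have hd2 : Disjoint ((((H.erase v) ×ˢ (H.erase v)).filter (fun p => adj p.1 p.2)) ∪
        (Y.image (fun y => (u, y)))) (Y.image (fun y => (y, u))) := by
      rw [disjoint_left]
      rintro ⟨p, q⟩ hp hq
      simp only [mem_union, mem_filter, mem_image, hY, Prod.mk.injEq] at hp hq
      obtain ⟨y, hy, rfl, rfl⟩ := hq
      rcases hp with hp | ⟨y', hy', h, h'⟩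
      · exact hy.2.2.2 (hsymm _ _ hp.2)
      · exact hy.2.2.1 h.symm
    have hsub : ((((H.erase v) ×ˢ (H.erase v)).filter (fun p => adj p.1 p.2)) ∪
        (Y.image (fun y => (u, y)))) ∪ (Y.image (fun y => (y, u))) ⊆
        ((H.erase v) ×ˢ (H.erase v)).filter (fun p => cAdj adj u v p.1 p.2) := by
      rintro ⟨p, q⟩ hp
      simp only [mem_union, mem_filter, mem_image, hY, Prod.mk.injEq, mem_product, mem_erase] at hp
      rw [mem_filter]
      simp only [mem_product, mem_erase, cAdj]
      have hyv : ∀ y, adj v y → y ≠ v := by rintro y hy rfl; exact hirr _ hy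
      rcases hp with (hp | ⟨y, hy, rfl, rfl⟩) | ⟨y, hy, rfl, rfl⟩
      · tauto
      · have := hyv y hy.2.1
        tauto
      · have := hyv y hy.2.1
        tauto
    have h4 := card_le_card hsub
    rw [card_union_of_disjoint hd2, card_union_of_disjoint hd1,
      card_image_of_injective _ (fun a b h => by simpa using h),
      card_image_of_injective _ (fun a b h => by simpa using h)] at h4
    unfold eN
    omega
  omega

open Classical in
/-- the inductive linear bound -/
lemma Good.bound_aux (C C' t : ℕ) (hC : C = 2 * C' + 1)
    (IH : ∀ (adj : α → α → Prop) (s : α → α → ℤ) (x : α → α → α → ℤ), Good adj s x →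
      ∀ (T H : Finset α), T.card = t + 1 → (∀ a ∈ T, ∀ b ∈ T, a ≠ b → adj a b) →
      (∀ a ∈ T, ∀ b ∈ H, adj a b) → eN adj H ≤ 2 * C' * H.card) :
    ∀ (n : ℕ) (adj : α → α → Prop) (s : α → α → ℤ) (x : α → α → α → ℤ), Good adj s x →
      ∀ (T H : Finset α), H.card = n → T.card = t → (∀ a ∈ T, ∀ b ∈ T, a ≠ b → adj a b) →
      (∀ a ∈ T, ∀ b ∈ H, adj a b) → eN adj H ≤ 2 * C * H.card := by
  intro n
  induction n with
  | zero =>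
    intro adj s x h T H hH hT h1 h2
    rw [card_eq_zero] at hH
    subst hH
    simp [eN]
  | succ n ih =>
    intro adj s x h T H hH hT h1 h2
    by_cases hex : ∃ u ∈ H, ∃ v ∈ H, adj u v ∧ (H.filter (fun y => adj u y ∧ adj v y)).card + 1 ≤ C
    · obtain ⟨u, hu, v, hv, uv, hk⟩ := hex
      have hc := eN_contract h.symm h.irr hu hv uv
      have hvT : ∀ a ∈ T, a ≠ v := by
        rintro a ha rfl
        exact h.irr _ (h2 _ ha _ hv)
      have := ih _ _ _ (h.contract uv) T (H.erase v) (by rw [card_erase_of_mem hv, hH]; rfl) hT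
        (fun a ha b hb hab => ⟨hvT a ha, hvT b hb, Or.inl (h1 a ha b hb hab)⟩)
        (fun a ha b hb => ⟨hvT a ha, (mem_erase.1 hb).1, Or.inl (h2 a ha b (mem_erase.1 hb).2)⟩)
      rw [card_erase_of_mem hv, hH] at this
      rw [hH]
      simp only [Nat.add_sub_cancel] at this
      have e : 2 * C * (n + 1) = 2 * C * n + 2 * C := by ring
      omega
    · push Not at hex
      by_cases hE : ∃ p ∈ H, ∃ q ∈ H, adj p q
      · obtain ⟨p, hp, q, hq, pq⟩ := hE
        set N := H.filter (fun y => adj p y) with hN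
        have hpT : p ∉ T := fun hpT => h.irr _ (h2 p hpT p hp)
        have hb := IH adj s x h (insert p T) N (by rw [card_insert_of_notMem hpT, hT])
          (by
            intro a ha b hb hab
            rw [mem_insert] at ha hb
            rcases ha with rfl | ha
            · rcases hb with rfl | hb
              · exact absurd rfl hab
              · exact h.symm _ _ (h2 b hb a hp)
            · rcases hb with rfl | hb
              · exact h2 a ha b hp
              · exact h1 a ha b hb hab)
          (by
            intro a ha b hb
            rw [hN, mem_filter] at hb
            rw [mem_insert] at ha
            rcases ha with rfl | ha
            · exact hb.2
            · exact h2 a ha b hb.1)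
        have hlow : N.card * C ≤ eN adj N := by
          have : eN adj N = ∑ a ∈ N, (N.filter (fun y => adj a y)).card := by
            unfold eN
            rw [card_filter, sum_product]
            apply sum_congr rfl
            intro a _
            rw [card_filter]
          rw [this]
          apply card_nsmul_le_sum
          intro a ha
          rw [hN, mem_filter] at ha
          have := hex p hp a ha.1 ha.2
          rw [hN, filter_filter]
          omega
        have hpos : 0 < N.card := card_pos.2 ⟨q, by rw [hN, mem_filter]; exact ⟨hq, pq⟩⟩
        subst hC
        nlinarith
      · push Not at hE
        have : eN adj H = 0 := by
          unfold eN
          rw [card_eq_zero, filter_eq_empty_iff]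
          rintro ⟨p, q⟩ hpq
          rw [mem_product] at hpq
          exact hE p hpq.1 q hpq.2
        omega

lemma Good.bound {adj : α → α → Prop} {s : α → α → ℤ} {x : α → α → α → ℤ} (h : Good adj s x)
    (H : Finset α) : eN adj H ≤ 14 * H.card := by
  classical
  have c3 : ∀ (adj : α → α → Prop) (s : α → α → ℤ) (x : α → α → α → ℤ), Good adj s x →
      ∀ (T H : Finset α), T.card = 3 → (∀ a ∈ T, ∀ b ∈ T, a ≠ b → adj a b) →
      (∀ a ∈ T, ∀ b ∈ H, adj a b) → eN adj H ≤ 2 * 0 * H.card := by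
    intro adj s x h T H hT h1 h2
    obtain ⟨a, b, c, hab, hac, hbc, rfl⟩ := card_eq_three.1 hT
    have : eN adj H = 0 := by
      unfold eN
      rw [card_eq_zero, filter_eq_empty_iff]
      rintro ⟨p, q⟩ hpq hadj
      rw [mem_product] at hpq
      exact h.noK5 (h1 a (by simp) b (by simp) hab) (h1 a (by simp) c (by simp) hac)
        (h2 a (by simp) p hpq.1) (h2 a (by simp) q hpq.2) (h1 b (by simp) c (by simp) hbc)
        (h2 b (by simp) p hpq.1) (h2 b (by simp) q hpq.2)
        (h2 c (by simp) p hpq.1) (h2 c (by simp) q hpq.2) hadj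
    omega
  have c2 := fun adj s x h T H => Good.bound_aux (α := α) 1 0 2 rfl c3 _ adj s x h T H rfl
  have c1 := fun adj s x h T H => Good.bound_aux (α := α) 3 1 1 rfl c2 _ adj s x h T H rfl
  have c0 := Good.bound_aux (α := α) 7 3 0 rfl c1 _ adj s x h ∅ H rfl rfl (by simp) (by simp)
  exact c0

end PC

namespace PC
open Set

structure Rep (g g' : ℝ → ℂ) : Prop where
  jc : JC g'
  rng : range g' = range g
  par : ∀ q, q ∉ range g → (w g' q - w g q) % 2 = 0

lemma Rep.shift {g : ℝ → ℂ} (h : JC g) (k : ℝ) : Rep g (fun t => g (t + k)) :=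
  ⟨h.shift k, range_shift g k, fun q hq => by rw [w_shift h hq]; simp⟩

lemma Rep.rev {g : ℝ → ℂ} (h : JC g) : Rep g (fun t => g (-t)) :=
  ⟨h.rev, range_rev g, fun q hq => by rw [w_rev h hq]; omega⟩

lemma Rep.refl {g : ℝ → ℂ} (h : JC g) : Rep g g := ⟨h, rfl, fun q _ => by simp⟩

lemma Rep.trans {g g' g'' : ℝ → ℂ} (h : Rep g g') (h' : Rep g' g'') : Rep g g'' :=
  ⟨h'.jc, h'.rng.trans h.rng, fun q hq => by
    have h1 := h.par q hq
    have h2 := h'.par q (by rwa [h.rng])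
    omega⟩

structure FC (ρ g : ℝ → ℂ) (τ : ℝ) : Prop where
  r0 : ρ 0 ∉ range g
  r1 : ρ 1 ∉ range g
  t0 : 0 < τ
  t1 : τ < 1
  mem : ρ τ ∈ range g
  uniq : ∀ σ ∈ Icc (0:ℝ) 1, ∀ σ' ∈ Icc (0:ℝ) 1, σ ≠ τ → σ' ≠ τ → ρ σ ∈ range g → ρ σ' ∈ range g →
    σ = σ'
  lo : ∀ σ ∈ Icc (0:ℝ) 1, σ < τ → ρ σ ∉ range g → (w g (ρ σ) - w g (ρ 0)) % 2 = 0
  hi : ∀ σ ∈ Icc (0:ℝ) 1, τ < σ → ρ σ ∉ range g → (w g (ρ σ) - w g (ρ 1)) % 2 = 0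
  odd : (w g (ρ 1) - w g (ρ 0)) % 2 = 1

lemma FC.rep {ρ g g' : ℝ → ℂ} {τ : ℝ} (h : FC ρ g τ) (hr : Rep g g') : FC ρ g' τ := by
  have p0 := hr.par _ h.r0
  have p1 := hr.par _ h.r1
  have ho := h.odd
  constructor
  · rw [hr.rng]; exact h.r0
  · rw [hr.rng]; exact h.r1
  · exact h.t0
  · exact h.t1
  · rw [hr.rng]; exact h.mem
  · rw [hr.rng]; exact h.uniq
  · rw [hr.rng]
    intro σ hσ h1 h2
    have := h.lo σ hσ h1 h2
    have := hr.par _ h2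
    omega
  · rw [hr.rng]
    intro σ hσ h1 h2
    have := h.hi σ hσ h1 h2
    have := hr.par _ h2
    omega
  · omega

structure IsG (ρ : ℝ → ℂ) (G : ℝ → ℝ → ℂ) : Prop where
  ee : ∀ y ∈ Ioo (0:ℝ) 1, ∀ x ∈ Ioo (0:ℝ) 1, x ≠ y → ee (G y x) = ρ y - ρ x
  half : ∀ y ∈ Ioo (0:ℝ) 1, ∀ x ∈ Ioo (0:ℝ) 1, x < y → G x y = G y x + 1/2
  lt : ∀ τ ∈ Ioo (0:ℝ) 1, ∀ σ ∈ Ioo (0:ℝ) 1, ∀ σ' ∈ Ioo (0:ℝ) 1, σ < τ → σ' < τ →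
    V ρ σ σ' (ρ τ) = G τ σ' - G τ σ
  gt : ∀ τ ∈ Ioo (0:ℝ) 1, ∀ σ ∈ Ioo (0:ℝ) 1, ∀ σ' ∈ Ioo (0:ℝ) 1, τ < σ → τ < σ' →
    V ρ σ σ' (ρ τ) = G τ σ' - G τ σ

lemma exists_G {ρ : ℝ → ℂ} (hρ : Continuous ρ) (hi : InjOn ρ (Icc 0 1)) : ∃ G, IsG ρ G := by
  set U : Set (ℝ × ℝ) := {p | 0 < p.1 ∧ p.1 < p.2 ∧ p.2 < 1} with hU
  have hUo : IsOpen U := by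
    have a1 : IsOpen {p : ℝ × ℝ | 0 < p.1} := isOpen_lt (by fun_prop) (by fun_prop)
    have a2 : IsOpen {p : ℝ × ℝ | p.1 < p.2} := isOpen_lt (by fun_prop) (by fun_prop)
    have a3 : IsOpen {p : ℝ × ℝ | p.2 < 1} := isOpen_lt (by fun_prop) (by fun_prop)
    exact a1.inter (a2.inter a3)
  have hUc : Convex ℝ U := by
    rintro ⟨a, b⟩ ⟨h1, h2, h3⟩ ⟨c, d⟩ ⟨h4, h5, h6⟩ s t hs ht hst
    simp only at h1 h2 h3 h4 h5 h6
    simp only [hU, mem_ofPred_eq, Prod.smul_mk, Prod.mk_add_mk, smul_eq_mul]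
    rcases eq_or_lt_of_le hs with rfl | hs
    · have : t = 1 := by linarith
      subst this
      simp [h4, h5, h6]
    · refine ⟨?_, ?_, ?_⟩ <;> nlinarith
  obtain ⟨L, hL, hL'⟩ := exists_log2 hUo hUc ⟨(1/4, 1/2), by norm_num [hU]⟩
    (F := fun p => ρ p.2 - ρ p.1) (by apply Continuous.continuousOn; fun_prop)
    (by
      rintro ⟨x, y⟩ ⟨h1, h2, h3⟩
      simp only at h1 h2 h3
      rw [sub_ne_zero]
      intro h
      have := hi ⟨by linarith, by linarith⟩ ⟨by linarith, by linarith⟩ h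
      linarith)
  refine ⟨fun y x => if x < y then L (x, y) else L (y, x) + 1/2, ?_, ?_, ?_, ?_⟩
  · intro y hy x hx hxy
    split_ifs with h
    · exact hL' (x, y) ⟨hx.1, h, hy.2⟩
    · rw [ee_add, ee_half, hL' (y, x) ⟨hy.1, lt_of_le_of_ne (not_lt.1 h) hxy.symm, hx.2⟩]
      ring
  · intro y hy x hx hxy
    rw [if_neg (by linarith), if_pos hxy]
  · intro τ hτ σ hσ σ' hσ' h h'
    have hsub : ∀ t ∈ uIcc σ σ', (t, τ) ∈ U := by
      intro t ht
      rw [mem_uIcc] at ht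
      have := hσ.1
      have := hσ'.1
      refine ⟨?_, ?_, hτ.2⟩
      · rcases ht with ht | ht <;> simp only <;> linarith
      · rcases ht with ht | ht <;> simp only <;> linarith
    rw [V_eq (L := fun t => L (t, τ) + 1/2)]
    · simp only [if_pos h, if_pos h']; ring
    · refine ⟨?_, fun t ht => ?_⟩
      · exact (hL.comp (by fun_prop) hsub).add continuousOn_const
      · rw [ee_add, ee_half, hL' _ (hsub t ht)]; ring
  · intro τ hτ σ hσ σ' hσ' h h'
    have hsub : ∀ t ∈ uIcc σ σ', (τ, t) ∈ U := by
      intro t ht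
      rw [mem_uIcc] at ht
      have := hσ.2
      have := hσ'.2
      refine ⟨hτ.1, ?_, ?_⟩
      · rcases ht with ht | ht <;> simp only <;> linarith
      · rcases ht with ht | ht <;> simp only <;> linarith
    rw [V_eq (L := fun t => L (τ, t))]
    · simp only [if_neg h.not_gt, if_neg h'.not_gt]; ring
    · refine ⟨?_, fun t ht => ?_⟩
      · exact (hL.comp (by fun_prop) hsub)
      · rw [hL' _ (hsub t ht)]

/-- the function `X` -/
def XX (ρ : ℝ → ℂ) (G : ℝ → ℝ → ℂ) (g : ℝ → ℂ) (τ θ σ : ℝ) : ℂ :=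
  V g 0 θ (ρ σ) - V ρ (1/2) σ (g θ) + G τ σ

lemma Ioo_sub {σ σ' t : ℝ} (h : σ ∈ Ioo (0:ℝ) 1) (h' : σ' ∈ Ioo (0:ℝ) 1) (ht : t ∈ uIcc σ σ') :
    t ∈ Ioo (0:ℝ) 1 := by
  rw [mem_uIcc] at ht
  obtain ⟨h1, h2⟩ := h
  obtain ⟨h3, h4⟩ := h'
  constructor <;> rcases ht with ht | ht <;> linarith

section dir
variable {ρ g : ℝ → ℂ} {τ : ℝ} {G : ℝ → ℝ → ℂ}

def Off (ρ : ℝ → ℂ) (u : ℂ) : Prop := ∀ t ∈ Icc (0:ℝ) 1, ρ t ≠ u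

lemma XX_int (hρ : Continuous ρ) (hG : IsG ρ G) (hg : JC g) (hF : FC ρ g τ) (h0 : g 0 = ρ τ)
    {θ : ℝ} (hθ : Off ρ (g θ)) {σ σ' : ℝ} (hσ : σ ∈ Ioo (0:ℝ) 1)
    (hσ' : σ' ∈ Ioo (0:ℝ) 1) (n1 : ρ σ ∉ range g) (n2 : ρ σ' ∉ range g) :
    ∃ m : ℤ, XX ρ G g τ θ σ - XX ρ G g τ θ σ' = m := by
  have key : ∀ σ ∈ Ioo (0:ℝ) 1, ρ σ ∉ range g → ee (XX ρ G g τ θ σ) = g θ - ρ (1/2) := by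
    intro σ hσ hn
    have hne : σ ≠ τ := by rintro rfl; exact hn hF.mem
    unfold XX
    rw [ee_add, ee_sub, V_ee hg.cont (fun t _ => off hn t), V_ee hρ (fun t ht => hθ t
      (Ioo_subset_Icc_self (Ioo_sub (by norm_num) hσ ht))), hG.ee τ ⟨hF.t0, hF.t1⟩ σ hσ hne, h0]
    have e1 : g θ - ρ σ ≠ 0 := sub_ne_zero.2 (off hn θ)
    have e1' : ρ σ - g θ ≠ 0 := sub_ne_zero.2 (off hn θ).symm
    have e2 : ρ (1/2) - g θ ≠ 0 := sub_ne_zero.2 (hθ _ (by norm_num))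
    have e3 : ρ τ - ρ σ ≠ 0 := by rw [← h0]; exact sub_ne_zero.2 (off hn 0)
    field_simp
    ring
  have h1 := key σ hσ n1
  rw [← key σ' hσ' n2, ee_eq_iff] at h1
  obtain ⟨m, hm⟩ := h1
  exact ⟨m, by rw [hm]; ring⟩

lemma V_half (hρ : Continuous ρ) {u : ℂ} (hu : Off ρ u) {σ σ' : ℝ} (hσ : σ ∈ Ioo (0:ℝ) 1)
    (hσ' : σ' ∈ Ioo (0:ℝ) 1) : V ρ (1/2) σ' u - V ρ (1/2) σ u = V ρ σ σ' u := by
  have h := V_add hρ (x := 0) (y := 1) (q := u) (a := 1/2) (b := σ) (c := σ')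
    (fun t ht => hu t (by rwa [uIcc_of_le zero_le_one] at ht))
    (by rw [uIcc_of_le zero_le_one]; norm_num)
    (by rw [uIcc_of_le zero_le_one]; exact Ioo_subset_Icc_self hσ)
    (by rw [uIcc_of_le zero_le_one]; exact Ioo_subset_Icc_self hσ')
  rw [← h]; ring

lemma XX_side (hρ : Continuous ρ) (hi : InjOn ρ (Icc 0 1)) (hG : IsG ρ G) (hg : JC g)
    (hF : FC ρ g τ) (h0 : g 0 = ρ τ)
    {θ : ℝ} (hθ1 : θ ∈ Ioo (0:ℝ) 1) (hθ : Off ρ (g θ)) {σ σ' : ℝ} (hσ : σ ∈ Ioo (0:ℝ) 1)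
    (hσ' : σ' ∈ Ioo (0:ℝ) 1) (n1 : ρ σ ∉ range g) (n2 : ρ σ' ∉ range g)
    (hs : (σ < τ ∧ σ' < τ) ∨ (τ < σ ∧ τ < σ')) :
    ∃ m : ℤ, XX ρ G g τ θ σ - XX ρ G g τ θ σ' = m ∧ m % 2 = 0 := by
  have hne : ∀ t ∈ uIcc σ σ', t ≠ τ := by
    rintro t ht rfl
    rw [mem_uIcc] at ht
    rcases hs with ⟨a, b⟩ | ⟨a, b⟩ <;> rcases ht with ht | ht <;> linarith
  have hI : ∀ t ∈ uIcc σ σ', t ∈ Icc (0:ℝ) 1 :=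
    fun t ht => Ioo_subset_Icc_self (Ioo_sub hσ hσ' ht)
  have hτ : τ ∈ Icc (0:ℝ) 1 := ⟨hF.t0.le, hF.t1.le⟩
  obtain ⟨m, hm, hm2⟩ := E1 hg hρ hθ1 n1 n2 (by
      rcases hs with ⟨a, b⟩ | ⟨a, b⟩
      · have := hF.lo σ (Ioo_subset_Icc_self hσ) a n1
        have := hF.lo σ' (Ioo_subset_Icc_self hσ') b n2
        omega
      · have := hF.hi σ (Ioo_subset_Icc_self hσ) a n1
        have := hF.hi σ' (Ioo_subset_Icc_self hσ') b n2
        omega)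
    (fun t ht h => hne t ht (hi (hI t ht) hτ (h.trans h0)))
    (fun t ht => hθ t (hI t ht))
    (fun t ht t' ht' h h' => hF.uniq t (hI t ht) t' (hI t' ht') (hne t ht) (hne t' ht') h h')
  refine ⟨m, ?_, hm2⟩
  rw [← hm]
  have e1 := V_half hρ hθ hσ hσ'
  have e2 : V ρ σ σ' (g 0) = G τ σ' - G τ σ := by
    rw [h0]
    rcases hs with ⟨a, b⟩ | ⟨a, b⟩
    · exact hG.lt τ ⟨hF.t0, hF.t1⟩ σ hσ σ' hσ' a b
    · exact hG.gt τ ⟨hF.t0, hF.t1⟩ σ hσ σ' hσ' a b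
  unfold XX cr
  rw [e2, ← e1]; ring

def Isol (ρ g : ℝ → ℂ) (τ l r : ℝ) : Prop :=
  0 < l ∧ l < τ ∧ τ < r ∧ r < 1 ∧ ∀ t ∈ Icc l r, ρ t ∈ range g → t = τ

lemma exists_isol (hF : FC ρ g τ) : ∃ l r, Isol ρ g τ l r := by
  have t0 := hF.t0
  have t1 := hF.t1
  have h1 : ∃ l, 0 < l ∧ l < τ ∧ ∀ t, l ≤ t → t < τ → ρ t ∉ range g := by
    by_cases h : ∃ s, 0 < s ∧ s < τ ∧ ρ s ∈ range g
    · obtain ⟨s, hs, hs', hm⟩ := h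
      refine ⟨(s + τ)/2, by linarith, by linarith, fun t ht ht' hm' => ?_⟩
      have := hF.uniq s ⟨by linarith, by linarith⟩ t ⟨by linarith, by linarith⟩ hs'.ne ht'.ne hm hm'
      linarith
    · push Not at h
      exact ⟨τ/2, by linarith, by linarith, fun t ht ht' => h t (by linarith) ht'⟩
  have h2 : ∃ r, τ < r ∧ r < 1 ∧ ∀ t, t ≤ r → τ < t → ρ t ∉ range g := by
    by_cases h : ∃ s, s < 1 ∧ τ < s ∧ ρ s ∈ range g
    · obtain ⟨s, hs, hs', hm⟩ := h
      refine ⟨(s + τ)/2, by linarith, by linarith, fun t ht ht' hm' => ?_⟩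
      have := hF.uniq s ⟨by linarith, by linarith⟩ t ⟨by linarith, by linarith⟩ hs'.ne' ht'.ne' hm hm'
      linarith
    · push Not at h
      exact ⟨(τ+1)/2, by linarith, by linarith, fun t ht ht' => h t (by linarith) ht'⟩
  obtain ⟨l, a1, a2, a3⟩ := h1
  obtain ⟨r, b1, b2, b3⟩ := h2
  refine ⟨l, r, a1, a2, b1, b2, fun t ht hm => ?_⟩
  rcases lt_trichotomy t τ with h | h | h
  · exact absurd hm (a3 t ht.1 h)
  · exact h
  · exact absurd hm (b3 t ht.2 h)

lemma XX_all (hρ : Continuous ρ) (hi : InjOn ρ (Icc 0 1)) (hG : IsG ρ G) (hg : JC g)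
    (hF : FC ρ g τ) (h0 : g 0 = ρ τ) {l r : ℝ} (hlr : Isol ρ g τ l r)
    {θ : ℝ} (hθ1 : θ ∈ Ioo (0:ℝ) 1) (hθ : Off ρ (g θ))
    (hk : ∃ m : ℤ, XX ρ G g τ θ r - XX ρ G g τ θ l = m ∧ m % 2 = 0)
    {σ σ' : ℝ} (hσ : σ ∈ Ioo (0:ℝ) 1)
    (hσ' : σ' ∈ Ioo (0:ℝ) 1) (n1 : ρ σ ∉ range g) (n2 : ρ σ' ∉ range g) :
    ∃ m : ℤ, XX ρ G g τ θ σ - XX ρ G g τ θ σ' = m ∧ m % 2 = 0 := by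
  obtain ⟨l0, l1, r0, r1, hiso⟩ := hlr
  have nl : ρ l ∉ range g := fun h => l1.ne (hiso l ⟨le_rfl, by linarith⟩ h)
  have nr : ρ r ∉ range g := fun h => r0.ne' (hiso r ⟨by linarith, le_rfl⟩ h)
  have key : ∀ σ ∈ Ioo (0:ℝ) 1, ρ σ ∉ range g →
      ∃ m : ℤ, XX ρ G g τ θ σ - XX ρ G g τ θ l = m ∧ m % 2 = 0 := by
    intro σ hσ hn
    rcases lt_trichotomy σ τ with h | h | h
    · exact XX_side hρ hi hG hg hF h0 hθ1 hθ hσ ⟨l0, by linarith⟩ hn nl (Or.inl ⟨h, l1⟩)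
    · subst h; exact absurd hF.mem hn
    · obtain ⟨m, hm, hm'⟩ := XX_side hρ hi hG hg hF h0 hθ1 hθ hσ ⟨by linarith, r1⟩ hn nr
        (Or.inr ⟨h, r0⟩)
      obtain ⟨k, hk, hk'⟩ := hk
      exact ⟨m + k, by push_cast; rw [← hm, ← hk]; ring, by omega⟩
  obtain ⟨m, hm, hm'⟩ := key σ hσ n1
  obtain ⟨k, hk, hk'⟩ := key σ' hσ' n2
  exact ⟨m - k, by push_cast; rw [← hm, ← hk]; ring, by omega⟩

lemma kappa_const (hρ : Continuous ρ) (hg : JC g) (h0 : g 0 = ρ τ) {l r : ℝ}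
    (hlr : Isol ρ g τ l r) {θ θ' : ℝ} (hθ1 : θ ∈ Ioo (0:ℝ) 1) (hθ : Off ρ (g θ))
    (hθ1' : θ' ∈ Ioo (0:ℝ) 1) (hθ' : Off ρ (g θ')) :
    XX ρ G g τ θ r - XX ρ G g τ θ l = XX ρ G g τ θ' r - XX ρ G g τ θ' l := by
  obtain ⟨l0, l1, r0, r1, hiso⟩ := hlr
  have nl : ρ l ∉ range g := fun h => l1.ne (hiso l ⟨le_rfl, by linarith⟩ h)
  have nr : ρ r ∉ range g := fun h => r0.ne' (hiso r ⟨by linarith, le_rfl⟩ h)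
  have hc : cr g θ' θ ρ l r = 0 := by
    apply cr_disj hg.cont hρ
    intro s hs t ht h
    rw [uIcc_of_le (by linarith)] at ht
    have := hiso t ht ⟨s, h⟩
    subst this
    have hs' := Ioo_sub hθ1' hθ1 hs
    have := hg.inj1 (h.trans h0.symm) (by linarith [hs'.2]) (by linarith [hs'.1])
    linarith [hs'.1]
  have hl : l ∈ Ioo (0:ℝ) 1 := ⟨l0, by linarith⟩
  have hr : r ∈ Ioo (0:ℝ) 1 := ⟨by linarith, r1⟩
  have e1 := V_half hρ hθ hl hr
  have e2 := V_half hρ hθ' hl hr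
  have e3 := V_add' hg.cont nl 0 θ' θ
  have e4 := V_add' hg.cont nr 0 θ' θ
  unfold cr at hc
  unfold XX
  linear_combination -hc - e1 + e2 + e3 - e4

/-- direction choice -/
lemma exists_dir (hρ : Continuous ρ) (hi : InjOn ρ (Icc 0 1)) (hG : IsG ρ G) (hg : JC g)
    (hF : FC ρ g τ) : ∃ g', Rep g g' ∧ g' 0 = ρ τ ∧
    ∀ θ ∈ Ioo (0:ℝ) 1, Off ρ (g' θ) → ∀ σ ∈ Ioo (0:ℝ) 1, ∀ σ' ∈ Ioo (0:ℝ) 1,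
      ρ σ ∉ range g' → ρ σ' ∉ range g' →
      ∃ m : ℤ, XX ρ G g' τ θ σ - XX ρ G g' τ θ σ' = m ∧ m % 2 = 0 := by
  obtain ⟨k, hk⟩ := hF.mem
  have R1 := Rep.shift hg k
  set g1 := fun t => g (t + k) with hg1
  have z1 : g1 0 = ρ τ := by rw [hg1]; simp [hk]
  have F1 := hF.rep R1
  have R2 := Rep.rev R1.jc
  set g2 := fun t => g1 (-t) with hg2
  have z2 : g2 0 = ρ τ := by rw [hg2]; simp [z1]
  have F2 := F1.rep R2
  obtain ⟨l, r, hlr⟩ := exists_isol F1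
  have hlr2 : Isol ρ g2 τ l r := by
    unfold Isol; rw [R2.rng]; exact hlr
  by_cases hex : ∃ θ ∈ Ioo (0:ℝ) 1, Off ρ (g1 θ)
  swap
  · exact ⟨g1, R1, z1, fun θ hθ h => absurd ⟨θ, hθ, h⟩ hex⟩
  obtain ⟨θ, hθ, hoff⟩ := hex
  have hlr' := hlr
  obtain ⟨l0, l1, r0, r1, hiso⟩ := hlr'
  have nl : ρ l ∉ range g1 := fun h => l1.ne (hiso l ⟨le_rfl, by linarith⟩ h)
  have nr : ρ r ∉ range g1 := fun h => r0.ne' (hiso r ⟨by linarith, le_rfl⟩ h)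
  have hl : l ∈ Ioo (0:ℝ) 1 := ⟨l0, by linarith⟩
  have hr : r ∈ Ioo (0:ℝ) 1 := ⟨by linarith, r1⟩
  obtain ⟨m, hm⟩ := XX_int hρ hG R1.jc F1 z1 hoff hr hl nr nl
  by_cases hev : m % 2 = 0
  · refine ⟨g1, R1, z1, fun θ' hθ' ho σ hσ σ' hσ' n n' => ?_⟩
    exact XX_all hρ hi hG R1.jc F1 z1 hlr hθ' ho
      ⟨m, by rw [← hm]; exact kappa_const hρ R1.jc z1 hlr hθ' ho hθ hoff, hev⟩ hσ hσ' n n'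
  · refine ⟨g2, R1.trans R2, z2, fun θ' hθ' ho σ hσ σ' hσ' n n' => ?_⟩
    have e0 : g2 (1 - θ) = g1 θ := by
      change g1 (-(1 - θ)) = g1 θ
      have := R1.jc.per (-(1 - θ))
      rw [← this]; congr 1; ring
    have ho2 : Off ρ (g2 (1 - θ)) := by rw [e0]; exact hoff
    have h1θ : 1 - θ ∈ Ioo (0:ℝ) 1 := ⟨by linarith [hθ.2], by linarith [hθ.1]⟩
    refine XX_all hρ hi hG R2.jc F2 z2 hlr2 hθ' ho ?_ hσ hσ' n n'
    rw [kappa_const hρ R2.jc z2 hlr2 hθ' ho h1θ ho2]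
    have kk : ∀ q, q ∉ range g1 → V g2 0 (1 - θ) q = V g1 0 θ q - w g1 q := by
      intro q hq
      rw [hg2, V_rev R1.jc.cont hq]
      have h1 := V_full R1.jc hq (θ - 1)
      have h2 := V_add' R1.jc.cont hq 0 (θ - 1) θ
      rw [show θ - 1 + 1 = θ by ring] at h1
      rw [show -(1 - θ) = θ - 1 by ring, neg_zero]
      linear_combination h2 - h1
    refine ⟨m - (w g1 (ρ r) - w g1 (ρ l)), ?_, ?_⟩
    · push_cast
      rw [← hm]
      unfold XX
      rw [kk _ nr, kk _ nl, e0]; ring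
    · have := F1.lo l (Ioo_subset_Icc_self hl) l1 nl
      have := F1.hi r (Ioo_subset_Icc_self hr) r0 nr
      have := F1.odd
      omega
end dir

end PC

namespace PC
open Set

structure Fam {ι : Type*} (g : ι → ℝ → ℂ) : Prop where
  jc : ∀ i, JC (g i)
  two : ∀ i j, i ≠ j → AtMost2 (range (g i) ∩ range (g j))
  ne : ∀ i j, i ≠ j → (range (g i) ∩ range (g j)).Nonempty
  gp : ∀ x i j k, x ∈ range (g i) → x ∈ range (g j) → x ∈ range (g k) → i = j ∨ i = k ∨ j = k

def Tch (a b : ℝ → ℂ) : Prop := ∃ p, range a ∩ range b = {p}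

lemma Tch.symm {a b : ℝ → ℂ} (h : Tch a b) : Tch b a := by
  obtain ⟨p, hp⟩ := h
  exact ⟨p, by rw [inter_comm, hp]⟩

lemma touch_w {a b : ℝ → ℂ} (ha : JC a) (hb : JC b) (ht : Tch a b) {x y : ℂ}
    (hx : x ∈ range b) (hy : y ∈ range b) (hx' : x ∉ range a) (hy' : y ∉ range a) :
    w a x = w a y := by
  obtain ⟨p, hp⟩ := ht
  have hpm : p ∈ range a ∩ range b := by rw [hp]; rfl
  obtain ⟨s0, hs0⟩ := hpm.2
  obtain ⟨s, s1, s2, rfl⟩ := hb.exists_Ico s0 hx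
  obtain ⟨t, t1, t2, rfl⟩ := hb.exists_Ico s0 hy
  have key : ∀ r, s0 < r → r < s0 + 1 → b r ∉ range a := by
    intro r h1 h2 hm
    have : b r ∈ range a ∩ range b := ⟨hm, ⟨r, rfl⟩⟩
    rw [hp, mem_singleton_iff, ← hs0] at this
    have := hb.inj1 this (by linarith) (by linarith)
    linarith
  have s1' : s0 < s := lt_of_le_of_ne s1 (by rintro rfl; rw [hs0] at hx'; exact hx' hpm.1)
  have t1' : s0 < t := lt_of_le_of_ne t1 (by rintro rfl; rw [hs0] at hy'; exact hy' hpm.1)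
  apply w_const ha hb.cont
  intro r hr
  rw [mem_uIcc] at hr
  apply key <;> rcases hr with hr | hr <;> linarith

lemma cr_swap (f : ℝ → ℂ) (a b : ℝ) (h : ℝ → ℂ) (c d : ℝ) : cr h c d f a b = - cr f a b h c d := by
  unfold cr; ring

open Classical in
def pick (S : Set ℂ) : ℂ := if h : S.Nonempty then h.some else 0
lemma pick_mem {S : Set ℂ} (h : S.Nonempty) : pick S ∈ S := by
  unfold pick; rw [dif_pos h]; exact h.some_mem

open Classical in
/-- position in `[0,1)` of a point on the curve -/
def pos (g : ℝ → ℂ) (x : ℂ) : ℝ := if h : ∃ t, 0 ≤ t ∧ t < 1 ∧ g t = x then h.choose else 0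
lemma pos_spec {g : ℝ → ℂ} (h : JC g) {x : ℂ} (hx : x ∈ range g) :
    0 ≤ pos g x ∧ pos g x < 1 ∧ g (pos g x) = x := by
  have h' : ∃ t, 0 ≤ t ∧ t < 1 ∧ g t = x := by simpa using h.exists_Ico 0 hx
  unfold pos; rw [dif_pos h']; exact h'.choose_spec
lemma pos_Ioo {g : ℝ → ℂ} (h : JC g) {x : ℂ} (hx : x ∈ range g) (h0 : g 0 ≠ x) :
    pos g x ∈ Ioo (0:ℝ) 1 := by
  obtain ⟨h1, h2, h3⟩ := pos_spec h hx
  refine ⟨lt_of_le_of_ne h1 ?_, h2⟩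
  intro he; rw [← he] at h3; exact h0 h3

def uu {ι : Type*} (g : ι → ℝ → ℂ) (i j : ι) : ℂ := pick (range (g i) ∩ range (g j))
lemma uu_comm {ι : Type*} (g : ι → ℝ → ℂ) (i j : ι) : uu g i j = uu g j i := by
  unfold uu; rw [inter_comm]

/-- the cylindrical setting -/
structure Cyl {ι : Type*} (g : ι → ℝ → ℂ) (ρ : ℝ → ℂ) (τ : ι → ℝ) (G : ℝ → ℝ → ℂ) : Prop where
  fam : Fam g
  cont : Continuous ρ
  isG : IsG ρ G
  fc : ∀ i, FC ρ (g i) (τ i)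
  zero : ∀ i, g i 0 = ρ (τ i)
  noint : ∀ i j, i ≠ j → ∀ σ ∈ Icc (0:ℝ) 1, ρ σ ∈ range (g i) → ρ σ ∉ range (g j)
  even : ∀ i, ∀ θ ∈ Ioo (0:ℝ) 1, Off ρ (g i θ) → ∀ σ ∈ Ioo (0:ℝ) 1, ∀ σ' ∈ Ioo (0:ℝ) 1,
      ρ σ ∉ range (g i) → ρ σ' ∉ range (g i) →
      ∃ m : ℤ, XX ρ G (g i) (τ i) θ σ - XX ρ G (g i) (τ i) θ σ' = m ∧ m % 2 = 0

section cyl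
variable {ι : Type*} {g : ι → ℝ → ℂ} {ρ : ℝ → ℂ} {τ : ι → ℝ} {G : ℝ → ℝ → ℂ}

open Classical in
def sg (τ : ι → ℝ) (i j : ι) : ℤ := if τ i < τ j then 1 else 0

lemma Cyl.mem01 (h : Cyl g ρ τ G) (i : ι) : τ i ∈ Ioo (0:ℝ) 1 := ⟨(h.fc i).t0, (h.fc i).t1⟩

lemma Cyl.zero_off (h : Cyl g ρ τ G) {i j : ι} (hij : i ≠ j) : g i 0 ∉ range (g j) := by
  rw [h.zero i]
  exact h.noint i j hij _ (Ioo_subset_Icc_self (h.mem01 i)) (h.fc i).mem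

lemma Cyl.tne (h : Cyl g ρ τ G) {i j : ι} (hij : i ≠ j) : τ i ≠ τ j := by
  intro he
  have := h.zero_off hij
  rw [h.zero i, he, ← h.zero j] at this
  exact this ⟨0, rfl⟩

lemma Cyl.Xlemma (h : Cyl g ρ τ G) {a b c d : ι} (ac : a ≠ c) (ad : a ≠ d)
    (bc : b ≠ c) (bd : b ≠ d) (hab : a ≠ b) (hcd : c ≠ d) {θa θb φc φd : ℝ}
    (ia : θa ∈ Ioo (0:ℝ) 1) (ib : θb ∈ Ioo (0:ℝ) 1) (ic : φc ∈ Ioo (0:ℝ) 1) (id : φd ∈ Ioo (0:ℝ) 1)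
    (hu : g a θa = g b θb) (hv : g c φc = g d φd) {x1 x2 x3 x4 : ℤ}
    (h1 : cr (g a) 0 θa (g c) 0 φc = x1) (h2 : cr (g b) 0 θb (g c) 0 φc = x2)
    (h3 : cr (g a) 0 θa (g d) 0 φd = x3) (h4 : cr (g b) 0 θb (g d) 0 φd = x4) :
    (x1 + x2 + x3 + x4 - (sg τ a c + sg τ b c + sg τ a d + sg τ b d)) % 2 = 0 := by
  have offu : Off ρ (g a θa) := fun t ht he => h.noint a b hab t ht ⟨θa, he.symm⟩
    ⟨θb, by rw [← hu, he]⟩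
  have offv : Off ρ (g c φc) := fun t ht he => h.noint c d hcd t ht ⟨φc, he.symm⟩
    ⟨φd, by rw [← hv, he]⟩
  have nz : ∀ {i j}, i ≠ j → ρ (τ i) ∉ range (g j) := by
    intro i j hij; rw [← h.zero i]; exact h.zero_off hij
  obtain ⟨ma, ea, pa⟩ := h.even a θa ia offu _ (h.mem01 c) _ (h.mem01 d) (nz ac.symm) (nz ad.symm)
  obtain ⟨mb, eb, pb⟩ := h.even b θb ib (hu ▸ offu) _ (h.mem01 c) _ (h.mem01 d) (nz bc.symm) (nz bd.symm)
  obtain ⟨mc, ec, pc⟩ := h.even c φc ic offv _ (h.mem01 a) _ (h.mem01 b) (nz ac) (nz bc)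
  obtain ⟨md, ed, pd⟩ := h.even d φd id (hv ▸ offv) _ (h.mem01 a) _ (h.mem01 b) (nz ad) (nz bd)
  have hG : ∀ {i j}, i ≠ j → G (τ i) (τ j) - G (τ j) (τ i) = (sg τ i j : ℂ) - 1/2 := by
    intro i j hij
    rcases lt_or_gt_of_ne (h.tne hij) with hl | hl
    · rw [h.isG.half _ (h.mem01 j) _ (h.mem01 i) hl]
      unfold sg; rw [if_pos hl]; push_cast; ring
    · rw [h.isG.half _ (h.mem01 i) _ (h.mem01 j) hl]
      unfold sg; rw [if_neg hl.not_gt]; push_cast; ring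
  have g1 := hG ac
  have g2 := hG bc
  have g3 := hG ad
  have g4 := hG bd
  have key : ((x1 - x2 - x3 + x4 : ℤ) : ℂ) =
      ((ma - mb - mc + md - sg τ a c + sg τ b c + sg τ a d - sg τ b d : ℤ) : ℂ) := by
    push_cast
    rw [← h1, ← h2, ← h3, ← h4, ← ea, ← eb, ← ec, ← ed]
    unfold cr XX
    simp only [h.zero, hu, hv] at *
    linear_combination -g1 + g2 + g3 - g4
  have key' : x1 - x2 - x3 + x4 =
      ma - mb - mc + md - sg τ a c + sg τ b c + sg τ a d - sg τ b d := by exact_mod_cast key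
  omega

open Classical in
def DD (g : ι → ℝ → ℂ) (i j k : ι) : ℤ :=
  if pos (g j) (uu g i j) < pos (g j) (uu g j k) then 1 else 0

open Classical in
def xx (g : ι → ℝ → ℂ) (τ : ι → ℝ) (i k j : ι) : ℤ :=
  if τ i < τ j ∧ τ j < τ k then DD g i j k else if τ k < τ j ∧ τ j < τ i then DD g k j i else 0

lemma uu_mem (h : Fam g) {i j : ι} (hij : i ≠ j) :
    uu g i j ∈ range (g i) ∧ uu g i j ∈ range (g j) := pick_mem (h.ne i j hij)

lemma uu_off (h : Fam g) {i j k : ι} (hij : i ≠ j) (hik : i ≠ k) (hjk : j ≠ k) :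
    uu g i j ∉ range (g k) := by
  intro hm
  obtain ⟨h1, h2⟩ := uu_mem h hij
  rcases h.gp _ i j k h1 h2 hm with e | e | e
  · exact hij e
  · exact hik e
  · exact hjk e

lemma Cyl.pos1 (h : Cyl g ρ τ G) {i j : ι} (hij : i ≠ j) :
    pos (g i) (uu g i j) ∈ Ioo (0:ℝ) 1 ∧ g i (pos (g i) (uu g i j)) = uu g i j := by
  have hm := uu_mem h.fam hij
  refine ⟨pos_Ioo (h.fam.jc i) hm.1 ?_, (pos_spec (h.fam.jc i) hm.1).2.2⟩
  intro he
  apply h.zero_off hij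
  rw [he]; exact hm.2

/-- touching pairs contribute even crossing numbers -/
lemma Cyl.even_touch (h : Cyl g ρ τ G) {a b c d : ι} (hac : a ≠ c) (hab : a ≠ b) (hcd : c ≠ d)
    (had : a ≠ d) (hbc : b ≠ c) (ht : Tch (g a) (g c)) :
    ∃ x : ℤ, cr (g a) 0 (pos (g a) (uu g a b)) (g c) 0 (pos (g c) (uu g c d)) = x ∧ x % 2 = 0 := by
  obtain ⟨i1, e1⟩ := h.pos1 hab
  obtain ⟨i2, e2⟩ := h.pos1 hcd
  have o1 : uu g a b ∉ range (g c) := uu_off h.fam hab hac hbc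
  have o2 : uu g c d ∉ range (g a) := uu_off h.fam hcd hac.symm had.symm
  refine P0 (h.fam.jc a) (h.fam.jc c) (h.fam.two a c hac) i1 i2 (h.zero_off hac) (by rw [e1]; exact o1)
    (h.zero_off hac.symm) (by rw [e2]; exact o2) ?_ ?_
  · rw [touch_w (h.fam.jc a) (h.fam.jc c) ht (y := g c (pos (g c) (uu g c d))) ⟨_, rfl⟩ ⟨_, rfl⟩
      (h.zero_off hac.symm) (by rw [e2]; exact o2)]
    simp
  · rw [touch_w (h.fam.jc c) (h.fam.jc a) ht.symm (y := g a (pos (g a) (uu g a b))) ⟨_, rfl⟩ ⟨_, rfl⟩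
      (h.zero_off hac) (by rw [e1]; exact o1)]
    simp

lemma Cyl.above (h : Cyl g ρ τ G) {i j : ι} (hij : τ i < τ j) :
    (w (g i) (g j 0) - w (g i) (ρ 1)) % 2 = 0 := by
  have hne : j ≠ i := by rintro rfl; exact lt_irrefl _ hij
  have := h.zero_off hne
  rw [h.zero j] at this ⊢
  exact (h.fc i).hi _ (Ioo_subset_Icc_self (h.mem01 j)) hij this

lemma Cyl.below (h : Cyl g ρ τ G) {i j : ι} (hij : τ j < τ i) :
    (w (g i) (g j 0) - w (g i) (ρ 0)) % 2 = 0 := by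
  have hne : j ≠ i := by rintro rfl; exact lt_irrefl _ hij
  have := h.zero_off hne
  rw [h.zero j] at this ⊢
  exact (h.fc i).lo _ (Ioo_subset_Icc_self (h.mem01 j)) hij this

/-- the general odd crossing statement: `a` touches `d`, `c` touches `b`;
`c` and `d` on the same side of `a`; `a` and `b` on different sides of `c` -/
lemma Cyl.odd_cross (h : Cyl g ρ τ G) {a b c d : ι} (hac : a ≠ c) (hab : a ≠ b) (hcd : c ≠ d)
    (had : a ≠ d) (hbc : b ≠ c) (tad : Tch (g a) (g d)) (tcb : Tch (g c) (g b))
    (h1 : (τ a < τ c ∧ τ a < τ d) ∨ (τ c < τ a ∧ τ d < τ a))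
    (h2 : (τ a < τ c ∧ τ c < τ b) ∨ (τ b < τ c ∧ τ c < τ a)) :
    ∃ x : ℤ, cr (g a) 0 (pos (g a) (uu g a b)) (g c) 0 (pos (g c) (uu g c d)) = x ∧
      (x % 2 = 1 ↔ pos (g c) (uu g c a) < pos (g c) (uu g c d)) := by
  obtain ⟨i1, e1⟩ := h.pos1 hab
  obtain ⟨i2, e2⟩ := h.pos1 hcd
  obtain ⟨i3, e3⟩ := h.pos1 hac.symm
  have o1 : uu g a b ∉ range (g c) := uu_off h.fam hab hac hbc
  have o2 : uu g c d ∉ range (g a) := uu_off h.fam hcd hac.symm had.symm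
  refine P1 (h.fam.jc a) (h.fam.jc c) (h.fam.two a c hac) i1 i2 (h.zero_off hac) (by rw [e1]; exact o1)
    (h.zero_off hac.symm) (by rw [e2]; exact o2) ?_ ?_ i3 (by rw [e3]; exact (uu_mem h.fam hac.symm).2)
  · rw [e2]
    rw [touch_w (h.fam.jc a) (h.fam.jc d) tad (x := uu g c d) (y := g d 0) (uu_mem h.fam hcd).2
      ⟨_, rfl⟩ o2 (h.zero_off had.symm)]
    rcases h1 with ⟨p, q⟩ | ⟨p, q⟩
    · have := h.above p
      have := h.above q
      omega
    · have := h.below p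
      have := h.below q
      omega
  · rw [e1]
    rw [touch_w (h.fam.jc c) (h.fam.jc b) tcb (x := uu g a b) (y := g b 0) (uu_mem h.fam hab).2
      ⟨_, rfl⟩ o1 (h.zero_off hbc)]
    have := (h.fc c).odd
    rcases h2 with ⟨p, q⟩ | ⟨p, q⟩
    · have := h.above q
      have := h.below p
      omega
    · have := h.above q
      have := h.below p
      omega

lemma Cyl.pos_ne (h : Cyl g ρ τ G) {i j k : ι} (hij : i ≠ j) (hik : i ≠ k) (hjk : j ≠ k) :
    pos (g i) (uu g i j) ≠ pos (g i) (uu g i k) := by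
  intro he
  have h1 := (h.pos1 hij).2
  have h2 := (h.pos1 hik).2
  rw [he, h2] at h1
  apply uu_off h.fam hij hik hjk
  rw [← h1]
  exact (uu_mem h.fam hik).2

/-- common part of interleaved and nested cases: crossing of `P` (through `i`,`l`) and
`Q` (through `j`,`k`) -/
lemma Cyl.interleaved (h : Cyl g ρ τ G) {i j k l : ι} (ij : τ i < τ j) (jk : τ j < τ k)
    (kl : τ k < τ l) (tik : Tch (g i) (g k)) (tjl : Tch (g j) (g l)) :
    (DD g i j k + DD g j k l) % 2 = 1 := by
  have ne : ∀ {p q}, τ p < τ q → p ≠ q := by rintro p q hpq rfl; exact lt_irrefl _ hpq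
  have nij := ne ij
  have nik := ne (ij.trans jk)
  have nil := ne ((ij.trans jk).trans kl)
  have njk := ne jk
  have njl := ne (jk.trans kl)
  have nkl := ne kl
  obtain ⟨x1, e1, o1⟩ := h.odd_cross (a := i) (b := l) (c := j) (d := k) nij nil njk nik njl.symm
    tik tjl (Or.inl ⟨ij, ij.trans jk⟩) (Or.inl ⟨ij, jk.trans kl⟩)
  obtain ⟨x2, e2, o2⟩ := h.even_touch (a := l) (b := i) (c := j) (d := k) njl.symm nil.symm njk
    nkl.symm nij tjl.symm
  obtain ⟨x3, e3, o3⟩ := h.even_touch (a := i) (b := l) (c := k) (d := j) nik nil njk.symm nij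
    nkl.symm tik
  obtain ⟨x4, e4, o4⟩ := h.odd_cross (a := l) (b := i) (c := k) (d := j) nkl.symm nil.symm njk.symm
    njl.symm nik tjl.symm tik.symm (Or.inr ⟨kl, jk.trans kl⟩) (Or.inr ⟨ij.trans jk, kl⟩)
  have hX := h.Xlemma nij nik njl.symm nkl.symm nil njk (h.pos1 nil).1 (h.pos1 nil.symm).1
    (h.pos1 njk).1 (h.pos1 njk.symm).1
    (by rw [(h.pos1 nil).2, (h.pos1 nil.symm).2, uu_comm])
    (by rw [(h.pos1 njk).2, (h.pos1 njk.symm).2, uu_comm]) e1 e2 e3 e4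
  unfold sg at hX
  rw [if_pos ij, if_neg (jk.trans kl).not_gt, if_pos (ij.trans jk), if_neg kl.not_gt] at hX
  have hne := h.pos_ne njk.symm nkl njl
  unfold DD
  rw [uu_comm g i j, uu_comm g j k]
  rw [uu_comm g k j] at *
  split_ifs with q1 q2 q2
  · have := o1.2 q1
    have : ¬ (pos (g k) (uu g k l) < pos (g k) (uu g j k)) := by linarith
    rw [← o4] at this
    omega
  · have := o1.2 q1
    have : (pos (g k) (uu g k l) < pos (g k) (uu g j k)) := lt_of_le_of_ne (not_lt.1 q2) hne.symm
    rw [← o4] at this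
    omega
  · rw [← o1] at q1
    have : ¬ (pos (g k) (uu g k l) < pos (g k) (uu g j k)) := by linarith
    rw [← o4] at this
    omega
  · rw [← o1] at q1
    have : (pos (g k) (uu g k l) < pos (g k) (uu g j k)) := lt_of_le_of_ne (not_lt.1 q2) hne.symm
    rw [← o4] at this
    omega

lemma Cyl.nested (h : Cyl g ρ τ G) {i j k l : ι} (ij : τ i < τ j) (jl : τ j < τ l)
    (lk : τ l < τ k) (tik : Tch (g i) (g k)) (tjl : Tch (g j) (g l)) :
    (DD g i j k + DD g i l k) % 2 = 0 := by
  have ne : ∀ {p q}, τ p < τ q → p ≠ q := by rintro p q hpq rfl; exact lt_irrefl _ hpq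
  have nij := ne ij
  have nil := ne (ij.trans jl)
  have nik := ne ((ij.trans jl).trans lk)
  have njl := ne jl
  have njk := ne (jl.trans lk)
  have nlk := ne lk
  obtain ⟨x1, e1, o1⟩ := h.odd_cross (a := i) (b := l) (c := j) (d := k) nij nil njk nik njl.symm
    tik tjl (Or.inl ⟨ij, ij.trans (jl.trans lk)⟩) (Or.inl ⟨ij, jl⟩)
  obtain ⟨x2, e2, o2⟩ := h.even_touch (a := l) (b := i) (c := j) (d := k) njl.symm nil.symm njk
    nlk nij tjl.symm
  obtain ⟨x3, e3, o3⟩ := h.even_touch (a := i) (b := l) (c := k) (d := j) nik nil njk.symm nij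
    nlk tik
  obtain ⟨x4, e4, o4⟩ := h.odd_cross (a := k) (b := j) (c := l) (d := i) nlk.symm njk.symm nil.symm
    nik.symm njl tik.symm tjl.symm (Or.inr ⟨lk, ij.trans (jl.trans lk)⟩) (Or.inr ⟨jl, lk⟩)
  have e4' : cr (g l) 0 (pos (g l) (uu g l i)) (g k) 0 (pos (g k) (uu g k j)) = ((-x4 : ℤ) : ℂ) := by
    rw [cr_swap, e4]; push_cast; rfl
  have hX := h.Xlemma nij nik njl.symm nlk nil njk (h.pos1 nil).1 (h.pos1 nil.symm).1
    (h.pos1 njk).1 (h.pos1 njk.symm).1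
    (by rw [(h.pos1 nil).2, (h.pos1 nil.symm).2, uu_comm])
    (by rw [(h.pos1 njk).2, (h.pos1 njk.symm).2, uu_comm]) e1 e2 e3 e4'
  unfold sg at hX
  rw [if_pos ij, if_neg jl.not_gt, if_pos (ij.trans (jl.trans lk)), if_pos lk] at hX
  have hne := h.pos_ne nil.symm nlk nik
  unfold DD
  rw [uu_comm g i j, uu_comm g i l]
  split_ifs with q1 q2 q2
  · have := o1.2 q1
    have : ¬ (pos (g l) (uu g l k) < pos (g l) (uu g l i)) := by linarith
    rw [← o4] at this
    omega
  · have := o1.2 q1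
    have : (pos (g l) (uu g l k) < pos (g l) (uu g l i)) := lt_of_le_of_ne (not_lt.1 q2) hne.symm
    rw [← o4] at this
    omega
  · rw [← o1] at q1
    have : ¬ (pos (g l) (uu g l k) < pos (g l) (uu g l i)) := by linarith
    rw [← o4] at this
    omega
  · rw [← o1] at q1
    have : (pos (g l) (uu g l k) < pos (g l) (uu g l i)) := lt_of_le_of_ne (not_lt.1 q2) hne.symm
    rw [← o4] at this
    omega

lemma xx_symm (i k j : ι) : xx g τ i k j = xx g τ k i j := by
  unfold xx
  by_cases h1 : τ i < τ j ∧ τ j < τ k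
  · have h2 : ¬ (τ k < τ j ∧ τ j < τ i) := by rintro ⟨a, b⟩; linarith [h1.1]
    rw [if_pos h1, if_neg h2, if_pos h1]
  · rw [if_neg h1]
    split_ifs <;> rfl

lemma xx_mid {i k j : ι} (h1 : τ i < τ j) (h2 : τ j < τ k) : xx g τ i k j = DD g i j k := by
  unfold xx; rw [if_pos ⟨h1, h2⟩]
lemma xx_lo {i k j : ι} (h1 : τ j < τ i) (h2 : τ j < τ k) : xx g τ i k j = 0 := by
  unfold xx; rw [if_neg (by rintro ⟨a, b⟩; linarith), if_neg (by rintro ⟨a, b⟩; linarith)]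
lemma xx_hi {i k j : ι} (h1 : τ i < τ j) (h2 : τ k < τ j) : xx g τ i k j = 0 := by
  unfold xx; rw [if_neg (by rintro ⟨a, b⟩; linarith), if_neg (by rintro ⟨a, b⟩; linarith)]

lemma Cyl.good (h : Cyl g ρ τ G) :
    Good (fun i j => i ≠ j ∧ Tch (g i) (g j)) (sg τ) (xx g τ) := by
  have santi : ∀ a b, a ≠ b → (sg τ a b + sg τ b a) % 2 = 1 := by
    intro a b hab
    unfold sg
    rcases lt_or_gt_of_ne (h.tne hab) with hl | hl
    · rw [if_pos hl, if_neg hl.not_gt]; rfl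
    · rw [if_pos hl, if_neg hl.not_gt]; rfl
  have s1 : ∀ {a b}, τ a < τ b → sg τ a b = 1 := fun hl => by unfold sg; rw [if_pos hl]
  have s0 : ∀ {a b}, τ b < τ a → sg τ a b = 0 := fun hl => by unfold sg; rw [if_neg hl.not_gt]
  have M1 : ∀ a b c d, τ a < τ b → τ c < τ d → τ a < τ c → b ≠ c → b ≠ d →
      Tch (g a) (g b) → Tch (g c) (g d) →
      (sg τ a c + sg τ a d + sg τ b c + sg τ b d -
        (xx g τ a b c + xx g τ a b d + xx g τ c d a + xx g τ c d b)) % 2 = 0 := by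
    intro a b c d hab hcd hac nbc nbd tab tcd
    have had := hac.trans hcd
    rw [xx_lo hac had, s1 hac, s1 had]
    rcases lt_or_gt_of_ne (h.tne nbc) with hbc | hcb
    · have hbd := hbc.trans hcd
      rw [xx_lo hbc hbd, xx_hi hac hbc, xx_hi had hbd, s1 hbc, s1 hbd]; rfl
    · rcases lt_or_gt_of_ne (h.tne nbd) with hbd | hdb
      · rw [xx_mid hac hcb, xx_hi had hbd, xx_mid hcb hbd, s0 hcb, s1 hbd]
        have := h.interleaved hac hcb hbd tab tcd
        omega
      · rw [xx_mid hac hcb, xx_mid had hdb, xx_hi hcb hdb, s0 hcb, s0 hdb]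
        have := h.nested hac hcd hdb tab tcd
        omega
  have M2 : ∀ a b c d, τ a < τ b → τ c < τ d → a ≠ c → a ≠ d → b ≠ c → b ≠ d →
      Tch (g a) (g b) → Tch (g c) (g d) →
      (sg τ a c + sg τ a d + sg τ b c + sg τ b d -
        (xx g τ a b c + xx g τ a b d + xx g τ c d a + xx g τ c d b)) % 2 = 0 := by
    intro a b c d hab hcd nac nad nbc nbd tab tcd
    rcases lt_or_gt_of_ne (h.tne nac) with hac | hca
    · exact M1 a b c d hab hcd hac nbc nbd tab tcd
    · have := M1 c d a b hcd hab hca nad.symm nbd.symm tcd tab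
      have := santi a c nac
      have := santi a d nad
      have := santi b c nbc
      have := santi b d nbd
      omega
  have M3 : ∀ a b c d, τ a < τ b → c ≠ d → a ≠ c → a ≠ d → b ≠ c → b ≠ d →
      Tch (g a) (g b) → Tch (g c) (g d) →
      (sg τ a c + sg τ a d + sg τ b c + sg τ b d -
        (xx g τ a b c + xx g τ a b d + xx g τ c d a + xx g τ c d b)) % 2 = 0 := by
    intro a b c d hab ncd nac nad nbc nbd tab tcd
    rcases lt_or_gt_of_ne (h.tne ncd) with hcd | hdc
    · exact M2 a b c d hab hcd nac nad nbc nbd tab tcd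
    · have := M2 a b d c hab hdc nad nac nbd nbc tab tcd.symm
      rw [xx_symm c d a, xx_symm c d b]
      omega
  refine ⟨?_, ?_, santi, ?_, ?_⟩
  · rintro a b ⟨n, t⟩; exact ⟨n.symm, t.symm⟩
  · rintro a ⟨n, -⟩; exact n rfl
  · intro a b c _ _ _
    rw [xx_symm]; simp
  · rintro a b c d nac nad nbc nbd ⟨nab, tab⟩ ⟨ncd, tcd⟩
    rcases lt_or_gt_of_ne (h.tne nab) with hab | hba
    · exact M3 a b c d hab ncd nac nad nbc nbd tab tcd
    · have := M3 b a c d hba ncd nbc nbd nac nad tab.symm tcd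
      rw [xx_symm a b c, xx_symm a b d]
      omega
end cyl

/-- Main cylindrical lemma -/
lemma cyl_bound {ι : Type*} [Fintype ι] {g : ι → ℝ → ℂ} (hf : Fam g) {ρ : ℝ → ℂ}
    (hρ : Continuous ρ) (hi : InjOn ρ (Icc 0 1)) (F : Finset ι) (τ : ι → ℝ)
    (hF : ∀ i ∈ F, FC ρ (g i) (τ i))
    (hno : ∀ i ∈ F, ∀ j ∈ F, i ≠ j → ∀ σ ∈ Icc (0:ℝ) 1, ρ σ ∈ range (g i) → ρ σ ∉ range (g j)) :
    eN (fun i j => i ≠ j ∧ Tch (g i) (g j)) F ≤ 14 * F.card := by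
  classical
  obtain ⟨G, hG⟩ := exists_G hρ hi
  have hd : ∀ i : F, _ := fun i => exists_dir hρ hi hG (hf.jc i) (hF i i.2)
  choose g' hR h0 hE using hd
  have hcyl : Cyl g' ρ (fun i : F => τ i) G := by
    refine ⟨⟨fun i => (hR i).jc, ?_, ?_, ?_⟩, hρ, hG, fun i => (hF i i.2).rep (hR i), h0, ?_, hE⟩
    · intro i j hij
      rw [(hR i).rng, (hR j).rng]
      exact hf.two i j (fun h => hij (Subtype.ext h))
    · intro i j hij
      rw [(hR i).rng, (hR j).rng]
      exact hf.ne i j (fun h => hij (Subtype.ext h))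
    · intro x i j k
      rw [(hR i).rng, (hR j).rng, (hR k).rng]
      intro h1 h2 h3
      rcases hf.gp x i j k h1 h2 h3 with e | e | e
      · exact Or.inl (Subtype.ext e)
      · exact Or.inr (Or.inl (Subtype.ext e))
      · exact Or.inr (Or.inr (Subtype.ext e))
    · intro i j hij
      rw [(hR i).rng, (hR j).rng]
      exact hno i i.2 j j.2 (fun h => hij (Subtype.ext h))
  have hb := hcyl.good.bound Finset.univ
  have hTch : ∀ i j : F, Tch (g' i) (g' j) ↔ Tch (g i) (g j) := by
    intro i j; unfold Tch; rw [(hR i).rng, (hR j).rng]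
  rw [Finset.card_univ, Fintype.card_coe] at hb
  refine le_trans ?_ hb
  unfold eN
  refine Finset.card_le_card_of_surjOn (fun p : F × F => (p.1.1, p.2.1)) ?_
  rintro ⟨p, q⟩ hp
  simp only [Finset.coe_filter, Finset.mem_product, mem_ofPred_eq] at hp
  obtain ⟨⟨hp, hq⟩, hne, ht⟩ := hp
  refine ⟨(⟨p, hp⟩, ⟨q, hq⟩), ?_, rfl⟩
  simp only [Finset.coe_filter, Finset.mem_product, mem_ofPred_eq]
  refine ⟨⟨Finset.mem_univ _, Finset.mem_univ _⟩, ?_, (hTch _ _).2 ht⟩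
  intro he
  exact hne (congrArg Subtype.val he)

end PC

namespace PC
open Set

section k5
variable {g : Fin 5 → ℝ → ℂ}

def VP (g : Fin 5 → ℝ → ℂ) (a b : Fin 5) (q : ℂ) : ℂ :=
  V (g a) 0 (pos (g a) (uu g a b)) q - V (g b) 0 (pos (g b) (uu g b a)) q

def GG (L : Fin 5 → Fin 5 → ℂ) (a b : Fin 5) : ℂ := if a < b then L a b else L b a + 1/2

lemma K5 (hf : Fam g) (h0 : ∀ r s, r ≠ s → g r 0 ∉ range (g s))
    (hs : ∀ r s t, r ≠ s → s ≠ t → r ≠ t → (w (g r) (g s 0) - w (g r) (uu g s t)) % 2 = 0) : False := by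
  have p0 : ∀ {i j}, i ≠ j → g i 0 - g j 0 ≠ 0 := by
    intro i j hij he
    exact h0 i j hij ⟨0, (sub_eq_zero.1 he).symm⟩
  have hL : ∀ i j, ∃ l, i ≠ j → ee l = g i 0 - g j 0 := by
    intro i j
    by_cases hij : i = j
    · exact ⟨0, fun h => absurd hij h⟩
    · obtain ⟨l, hl⟩ := ee_surj (p0 hij)
      exact ⟨l, fun _ => hl⟩
  choose L hL using hL
  have hG : ∀ {i j}, i ≠ j → ee (GG L i j) = g i 0 - g j 0 := by
    intro i j hij
    unfold GG
    split_ifs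
    · exact hL i j hij
    · rw [ee_add, ee_half, hL j i hij.symm]; ring
  have hGs : ∀ {i j : Fin 5}, i ≠ j → GG L i j - GG L j i = 1/2 - (((if i < j then 1 else 0 : ℤ)) : ℂ) := by
    intro i j hij
    unfold GG
    rcases lt_or_gt_of_ne hij with hl | hl
    · rw [if_pos hl, if_neg hl.not_gt, if_pos hl]; push_cast; ring
    · rw [if_pos hl, if_neg hl.not_gt, if_neg hl.not_gt]; push_cast; ring
  have pos1 : ∀ {i j}, i ≠ j → pos (g i) (uu g i j) ∈ Ioo (0:ℝ) 1 ∧ g i (pos (g i) (uu g i j)) = uu g i j := by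
    intro i j hij
    have hm := uu_mem hf hij
    refine ⟨pos_Ioo (hf.jc i) hm.1 ?_, (pos_spec (hf.jc i) hm.1).2.2⟩
    intro he
    apply h0 i j hij
    rw [he]; exact hm.2
  have hX : ∀ a b c, ∃ m : ℤ, a ≠ b → a ≠ c → b ≠ c → VP g a b (g c 0) - GG L b c + GG L a c = m := by
    intro a b c
    by_cases hh : a ≠ b ∧ a ≠ c ∧ b ≠ c
    · obtain ⟨hab, hac, hbc⟩ := hh
      have : ∃ m : ℤ, VP g a b (g c 0) - GG L b c + GG L a c = m := by
        rw [← ee_eq_one_iff]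
        unfold VP
        rw [ee_add, ee_sub, ee_sub, hG hac, hG hbc,
          V_ee (hf.jc a).cont (fun t _ => off (h0 c a hac.symm) t),
          V_ee (hf.jc b).cont (fun t _ => off (h0 c b hbc.symm) t), (pos1 hab).2, (pos1 hab.symm).2, uu_comm g b a]
        have h1 := p0 hac
        have h2 := p0 hbc
        have h3 : uu g a b - g c 0 ≠ 0 := by
          intro he
          apply h0 c a hac.symm
          rw [← sub_eq_zero.1 he]; exact (uu_mem hf hab).1
        field_simp
      obtain ⟨m, hm⟩ := this
      exact ⟨m, fun _ _ _ => hm⟩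
    · exact ⟨0, fun h1 h2 h3 => absurd ⟨h1, h2, h3⟩ hh⟩
  choose X hX using hX
  have even : ∀ {a b c d}, a ≠ c → a ≠ b → c ≠ d → a ≠ d → b ≠ c →
      ∃ x : ℤ, cr (g a) 0 (pos (g a) (uu g a b)) (g c) 0 (pos (g c) (uu g c d)) = x ∧ x % 2 = 0 := by
    intro a b c d hac hab hcd had hbc
    obtain ⟨i1, e1⟩ := pos1 hab
    obtain ⟨i2, e2⟩ := pos1 hcd
    refine P0 (hf.jc a) (hf.jc c) (hf.two a c hac) i1 i2 (h0 a c hac)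
      (by rw [e1]; exact uu_off hf hab hac hbc)
      (h0 c a hac.symm) (by rw [e2]; exact uu_off hf hcd hac.symm had.symm) ?_ ?_
    · rw [e2]; exact hs a c d hac hcd had
    · rw [e1]; exact hs c a b hac.symm hab hbc.symm
  have good : Good (fun a b : Fin 5 => a ≠ b) (fun a b => if a < b then 1 else 0) X := by
    refine ⟨fun a b h => h.symm, fun a h => h rfl, ?_, ?_, ?_⟩
    · intro a b hab
      rcases lt_or_gt_of_ne hab with hl | hl
      · rw [if_pos hl, if_neg hl.not_gt]; rfl
      · rw [if_pos hl, if_neg hl.not_gt]; rfl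
    · intro a b c hab hac hbc
      have h1 := hX a b c hab hac hbc
      have h2 := hX b a c hab.symm hbc hac
      have : ((X a b c : ℤ) : ℂ) = ((-X b a c : ℤ) : ℂ) := by
        push_cast
        rw [← h1, ← h2]; unfold VP; ring
      have : X a b c = -X b a c := by exact_mod_cast this
      omega
    · intro a b c d hac had hbc hbd hab hcd
      obtain ⟨x1, e1, o1⟩ := even (a := a) (b := b) (c := c) (d := d) hac hab hcd had hbc
      obtain ⟨x2, e2, o2⟩ := even (a := b) (b := a) (c := c) (d := d) hbc hab.symm hcd hbd hac
      obtain ⟨x3, e3, o3⟩ := even (a := a) (b := b) (c := d) (d := c) had hab hcd.symm hac hbd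
      obtain ⟨x4, e4, o4⟩ := even (a := b) (b := a) (c := d) (d := c) hbd hab.symm hcd.symm hbc had
      have f1 := hX a b c hab hac hbc
      have f2 := hX a b d hab had hbd
      have f3 := hX c d a hcd hac.symm had.symm
      have f4 := hX c d b hcd hbc.symm hbd.symm
      have g1 := hGs hac
      have g2 := hGs had
      have g3 := hGs hbc
      have g4 := hGs hbd
      generalize (if a < c then 1 else 0 : ℤ) = s1 at *
      generalize (if a < d then 1 else 0 : ℤ) = s2 at *
      generalize (if b < c then 1 else 0 : ℤ) = s3 at *
      generalize (if b < d then 1 else 0 : ℤ) = s4 at *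
      have key : ((x1 - x2 - x3 + x4 : ℤ) : ℂ) =
          ((X a b c - X a b d + X c d b - X c d a - s3 + s1 + s4 - s2 : ℤ) : ℂ) := by
        push_cast
        rw [← e1, ← e2, ← e3, ← e4, ← f1, ← f2, ← f3, ← f4]
        unfold cr VP
        rw [(pos1 hab).2, (pos1 hab.symm).2, (pos1 hcd).2, (pos1 hcd.symm).2, uu_comm g b a,
          uu_comm g d c]
        linear_combination g3 - g1 - g4 + g2
      have key' : x1 - x2 - x3 + x4 = X a b c - X a b d + X c d b - X c d a - s3 + s1 + s4 - s2 := by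
        exact_mod_cast key
      omega
  exact good.noK5 (a := 0) (b := 1) (c := 2) (d := 3) (e := 4) (by decide) (by decide) (by decide)
    (by decide) (by decide) (by decide) (by decide) (by decide) (by decide) (by decide)
end k5
end PC

namespace PC
open Set

section base
variable {A B i k g ρ : ℝ → ℂ}

lemma hit (hg : JC g) (hA : Continuous A) {s t : ℝ} (hst : s ≤ t)
    (h : w g (A s) ≠ w g (A t)) : ∃ u ∈ Icc s t, A u ∈ range g := by
  by_contra hc
  push Not at hc
  apply h
  apply w_const hg hA
  intro u hu
  rw [uIcc_of_le hst] at hu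
  exact hc u hu

/-- hits of `ρ` with `range g` on `[s,t]` are unique -/
def Uq (ρ g : ℝ → ℂ) (s t : ℝ) : Prop :=
  ∀ u ∈ Icc s t, ∀ v ∈ Icc s t, ρ u ∈ range g → ρ v ∈ range g → u = v

lemma FC_path (hg : JC g) (hρ : Continuous ρ) {m : ℝ} (m0 : 0 < m) (m1 : m ≤ 1)
    (r0 : ρ 0 ∉ range g) (rm : ρ m ∉ range g) (r1 : ρ 1 ∉ range g)
    (u0 : Uq ρ g 0 m) (u1 : Uq ρ g m 1)
    (hodd : (w g (ρ m) - w g (ρ 0)) % 2 = 1) (heven : (w g (ρ 1) - w g (ρ m)) % 2 = 0) :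
    ∃ τ, FC ρ g τ := by
  obtain ⟨τ, hτ, hm⟩ := hit hg hρ m0.le (by intro h; rw [h] at hodd; simp at hodd)
  have t0 : 0 < τ := lt_of_le_of_ne hτ.1 (by rintro rfl; exact r0 hm)
  have tm : τ < m := lt_of_le_of_ne hτ.2 (by rintro rfl; exact rm hm)
  have wc : ∀ s t, s ≤ t → (∀ u ∈ Icc s t, ρ u ∉ range g) → w g (ρ s) = w g (ρ t) := by
    intro s t hst h
    by_contra hne
    obtain ⟨u, hu, hu'⟩ := hit hg hρ hst hne
    exact h u hu hu'
  refine ⟨τ, r0, r1, t0, by linarith, hm, ?_, ?_, ?_, by omega⟩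
  · intro σ hσ σ' hσ' n n' h h'
    have key : ∀ s ∈ Icc (0:ℝ) 1, s ≠ τ → ρ s ∈ range g → m ≤ s := by
      intro s hs hn hs'
      by_contra hc
      exact hn (u0 s ⟨hs.1, by linarith⟩ τ hτ hs' hm)
    exact u1 σ ⟨key σ hσ n h, hσ.2⟩ σ' ⟨key σ' hσ' n' h', hσ'.2⟩ h h'
  · intro σ hσ hl hn
    rw [wc 0 σ hσ.1]
    · simp
    · intro u hu hu'
      have := u0 u ⟨hu.1, by linarith [hu.2]⟩ τ hτ hu' hm
      linarith [hu.2]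
  · intro σ hσ hl hn
    rcases le_or_gt σ m with hsm | hsm
    · rw [wc σ m hsm]
      · omega
      · intro u hu hu'
        have := u0 u ⟨by linarith [hu.1], hu.2⟩ τ hτ hu' hm
        linarith [hu.1]
    · by_cases hh : ∃ u ∈ Icc m σ, ρ u ∈ range g
      · obtain ⟨u, hu, hu'⟩ := hh
        rw [wc σ 1 hσ.2]
        · simp
        · intro v hv hv'
          have := u1 u ⟨hu.1, hu.2.trans hσ.2⟩ v ⟨by linarith [hv.1], hv.2⟩ hu' hv'
          have : u = σ := le_antisymm hu.2 (by rw [this]; exact hv.1)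
          rw [this] at hu'
          exact hn hu'
      · push Not at hh
        rw [← wc m σ hsm.le hh]
        omega

lemma FC.reverse {τ : ℝ} (h : FC (fun u => ρ (1 - u)) g τ) : FC ρ g (1 - τ) := by
  have r0 := h.r0
  have r1 := h.r1
  have odd := h.odd
  simp only [sub_zero, sub_self] at r0 r1 odd
  have mm : ∀ σ, σ ∈ Icc (0:ℝ) 1 → 1 - σ ∈ Icc (0:ℝ) 1 := fun σ hσ => ⟨by linarith [hσ.2], by linarith [hσ.1]⟩
  refine ⟨r1, r0, by linarith [h.t1], by linarith [h.t0], h.mem, ?_, ?_, ?_, by omega⟩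
  · intro σ hσ σ' hσ' n n' q q'
    have := h.uniq (1 - σ) (mm _ hσ) (1 - σ') (mm _ hσ') (fun e => n (by linarith))
      (fun e => n' (by linarith)) (by simpa using q) (by simpa using q')
    linarith
  · intro σ hσ hl hn
    have := h.hi (1 - σ) (mm _ hσ) (by linarith) (by simpa using hn)
    simpa using this
  · intro σ hσ hl hn
    have := h.lo (1 - σ) (mm _ hσ) (by linarith) (by simpa using hn)
    simpa using this

lemma JC.one (hA : JC A) : A 1 = A 0 := by simpa using hA.per 0

lemma one_hit (hA : JC A) (hg : JC g) (h2 : AtMost2 (range A ∩ range g)) {T : ℝ}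
    (hT : T ∈ Ioo (0:ℝ) 1) (hodd : (w g (A T) - w g (A 0)) % 2 = 1) (hn : A T ∉ range g)
    (h0 : A 0 ∉ range g) : Uq A g 0 T := by
  obtain ⟨u, hu, hu'⟩ := hit hg hA.cont hT.2.le (by
    rw [hA.one]; intro h; rw [h] at hodd; simp at hodd)
  have u1 : u < 1 := lt_of_le_of_ne hu.2 (by rintro rfl; rw [hA.one] at hu'; exact h0 hu')
  have key : ∀ x ∈ Icc 0 T, A x ∈ range g → A x ≠ A u := by
    intro x hx hxg he
    have := hA.inj1 he (by linarith [hx.2, hu.1]) (by linarith [hx.1])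
    subst this
    have : x = T := le_antisymm hx.2 hu.1
    rw [this] at hxg
    exact hn hxg
  intro x hx y hy hxg hyg
  rcases h2 (A x) ⟨⟨x, rfl⟩, hxg⟩ (A y) ⟨⟨y, rfl⟩, hyg⟩ (A u) ⟨⟨u, rfl⟩, hu'⟩ with e | e | e
  · exact hA.inj1 e (by linarith [hx.2, hT.2, hy.1]) (by linarith [hy.2, hT.2, hx.1])
  · exact absurd e (key x hx hxg)
  · exact absurd e (key y hy hyg)

/-- two directions: one of them has at most one hit -/
lemma two_dir (hA : JC A) (h2 : AtMost2 (range A ∩ range g)) {T T' : ℝ}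
    (hT0 : 0 < T) (hT' : 0 < T') (hTT : T ≤ 1 - T') (hn : A T ∉ range g)
    (h0 : A 0 ∉ range g) : Uq A g 0 T ∨ Uq (fun t => A (-t)) g 0 T' := by
  by_contra hc
  push Not at hc
  obtain ⟨c1, c2⟩ := hc
  apply c1
  intro x hx y hy hxg hyg
  have : ∃ z ∈ Icc 0 T', A (-z) ∈ range g := by
    by_contra hh
    push Not at hh
    apply c2
    intro u hu v hv hu' 
    exact absurd hu' (hh u hu)
  obtain ⟨z, hz, hzg⟩ := this
  have z0 : 0 < z := lt_of_le_of_ne hz.1 (by rintro rfl; rw [neg_zero] at hzg; exact h0 hzg)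
  have per : A (-z) = A (1 - z) := by rw [← hA.per (-z)]; congr 1; ring
  rw [per] at hzg
  have key : ∀ x ∈ Icc 0 T, A x ∈ range g → A x ≠ A (1 - z) := by
    intro x hx hxg he
    have := hA.inj1 he (by linarith [hx.2, hz.2]) (by linarith [hx.1])
    have : x = T := le_antisymm hx.2 (by linarith [hz.2])
    rw [this] at hxg
    exact hn hxg
  rcases h2 (A x) ⟨⟨x, rfl⟩, hxg⟩ (A y) ⟨⟨y, rfl⟩, hyg⟩ (A (1 - z)) ⟨⟨_, rfl⟩, hzg⟩ with e | e | e
  · exact hA.inj1 e (by linarith [hx.2, hy.1]) (by linarith [hy.2, hx.1])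
  · exact absurd e (key x hx hxg)
  · exact absurd e (key y hy hyg)

lemma JC.range_eq (h : JC g) : range g = g '' Icc 0 1 := by
  apply Subset.antisymm
  · rintro x hx
    obtain ⟨t, h1, h2, h3⟩ := h.exists_Ico 0 hx
    exact ⟨t, ⟨h1, by linarith⟩, h3⟩
  · rintro _ ⟨t, -, rfl⟩; exact ⟨t, rfl⟩

lemma JC.closed (h : JC g) : IsClosed (range g) := by
  rw [h.range_eq]
  exact (isCompact_Icc.image h.cont).isClosed

lemma first_hit (hA : JC A) {S : Set ℂ} (hS : IsClosed S) (hne : (range A ∩ S).Nonempty)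
    (h0 : A 0 ∉ S) : ∃ T ∈ Ioo (0:ℝ) 1, A T ∈ S ∧ ∀ t, 0 ≤ t → t < T → A t ∉ S := by
  obtain ⟨x, hx, hxS⟩ := hne
  obtain ⟨t, t1, t2, rfl⟩ := hA.exists_Ico 0 hx
  have hc : IsCompact (Icc (0:ℝ) t ∩ A ⁻¹' S) := isCompact_Icc.inter_right (hS.preimage hA.cont)
  obtain ⟨T, hT, hmin⟩ := hc.exists_isLeast ⟨t, ⟨t1, le_refl _⟩, hxS⟩
  refine ⟨T, ⟨lt_of_le_of_ne hT.1.1 ?_, by linarith [hT.1.2]⟩, hT.2, ?_⟩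
  · rintro rfl; exact h0 hT.2
  · intro s s0 sT hs
    have := hmin ⟨⟨s0, by linarith [hT.1.2]⟩, hs⟩
    linarith

/-- `x` lies on the side of `a` not containing `b` -/
def Bad (a b : ℝ → ℂ) (x : ℂ) : Prop :=
  x ∉ range a ∧ ∃ q ∈ range b, q ∉ range a ∧ (w a x - w a q) % 2 = 1

lemma Bad.odd (hi : JC i) (hk : JC k) (ht : Tch i k) {x q : ℂ} (h : Bad i k x) (hq : q ∈ range k)
    (hq' : q ∉ range i) : (w i x - w i q) % 2 = 1 := by
  obtain ⟨_, q', h1, h2, h3⟩ := h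
  rwa [touch_w hi hk ht hq h1 hq' h2]

lemma Bad.diff {x y : ℂ} (h : Bad i k x) (hy : ¬ Bad i k y)
    (hyi : y ∉ range i) : (w i x - w i y) % 2 = 1 ∧ (w i y - w i x) % 2 = 1 := by
  obtain ⟨_, q', h1, h2, h3⟩ := h
  unfold Bad at hy
  push Not at hy
  have := hy hyi q' h1 h2
  omega

lemma Bad.same {x y q : ℂ} (hx : ¬ Bad i k x) (hy : ¬ Bad i k y) (hxi : x ∉ range i)
    (hyi : y ∉ range i) (hq : q ∈ range k) (hq' : q ∉ range i) : (w i x - w i y) % 2 = 0 := by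
  unfold Bad at hy hx
  push Not at hy hx
  have := hy hyi q hq hq'
  have := hx hxi q hq hq'
  omega

lemma Bad.disj (hi : JC i) (hk : JC k) (ht : Tch i k) {c : ℝ → ℂ} (hc : JC c)
    (hno : ∀ x, x ∈ range c → x ∈ range i → x ∉ range k)
    (hne : (range c ∩ (range i ∪ range k)).Nonempty) {x : ℂ} (hx : x ∈ range c)
    (h1 : Bad i k x) (h2 : Bad k i x) : False := by
  obtain ⟨s, rfl⟩ := hx
  have hs := hc.shift s
  obtain ⟨T, hT, hm, hT'⟩ := first_hit hs (hi.closed.union hk.closed) (by rwa [range_shift])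
    (by rintro (h | h) <;> rw [zero_add] at h
        · exact h1.1 h
        · exact h2.1 h)
  have e0 : c s = (fun t => c (t + s)) 0 := by simp
  rcases hm with hm | hm
  · have hk' : c (T + s) ∉ range k := hno _ ⟨_, rfl⟩ hm
    have := h2.odd hk hi ht.symm hm hk'
    rw [e0] at this
    rw [w_const hk hs.cont (d := T)] at this
    · simp at this
    · intro u hu hu'
      rw [uIcc_of_le hT.1.le] at hu
      rcases hu.2.lt_or_eq with e | e
      · exact hT' u hu.1 e (Or.inr hu')
      · subst e; exact hk' hu'
  · have hi' : c (T + s) ∉ range i := fun h => hno _ ⟨_, rfl⟩ h hm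
    have := h1.odd hi hk ht hm hi'
    rw [e0] at this
    rw [w_const hi hs.cont (d := T)] at this
    · simp at this
    · intro u hu hu'
      rw [uIcc_of_le hT.1.le] at hu
      rcases hu.2.lt_or_eq with e | e
      · exact hT' u hu.1 e (Or.inl hu')
      · subst e; exact hi' hu'

def sgn (d : Bool) : ℝ := if d then 1 else -1
def go (g : ℝ → ℂ) (d : Bool) (o : ℂ) : ℝ → ℂ := fun t => g (pos g o + sgn d * t)

lemma go_neg (g : ℝ → ℂ) (o : ℂ) (d : Bool) : go g (!d) o = fun t => go g d o (-t) := by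
  funext t; unfold go sgn; cases d <;> simp
lemma go_true (g : ℝ → ℂ) (o : ℂ) : go g true o = fun t => g (t + pos g o) := by
  funext t; unfold go sgn; simp [add_comm]
lemma go_jc (h : JC g) (d : Bool) (o : ℂ) : JC (go g d o) := by
  cases d
  · have := go_neg g o true
    rw [Bool.not_true] at this
    rw [this, go_true]; exact (h.shift _).rev
  · rw [go_true]; exact h.shift _
lemma go_range (g : ℝ → ℂ) (d : Bool) (o : ℂ) : range (go g d o) = range g := by
  cases d
  · have := go_neg g o true
    rw [Bool.not_true] at this
    rw [this, range_rev, go_true, range_shift]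
  · rw [go_true, range_shift]
lemma go_zero (h : JC g) (d : Bool) {o : ℂ} (ho : o ∈ range g) : go g d o 0 = o := by
  unfold go; rw [mul_zero, add_zero]; exact (pos_spec h ho).2.2

lemma pos_eq (h : JC g) {T : ℝ} (h0 : 0 ≤ T) (h1 : T < 1) : pos g (g T) = T := by
  obtain ⟨p, q, r⟩ := pos_spec h ⟨T, rfl⟩
  exact h.inj1 r (by linarith) (by linarith)

/-- single arc base -/
def arc1 (a : ℝ → ℂ) (o o' : ℂ) : ℝ → ℂ := fun u => go a true o (u * pos (go a true o) o')


def arc2 (a : ℝ → ℂ) (d : Bool) (o x : ℂ) (b : ℝ → ℂ) (d' : Bool) (o' : ℂ) : ℝ → ℂ := fun u =>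
  go a d o (min (2 * u) 1 * pos (go a d o) x) + go b d' x (max (2 * u - 1) 0 * pos (go b d' x) o') - x

end base
end PC

namespace PC
open Set

section base2
variable {a b g : ℝ → ℂ}

lemma arc1_cont (ha : JC a) (o o' : ℂ) : Continuous (arc1 a o o') := by
  have := (go_jc ha true o).cont
  unfold arc1; fun_prop

lemma arc1_mem (o o' : ℂ) (u : ℝ) : arc1 a o o' u ∈ range a := by
  rw [← go_range a true o]; exact ⟨_, rfl⟩

lemma go_pos (ha : JC a) (d : Bool) {o o' : ℂ} (ho : o ∈ range a) (ho' : o' ∈ range a) (hne : o ≠ o') :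
    pos (go a d o) o' ∈ Ioo (0:ℝ) 1 ∧ go a d o (pos (go a d o) o') = o' := by
  have h' : o' ∈ range (go a d o) := by rwa [go_range]
  exact ⟨pos_Ioo (go_jc ha d o) h' (by rw [go_zero ha d ho]; exact hne),
    (pos_spec (go_jc ha d o) h').2.2⟩

lemma Uq.scale {A : ℝ → ℂ} {T : ℝ} (hT : 0 < T) (h : Uq A g 0 T) : Uq (fun u => A (u * T)) g 0 1 := by
  intro u hu v hv hug hvg
  have := h (u * T) ⟨mul_nonneg hu.1 hT.le, by nlinarith [hu.2]⟩ (v * T)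
    ⟨mul_nonneg hv.1 hT.le, by nlinarith [hv.2]⟩ hug hvg
  exact mul_right_cancel₀ hT.ne' this

lemma inj_scale {A : ℝ → ℂ} (hA : JC A) {T : ℝ} (hT : T ∈ Ioo (0:ℝ) 1) {u v : ℝ}
    (hu : u ∈ Icc (0:ℝ) 1) (hv : v ∈ Icc (0:ℝ) 1) (h : A (u * T) = A (v * T)) : u = v := by
  have h1 := hT.1
  have h2 := hT.2
  have := hA.inj1 h (by nlinarith [hu.2, mul_nonneg hv.1 h1.le]) (by nlinarith [hv.2, mul_nonneg hu.1 h1.le])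
  exact mul_right_cancel₀ hT.1.ne' this

lemma arc1_inj (ha : JC a) {o o' : ℂ} (ho : o ∈ range a) (ho' : o' ∈ range a) (hne : o ≠ o') :
    InjOn (arc1 a o o') (Icc 0 1) := by
  intro u hu v hv h
  exact inj_scale (go_jc ha true o) (go_pos ha true ho ho' hne).1 hu hv h

lemma arc1_FC (ha : JC a) (hg : JC g) {o o' : ℂ} (ho : o ∈ range a) (ho' : o' ∈ range a)
    (h2 : AtMost2 (range a ∩ range g)) (og : o ∉ range g) (og' : o' ∉ range g)
    (hodd : (w g o' - w g o) % 2 = 1) : ∃ τ, FC (arc1 a o o') g τ := by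
  have hne : o ≠ o' := by rintro rfl; simp at hodd
  obtain ⟨hT, hT'⟩ := go_pos ha true ho ho' hne
  have e0 : arc1 a o o' 0 = o := by unfold arc1; rw [zero_mul, go_zero ha true ho]
  have e1 : arc1 a o o' 1 = o' := by unfold arc1; rw [one_mul, hT']
  have hu := one_hit (go_jc ha true o) hg (by rwa [go_range]) hT (by rwa [hT', go_zero ha true ho])
    (by rwa [hT']) (by rwa [go_zero ha true ho])
  refine FC_path hg (arc1_cont ha o o') one_pos le_rfl (by rwa [e0]) (by rwa [e1]) (by rwa [e1])
    (hu.scale hT.1) ?_ (by rwa [e0, e1]) (by simp)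
  intro u hu v hv _ _
  linarith [hu.1, hu.2, hv.1, hv.2]

structure A2 (a : ℝ → ℂ) (d : Bool) (o x : ℂ) (b : ℝ → ℂ) (d' : Bool) (o' : ℂ) : Prop where
  ha : JC a
  hb : JC b
  oa : o ∈ range a
  xa : x ∈ range a
  xb : x ∈ range b
  ob : o' ∈ range b
  ox : o ≠ x
  xo : x ≠ o'
  first : ∀ t, 0 ≤ t → t < pos (go a d o) x → go a d o t ∉ range b

variable {d d' : Bool} {o x o' : ℂ}

lemma A2.cont (h : A2 a d o x b d' o') : Continuous (arc2 a d o x b d' o') := by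
  have := (go_jc h.ha d o).cont
  have := (go_jc h.hb d' x).cont
  unfold arc2; fun_prop

lemma A2.left (h : A2 a d o x b d' o') {u : ℝ} (hu : u ≤ 1/2) :
    arc2 a d o x b d' o' u = go a d o ((2 * u) * pos (go a d o) x) := by
  unfold arc2
  rw [min_eq_left (by linarith), max_eq_right (by linarith), zero_mul, go_zero h.hb d' h.xb]
  ring

lemma A2.right (h : A2 a d o x b d' o') {u : ℝ} (hu : 1/2 ≤ u) :
    arc2 a d o x b d' o' u = go b d' x ((2 * u - 1) * pos (go b d' x) o') := by
  unfold arc2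
  rw [min_eq_right (by linarith), max_eq_left (by linarith), one_mul, (go_pos h.ha d h.oa h.xa h.ox).2]
  ring

lemma A2.zero (h : A2 a d o x b d' o') : arc2 a d o x b d' o' 0 = o := by
  rw [h.left (by norm_num), mul_zero, zero_mul, go_zero h.ha d h.oa]
lemma A2.half (h : A2 a d o x b d' o') : arc2 a d o x b d' o' (1/2) = x := by
  rw [h.left le_rfl]
  norm_num
  exact (go_pos h.ha d h.oa h.xa h.ox).2
lemma A2.one (h : A2 a d o x b d' o') : arc2 a d o x b d' o' 1 = o' := by
  rw [h.right (by norm_num)]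
  norm_num
  exact (go_pos h.hb d' h.xb h.ob h.xo).2

lemma A2.mem (h : A2 a d o x b d' o') (u : ℝ) :
    arc2 a d o x b d' o' u ∈ range a ∨ arc2 a d o x b d' o' u ∈ range b := by
  rcases le_total u (1/2) with hu | hu
  · left; rw [h.left hu, ← go_range a d o]; exact ⟨_, rfl⟩
  · right; rw [h.right hu, ← go_range b d' x]; exact ⟨_, rfl⟩

lemma A2.inj (h : A2 a d o x b d' o') : InjOn (arc2 a d o x b d' o') (Icc 0 1) := by
  obtain ⟨hT, eT⟩ := go_pos h.ha d h.oa h.xa h.ox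
  obtain ⟨hS, eS⟩ := go_pos h.hb d' h.xb h.ob h.xo
  have key : ∀ u ∈ Icc (0:ℝ) 1, ∀ v ∈ Icc (0:ℝ) 1, u ≤ v →
      arc2 a d o x b d' o' u = arc2 a d o x b d' o' v → u = v := by
    intro u hu v hv huv he
    rcases le_total v (1/2) with h1 | h1
    · rw [h.left (huv.trans h1), h.left h1] at he
      have := inj_scale (go_jc h.ha d o) hT ⟨by linarith [hu.1], by linarith⟩
        ⟨by linarith [hv.1], by linarith⟩ he
      linarith
    rcases le_or_gt (1/2) u with h2 | h2
    · rw [h.right h2, h.right h1] at he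
      have := inj_scale (go_jc h.hb d' x) hS ⟨by linarith, by linarith [hu.2]⟩
        ⟨by linarith, by linarith [hv.2]⟩ he
      linarith
    · exfalso
      rw [h.left h2.le, h.right h1] at he
      apply h.first (2 * u * pos (go a d o) x) (mul_nonneg (by linarith [hu.1]) hT.1.le)
      · have := hT.1; nlinarith
      · rw [he, ← go_range b d' x]; exact ⟨_, rfl⟩
  intro u hu v hv he
  rcases le_total u v with h1 | h1
  · exact key u hu v hv h1 he
  · exact (key v hv u hu h1 he.symm).symm

lemma A2.uq_left (h : A2 a d o x b d' o') (hU : Uq (go a d o) g 0 (pos (go a d o) x)) :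
    Uq (arc2 a d o x b d' o') g 0 (1/2) := by
  have := hU.scale (go_pos h.ha d h.oa h.xa h.ox).1.1
  intro u hu v hv hug hvg
  rw [h.left hu.2] at hug
  rw [h.left hv.2] at hvg
  have := this (2 * u) ⟨by linarith [hu.1], by linarith [hu.2]⟩ (2 * v)
    ⟨by linarith [hv.1], by linarith [hv.2]⟩ hug hvg
  linarith

lemma A2.uq_right (h : A2 a d o x b d' o') (hU : Uq (go b d' x) g 0 (pos (go b d' x) o')) :
    Uq (arc2 a d o x b d' o') g (1/2) 1 := by
  have := hU.scale (go_pos h.hb d' h.xb h.ob h.xo).1.1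
  intro u hu v hv hug hvg
  rw [h.right hu.1] at hug
  rw [h.right hv.1] at hvg
  have := this (2 * u - 1) ⟨by linarith [hu.1], by linarith [hu.2]⟩ (2 * v - 1)
    ⟨by linarith [hv.1], by linarith [hv.2]⟩ hug hvg
  linarith

lemma A2.FC_left (h : A2 a d o x b d' o') (hg : JC g) (og : o ∉ range g) (xg : x ∉ range g)
    (og' : o' ∉ range g) (u0 : Uq (go a d o) g 0 (pos (go a d o) x))
    (u1 : Uq (go b d' x) g 0 (pos (go b d' x) o')) (hodd : (w g x - w g o) % 2 = 1)
    (heven : (w g o' - w g x) % 2 = 0) : ∃ τ, FC (arc2 a d o x b d' o') g τ :=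
  FC_path hg h.cont (by norm_num : (0:ℝ) < 1/2) (by norm_num) (by rwa [h.zero]) (by rwa [h.half])
    (by rwa [h.one]) (h.uq_left u0) (h.uq_right u1) (by rwa [h.half, h.zero]) (by rwa [h.half, h.one])

lemma A2.FC_right (h : A2 a d o x b d' o') (hg : JC g) (og : o ∉ range g) (xg : x ∉ range g)
    (og' : o' ∉ range g) (u0 : Uq (go a d o) g 0 (pos (go a d o) x))
    (u1 : Uq (go b d' x) g 0 (pos (go b d' x) o')) (hodd : (w g x - w g o') % 2 = 1)
    (heven : (w g o - w g x) % 2 = 0) : ∃ τ, FC (arc2 a d o x b d' o') g τ := by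
  have e1 : (1:ℝ) - 1/2 = 1/2 := by norm_num
  have hc := h.cont
  have : ∃ τ, FC (fun u => arc2 a d o x b d' o' (1 - u)) g τ := by
    refine FC_path hg (by fun_prop) (by norm_num : (0:ℝ) < 1/2) (by norm_num) ?_ ?_ ?_ ?_ ?_ ?_ ?_
    · simp only [sub_zero]; rwa [h.one]
    · simp only [e1]; rwa [h.half]
    · simp only [sub_self]; rwa [h.zero]
    · intro u hu v hv hug hvg
      have := h.uq_right u1 (1 - u) ⟨by linarith [hu.2], by linarith [hu.1]⟩ (1 - v)
        ⟨by linarith [hv.2], by linarith [hv.1]⟩ hug hvg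
      linarith
    · intro u hu v hv hug hvg
      have := h.uq_left u0 (1 - u) ⟨by linarith [hu.2], by linarith [hu.1]⟩ (1 - v)
        ⟨by linarith [hv.2], by linarith [hv.1]⟩ hug hvg
      linarith
    · simp only [e1, sub_zero]; rwa [h.half, h.one]
    · simp only [e1, sub_self]; rwa [h.half, h.zero]
  obtain ⟨τ, hτ⟩ := this
  exact ⟨_, hτ.reverse⟩

end base2

abbrev W := Fin 4 × Bool
abbrev Code := (W × W × W × Bool × Bool) ⊕ (W × W × W × W × Bool × Bool × Bool × Bool × Bool)

def base {ι : Type*} (g : ι → ℝ → ℂ) (pt : ι → ι → Bool → ℂ) (v : W → ι) : Code → ℝ → ℂ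
  | Sum.inl (c, c', c'', β, β') =>
    arc1 (g (v c)) (pt (v c) (v c') β) (pt (v c) (v c'') β')
  | Sum.inr (a, a', b, b', β, β', γ, d, d') =>
    arc2 (g (v a)) d (pt (v a) (v a') β) (pt (v a) (v b) γ) (g (v b)) d' (pt (v b) (v b') β')

structure GB {ι : Type*} (g : ι → ℝ → ℂ) (v : W → ι) (i k : ι) (ρ : ℝ → ℂ) : Prop where
  cont : Continuous ρ
  inj : InjOn ρ (Icc 0 1)
  mem : ∀ u, ∃ c, ρ u ∈ range (g (v c))
  fi : ∃ τ, FC ρ (g i) τ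
  fk : ∃ τ, FC ρ (g k) τ

section ex
variable {ι : Type*} {g : ι → ℝ → ℂ} {pt : ι → ι → Bool → ℂ} {v : W → ι} {i k : ι}

lemma Fam.off (hf : Fam g) {i j k : ι} (hij : i ≠ j) (hik : i ≠ k) (hjk : j ≠ k) {x : ℂ}
    (h1 : x ∈ range (g i)) (h2 : x ∈ range (g j)) : x ∉ range (g k) := by
  intro hm
  rcases hf.gp _ i j k h1 h2 hm with e | e | e
  · exact hij e
  · exact hik e
  · exact hjk e

lemma base_ex (hf : Fam g) (hpt : ∀ i j, i ≠ j → ∀ x ∈ range (g i) ∩ range (g j), ∃ β, pt i j β = x)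
    (hv : Function.Injective v) (hik : i ≠ k) (hvi : ∀ c, v c ≠ i) (hvk : ∀ c, v c ≠ k)
    (ht : Tch (g i) (g k)) {a a' b b' : W} (haa : a ≠ a') (hbb : b ≠ b') {o o' : ℂ}
    (oa : o ∈ range (g (v a))) (oa' : o ∈ range (g (v a')))
    (ob : o' ∈ range (g (v b))) (ob' : o' ∈ range (g (v b')))
    (hoi : Bad (g i) (g k) o) (hok : Bad (g k) (g i) o') :
    ∃ code, GB g v i k (base g pt v code) := by
  have ji := hf.jc i
  have jk := hf.jc k
  have ti := ht.symm
  have disj : ∀ c x, x ∈ range (g (v c)) → Bad (g i) (g k) x → Bad (g k) (g i) x → False := by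
    intro c x hx h1 h2
    refine Bad.disj ji jk ht (hf.jc (v c)) (fun y hy hy' => hf.off (hvi c) (hvk c) hik hy hy') ?_ hx h1 h2
    obtain ⟨y, hy⟩ := hf.ne (v c) i (hvi c)
    exact ⟨y, hy.1, Or.inl hy.2⟩
  -- single arc case
  have single : ∀ c c' c'' : W, c ≠ c' → c ≠ c'' → ∀ x y, x ∈ range (g (v c)) → x ∈ range (g (v c')) →
      y ∈ range (g (v c)) → y ∈ range (g (v c'')) → Bad (g i) (g k) x → Bad (g k) (g i) y →
      ∃ code, GB g v i k (base g pt v code) := by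
    intro c c' c'' h1 h2 x y x1 x2 y1 y2 bx bY
    obtain ⟨β, hβ⟩ := hpt (v c) (v c') (hv.ne h1) x ⟨x1, x2⟩
    obtain ⟨β', hβ'⟩ := hpt (v c) (v c'') (hv.ne h2) y ⟨y1, y2⟩
    have nyi : ¬ Bad (g i) (g k) y := fun h => disj c y y1 h bY
    have nxk : ¬ Bad (g k) (g i) x := fun h => disj c x x1 bx h
    have xi : x ∉ range (g i) := bx.1
    have yk : y ∉ range (g k) := bY.1
    have xk : x ∉ range (g k) := hf.off (hv.ne h1) (hvk c) (hvk c') x1 x2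
    have yi : y ∉ range (g i) := hf.off (hv.ne h2) (hvi c) (hvi c'') y1 y2
    refine ⟨Sum.inl (c, c', c'', β, β'), ?_⟩
    unfold base
    simp only
    rw [hβ, hβ']
    refine ⟨arc1_cont (hf.jc _) x y, arc1_inj (hf.jc _) x1 y1 ?_, fun u => ⟨c, arc1_mem x y u⟩, ?_, ?_⟩
    · rintro rfl; exact nyi bx
    · exact arc1_FC (hf.jc _) ji x1 y1 (hf.two _ _ (hvi c)) xi yi (bx.diff nyi yi).2
    · exact arc1_FC (hf.jc _) jk x1 y1 (hf.two _ _ (hvk c)) xk yk (bY.diff nxk xk).1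
  by_cases hab : a = b
  · subst hab
    exact single a a' b' haa hbb o o' oa oa' ob ob' hoi hok
  by_cases hx1 : ∃ x, x ∈ range (g (v a)) ∧ x ∈ range (g (v b)) ∧ Bad (g i) (g k) x
  · obtain ⟨x, xa, xb, bx⟩ := hx1
    exact single b a b' (Ne.symm hab) hbb x o' xb xa ob ob' bx hok
  by_cases hx2 : ∃ x, x ∈ range (g (v a)) ∧ x ∈ range (g (v b)) ∧ Bad (g k) (g i) x
  · obtain ⟨x, xa, xb, bx⟩ := hx2
    exact single a a' b haa hab o x oa oa' xa xb hoi bx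
  push Not at hx1 hx2
  have ja := hf.jc (v a)
  have jb := hf.jc (v b)
  have o_i := hoi.1
  have o_k : o ∉ range (g k) := hf.off (hv.ne haa) (hvk a) (hvk a') oa oa'
  have o'_k := hok.1
  have o'_i : o' ∉ range (g i) := hf.off (hv.ne hbb) (hvi b) (hvi b') ob ob'
  have no : ¬ Bad (g k) (g i) o := disj a o oa hoi
  have no' : ¬ Bad (g i) (g k) o' := fun h => disj b o' ob h hok
  have o_b : o ∉ range (g (v b)) := fun h => hx1 o oa h hoi
  -- first arc
  have arcA : ∃ d x, x ∈ range (g (v a)) ∧ x ∈ range (g (v b)) ∧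
      (∀ t, 0 ≤ t → t < pos (go (g (v a)) d o) x → go (g (v a)) d o t ∉ range (g (v b))) ∧
      Uq (go (g (v a)) d o) (g k) 0 (pos (go (g (v a)) d o) x) := by
    have hne := hf.ne (v a) (v b) (hv.ne hab)
    have fh : ∀ d, _ := fun d => first_hit (go_jc ja d o) jb.closed (by rwa [go_range])
      (by rwa [go_zero ja d oa])
    obtain ⟨T, hT, mT, fT⟩ := fh true
    obtain ⟨S, hS, mS, fS⟩ := fh false
    have mem : ∀ d t, go (g (v a)) d o t ∈ range (g (v a)) := fun d t => by
      rw [← go_range (g (v a)) d o]; exact ⟨t, rfl⟩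
    have offk : ∀ x, x ∈ range (g (v a)) → x ∈ range (g (v b)) → x ∉ range (g k) :=
      fun x h1 h2 => hf.off (hv.ne hab) (hvk a) (hvk b) h1 h2
    have hneg := go_neg (g (v a)) o true
    rw [Bool.not_true] at hneg
    have hTS : T ≤ 1 - S := by
      by_contra hc
      push Not at hc
      apply fT (1 - S) (by linarith [hS.2]) hc
      rw [hneg] at mS
      simp only at mS
      rw [← (go_jc ja true o).per (-S)] at mS
      rwa [show 1 - S = -S + 1 by ring]
    rcases two_dir (go_jc ja true o) (g := g k) (by rw [go_range]; exact hf.two _ _ (hvk a)) hT.1 hS.1 hTS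
      (offk _ (mem _ _) mT) (by rwa [go_zero ja true oa]) with hU | hU
    · refine ⟨true, go (g (v a)) true o T, mem _ _, mT, ?_⟩
      rw [pos_eq (go_jc ja true o) hT.1.le hT.2]
      exact ⟨fT, hU⟩
    · rw [← hneg] at hU
      refine ⟨false, go (g (v a)) false o S, mem _ _, mS, ?_⟩
      rw [pos_eq (go_jc ja false o) hS.1.le hS.2]
      exact ⟨fS, hU⟩
  obtain ⟨d, x, xa, xb, first, uk⟩ := arcA
  have x_i : x ∉ range (g i) := hf.off (hv.ne hab) (hvi a) (hvi b) xa xb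
  have x_k : x ∉ range (g k) := hf.off (hv.ne hab) (hvk a) (hvk b) xa xb
  have nxi := hx1 x xa xb
  have nxk := hx2 x xa xb
  have ox : o ≠ x := by rintro rfl; exact nxi hoi
  have xo : x ≠ o' := by rintro rfl; exact nxk hok
  have arcB : ∃ d', Uq (go (g (v b)) d' x) (g i) 0 (pos (go (g (v b)) d' x) o') := by
    have hneg := go_neg (g (v b)) x true
    rw [Bool.not_true] at hneg
    obtain ⟨hT, eT⟩ := go_pos jb true xb ob xo
    rcases two_dir (go_jc jb true x) (g := g i) (T := pos (go (g (v b)) true x) o')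
      (T' := 1 - pos (go (g (v b)) true x) o') (by rw [go_range]; exact hf.two _ _ (hvi b))
      hT.1 (by linarith [hT.2]) (by linarith) (by rwa [eT]) (by rwa [go_zero jb true xb]) with hU | hU
    · exact ⟨true, hU⟩
    · refine ⟨false, ?_⟩
      rw [← hneg] at hU
      have e : go (g (v b)) false x (1 - pos (go (g (v b)) true x) o') = o' := by
        rw [hneg]
        simp only
        rw [← (go_jc jb true x).per]
        convert eT using 2
        ring
      have := pos_eq (go_jc jb false x) (T := 1 - pos (go (g (v b)) true x) o') (by linarith [hT.2])
        (by linarith [hT.1])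
      rw [e] at this
      rwa [this]
  obtain ⟨d', ui⟩ := arcB
  have hA2 : A2 (g (v a)) d o x (g (v b)) d' o' := ⟨ja, jb, oa, xa, xb, ob, ox, xo, first⟩
  obtain ⟨hT, eT⟩ := go_pos ja d oa xa ox
  obtain ⟨hS, eS⟩ := go_pos jb d' xb ob xo
  have ui0 : Uq (go (g (v a)) d o) (g i) 0 (pos (go (g (v a)) d o) x) :=
    one_hit (go_jc ja d o) ji (by rw [go_range]; exact hf.two _ _ (hvi a)) hT
      (by rw [eT, go_zero ja d oa]; exact (hoi.diff nxi x_i).2) (by rwa [eT]) (by rwa [go_zero ja d oa])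
  have uk1 : Uq (go (g (v b)) d' x) (g k) 0 (pos (go (g (v b)) d' x) o') :=
    one_hit (go_jc jb d' x) jk (by rw [go_range]; exact hf.two _ _ (hvk b)) hS
      (by rw [eS, go_zero jb d' xb]; exact (hok.diff nxk x_k).1) (by rwa [eS]) (by rwa [go_zero jb d' xb])
  obtain ⟨q, hqi, hqk⟩ : ∃ q, q ∈ range (g i) ∧ q ∉ range (g k) := by
    obtain ⟨q, hq⟩ := hf.ne (v a) i (hvi a)
    exact ⟨q, hq.2, hf.off (hvi a) (hvk a) hik hq.1 hq.2⟩
  obtain ⟨q', hqk', hqi'⟩ : ∃ q, q ∈ range (g k) ∧ q ∉ range (g i) := by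
    obtain ⟨q, hq⟩ := hf.ne (v a) k (hvk a)
    exact ⟨q, hq.2, hf.off (hvk a) (hvi a) hik.symm hq.1 hq.2⟩
  obtain ⟨β, hβ⟩ := hpt (v a) (v a') (hv.ne haa) o ⟨oa, oa'⟩
  obtain ⟨β', hβ'⟩ := hpt (v b) (v b') (hv.ne hbb) o' ⟨ob, ob'⟩
  obtain ⟨γ, hγ⟩ := hpt (v a) (v b) (hv.ne hab) x ⟨xa, xb⟩
  refine ⟨Sum.inr (a, a', b, b', β, β', γ, d, d'), ?_⟩
  unfold base
  simp only
  rw [hβ, hβ', hγ]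
  refine ⟨hA2.cont, hA2.inj, ?_, ?_, ?_⟩
  · intro u
    rcases hA2.mem u with h | h
    · exact ⟨a, h⟩
    · exact ⟨b, h⟩
  · exact hA2.FC_left ji o_i x_i o'_i ui0 ui (hoi.diff nxi x_i).2
      (Bad.same no' nxi o'_i x_i hqk' hqi')
  · exact hA2.FC_right jk o_k x_k o'_k uk uk1 (hok.diff nxk x_k).2
      (Bad.same no nxk o_k x_k hqi hqk)
end ex
end PC

namespace PC
open Set

section five
variable {ι : Type*} {g : ι → ℝ → ℂ} {pt : ι → ι → Bool → ℂ}

/-- good end choice is impossible -/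
lemma bad_ex (hf : Fam g) (e : Fin 5 → Bool → ι) (he : ∀ r b r' b', e r b = e r' b' → r = r' ∧ b = b')
    (ht : ∀ r b, Tch (g (e r b)) (g (e r !b))) (β : Fin 5 → Bool) :
    ∃ r, ∃ c c' : Fin 5 × Bool, c ≠ c' ∧ c.1 ≠ r ∧ c'.1 ≠ r ∧ ∃ x, x ∈ range (g (e c.1 c.2)) ∧
      x ∈ range (g (e c'.1 c'.2)) ∧ Bad (g (e r (β r))) (g (e r (!(β r)))) x := by
  by_contra hc
  push Not at hc
  have hz : ∀ {r s}, r ≠ s → ∀ {b b'}, e r b ≠ e s b' := fun h b b' h' => h (he _ _ _ _ h').1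
  have hy : ∀ r, e r (β r) ≠ e r (!(β r)) := by
    intro r h'
    have := (he _ _ _ _ h').2
    cases hb : β r <;> simp [hb] at this
  have hp : ∀ r, ∃ s, g (e r (β r)) s ∈ range (g (e r (!(β r)))) := by
    intro r
    obtain ⟨x, ⟨s, hs⟩, hx2⟩ := hf.ne _ _ (hy r)
    exact ⟨s, by rwa [hs]⟩
  choose s hs using hp
  set g' : Fin 5 → ℝ → ℂ := fun r t => g (e r (β r)) (t + s r) with hg'
  have hR : ∀ r, Rep (g (e r (β r))) (g' r) := fun r => Rep.shift (hf.jc _) (s r)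
  have e0 : ∀ r, g' r 0 = g (e r (β r)) (s r) := by intro r; simp [hg']
  have zoff : ∀ r t, r ≠ t → g' r 0 ∉ range (g (e t (β t))) := by
    intro r t hrt
    rw [e0]
    exact hf.off (hy r) (hz hrt) (hz hrt) ⟨_, rfl⟩ (hs r)
  have hf' : Fam g' := by
    refine ⟨fun r => (hR r).jc, ?_, ?_, ?_⟩
    · intro r t hrt
      rw [(hR r).rng, (hR t).rng]; exact hf.two _ _ (hz hrt)
    · intro r t hrt
      rw [(hR r).rng, (hR t).rng]; exact hf.ne _ _ (hz hrt)
    · intro x r t u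
      rw [(hR r).rng, (hR t).rng, (hR u).rng]
      intro h1 h2 h3
      rcases hf.gp x _ _ _ h1 h2 h3 with h | h | h
      · exact Or.inl (he _ _ _ _ h).1
      · exact Or.inr (Or.inl (he _ _ _ _ h).1)
      · exact Or.inr (Or.inr (he _ _ _ _ h).1)
  refine K5 hf' ?_ ?_
  · intro r t hrt
    rw [(hR t).rng]; exact zoff r t hrt
  · intro r t u hrt htu hru
    have m := uu_mem hf' htu
    have o := uu_off hf' htu hrt.symm hru.symm
    rw [(hR t).rng, (hR u).rng] at m
    rw [(hR r).rng] at o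
    have o1 := zoff t r hrt.symm
    have p1 := (hR r).par _ o
    have p2 := (hR r).par _ o1
    have n1 := hc r (t, β t) (u, β u) (fun h => htu (congrArg Prod.fst h)) hrt.symm hru.symm
      (uu g' t u) m.1 m.2
    have n2 := hc r (t, β t) (t, !(β t)) (fun h => by
      have := congrArg Prod.snd h
      cases hb : β t <;> simp [hb] at this) hrt.symm hrt.symm
      (g' t 0) (by rw [e0]; exact ⟨_, rfl⟩) (by rw [e0]; exact hs t)
    obtain ⟨q, hq⟩ := hf.ne (e t (β t)) (e r (!(β r))) (hz hrt.symm)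
    have := Bad.same n2 n1 o1 o hq.2 (hf.off (hz hrt.symm) (hz hrt.symm) (hy r).symm hq.1 hq.2)
    omega

lemma five (hf : Fam g) (hpt : ∀ i j, i ≠ j → ∀ x ∈ range (g i) ∩ range (g j), ∃ β, pt i j β = x)
    (e : Fin 5 → Bool → ι) (he : ∀ r b r' b', e r b = e r' b' → r = r' ∧ b = b')
    (ht : ∀ r, Tch (g (e r false)) (g (e r true))) :
    ∃ r, ∃ code, GB g (fun c => e (r.succAbove c.1) c.2) (e r false) (e r true)
      (base g pt (fun c => e (r.succAbove c.1) c.2) code) := by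
  have ht' : ∀ r b, Tch (g (e r b)) (g (e r !b)) := by
    intro r b; cases b
    · exact ht r
    · exact (ht r).symm
  have : ∃ r, ∀ b, ∃ c c' : Fin 5 × Bool, c ≠ c' ∧ c.1 ≠ r ∧ c'.1 ≠ r ∧ ∃ x, x ∈ range (g (e c.1 c.2)) ∧
      x ∈ range (g (e c'.1 c'.2)) ∧ Bad (g (e r b)) (g (e r (!b))) x := by
    by_contra hc
    rw [not_exists] at hc
    have hc' : ∀ r, ∃ b, _ := fun r => not_forall.1 (hc r)
    choose β hβ using hc'
    obtain ⟨r, h⟩ := bad_ex hf e he ht' β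
    exact hβ r h
  obtain ⟨r, hr⟩ := this
  obtain ⟨a, a', haa, a1, a1', o, oa, oa', bo⟩ := hr false
  obtain ⟨b, b', hbb, b1, b1', o', ob, ob', bo'⟩ := hr true
  have lift : ∀ c : Fin 5 × Bool, c.1 ≠ r → ∃ c' : W, c = (r.succAbove c'.1, c'.2) := by
    rintro ⟨c, β⟩ hc
    obtain ⟨z, hz⟩ := Fin.exists_succAbove_eq hc
    exact ⟨(z, β), by simp [hz]⟩
  obtain ⟨a, rfl⟩ := lift a a1
  obtain ⟨a', rfl⟩ := lift a' a1'
  obtain ⟨b, rfl⟩ := lift b b1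
  obtain ⟨b', rfl⟩ := lift b' b1'
  refine ⟨r, base_ex hf hpt ?_ ?_ ?_ ?_ (ht r) (a := a) (a' := a') (b := b) (b' := b') ?_ ?_ oa oa' ob ob' bo bo'⟩
  · rintro ⟨c, x⟩ ⟨c', x'⟩ h
    obtain ⟨h1, h2⟩ := he _ _ _ _ h
    exact Prod.ext (Fin.succAbove_right_injective h1) h2
  · intro h
    have := (he _ _ _ _ h).2
    exact Bool.noConfusion this
  · intro c h
    exact Fin.succAbove_ne _ _ (he _ _ _ _ h).1
  · intro c h
    exact Fin.succAbove_ne _ _ (he _ _ _ _ h).1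
  · rintro rfl; exact haa rfl
  · rintro rfl; exact hbb rfl
end five
end PC

namespace PC
open Finset

section count
variable {α : Type*}

open Classical in
lemma count (E : Finset α) (r : Fin 5) (P : (Fin 4 → α) → α → Prop) (B : ℕ)
    (h : ∀ u, (E.filter (P u)).card ≤ B) :
    ((Fintype.piFinset (fun _ : Fin 5 => E)).filter
      (fun t => P (fun j => t (r.succAbove j)) (t r))).card ≤ B * E.card ^ 4 := by
  have h4 : E.card ^ 4 = (Fintype.piFinset (fun _ : Fin 4 => E)).card := by
    rw [Fintype.card_piFinset]; simp
  rw [h4]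
  refine card_le_mul_card_image_of_maps_to (f := fun t j => t (r.succAbove j)) ?_ B ?_
  · intro t ht
    simp only [mem_filter, Fintype.mem_piFinset] at ht ⊢
    intro j; exact ht.1 _
  · intro u hu
    refine le_trans ?_ (h u)
    refine card_le_card_of_injOn (fun t => t r) ?_ ?_
    · intro t ht
      simp only [coe_filter, mem_filter, Fintype.mem_piFinset, Set.mem_ofPred_eq] at ht ⊢
      obtain ⟨⟨h1, h2⟩, h3⟩ := ht
      rw [← h3]
      exact ⟨h1 r, h2⟩
    · intro t ht t' ht' hr
      simp only [coe_filter, mem_filter, Fintype.mem_piFinset, Set.mem_ofPred_eq] at ht ht'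
      funext j
      rcases eq_or_ne j r with hj | hj
      · subst hj; exact hr
      · obtain ⟨z, rfl⟩ := Fin.exists_succAbove_eq hj
        have := ht.2.trans ht'.2.symm
        exact congrFun this z

open Classical in
lemma eN_ge {adj : α → α → Prop} {H : Finset α} {S : Finset (α × α)}
    (h : ∀ p ∈ S, p.1 ∈ H ∧ p.2 ∈ H ∧ adj p.1 p.2) : S.card ≤ eN adj H := by
  unfold eN
  apply card_le_card
  intro p hp
  obtain ⟨h1, h2, h3⟩ := h p hp
  exact mem_filter.2 ⟨mem_product.2 ⟨h1, h2⟩, h3⟩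

def endp {β : Type*} (p : β × β) (b : Bool) : β := if b then p.2 else p.1

variable {n : ℕ} {g : Fin n → ℝ → ℂ} {pt : Fin n → Fin n → Bool → ℂ}

open Classical in
def EE (g : Fin n → ℝ → ℂ) : Finset (Fin n × Fin n) :=
  univ.filter (fun p => p.1 < p.2 ∧ Tch (g p.1) (g p.2))

def PN (s : Fin 4) (b b' : Bool) (u : Fin 4 → Fin n × Fin n) (p : Fin n × Fin n) : Prop :=
  endp p b = endp (u s) b'

def PG (g : Fin n → ℝ → ℂ) (pt : Fin n → Fin n → Bool → ℂ) (c : Code) (u : Fin 4 → Fin n × Fin n)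
    (p : Fin n × Fin n) : Prop :=
  (∀ c : W, endp (u c.1) c.2 ≠ p.1) ∧ (∀ c : W, endp (u c.1) c.2 ≠ p.2) ∧
    GB g (fun c => endp (u c.1) c.2) p.1 p.2 (base g pt (fun c => endp (u c.1) c.2) c)

open Classical in
lemma boundN (E : Finset (Fin n × Fin n)) (s : Fin 4) (b b' : Bool) (u : Fin 4 → Fin n × Fin n) :
    (E.filter (PN s b b' u)).card ≤ n := by
  have : (univ : Finset (Fin n)).card = n := by simp
  refine le_trans ?_ this.le
  refine card_le_card_of_injOn (fun p => endp p !b) (fun _ _ => mem_coe.2 (mem_univ _)) ?_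
  intro p hp q hq h
  simp only [coe_filter, Set.mem_ofPred_eq, PN] at hp hq
  have h1 := hp.2.trans hq.2.symm
  cases b <;> simp only [endp, Bool.not_false, Bool.not_true, if_true, Bool.false_eq_true, if_false] at h h1
  · exact Prod.ext h1 h
  · exact Prod.ext h h1

open Classical in
lemma boundG (hf : Fam g) (c : Code) (u : Fin 4 → Fin n × Fin n) :
    ((EE g).filter (PG g pt c u)).card ≤ 14 * n := by
  rcases ((EE g).filter (PG g pt c u)).eq_empty_or_nonempty with h0 | ⟨p0, hp0⟩
  · rw [h0]; simp
  obtain ⟨-, -, hGB⟩ := (mem_filter.1 hp0).2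
  set ρ := base g pt (fun c => endp (u c.1) c.2) c with hρ
  set F : Finset (Fin n) := univ.filter (fun i => (∀ c : W, endp (u c.1) c.2 ≠ i) ∧ ∃ τ, FC ρ (g i) τ)
    with hF
  have hτ : ∀ i, ∃ τ, i ∈ F → FC ρ (g i) τ := by
    intro i
    by_cases hi : i ∈ F
    · obtain ⟨τ, h⟩ := (mem_filter.1 hi).2.2
      exact ⟨τ, fun _ => h⟩
    · exact ⟨0, fun h => absurd h hi⟩
  choose τ hτ using hτ
  have key := cyl_bound hf hGB.cont hGB.inj F τ hτ (by
    intro i hi j hj hij σ _ h1 h2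
    obtain ⟨c, hc⟩ := hGB.mem σ
    exact hf.off ((mem_filter.1 hi).2.1 c) ((mem_filter.1 hj).2.1 c) hij hc h1 h2)
  have hFn : F.card ≤ n := by
    have := card_le_univ F
    simpa using this
  refine le_trans ?_ (key.trans (Nat.mul_le_mul_left 14 hFn))
  apply eN_ge
  intro p hp
  obtain ⟨hpE, h1, h2, hB⟩ := mem_filter.1 hp
  obtain ⟨hlt, hT⟩ := (mem_filter.1 hpE).2
  exact ⟨mem_filter.2 ⟨mem_univ _, h1, hB.fi⟩, mem_filter.2 ⟨mem_univ _, h2, hB.fk⟩, hlt.ne, hT⟩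

open Classical in
lemma main_count (hf : Fam g)
    (hpt : ∀ i j, i ≠ j → ∀ x ∈ Set.range (g i) ∩ Set.range (g j), ∃ β, pt i j β = x) :
    (EE g).card ≤ (80 + 70 * Fintype.card Code) * n := by
  set M := (EE g).card with hM
  set TT := Fintype.piFinset (fun _ : Fin 5 => EE g) with hTT
  set N := fun (z : Fin 5 × Fin 4 × Bool × Bool) =>
    TT.filter (fun t => PN z.2.1 z.2.2.1 z.2.2.2 (fun j => t (z.1.succAbove j)) (t z.1)) with hN
  set GG' := fun (z : Fin 5 × Code) =>
    TT.filter (fun t => PG g pt z.2 (fun j => t (z.1.succAbove j)) (t z.1)) with hG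
  have hcover : TT ⊆ univ.biUnion N ∪ univ.biUnion GG' := by
    intro t ht
    have htE : ∀ r, t r ∈ EE g := Fintype.mem_piFinset.1 ht
    rw [mem_union, mem_biUnion, mem_biUnion]
    by_cases hno : ∃ r, ∃ s : Fin 4, ∃ b b', endp (t r) b = endp (t (r.succAbove s)) b'
    · obtain ⟨r, s, b, b', h⟩ := hno
      left
      exact ⟨(r, s, b, b'), mem_univ _, mem_filter.2 ⟨ht, h⟩⟩
    · right
      push Not at hno
      have he : ∀ r b r' b', endp (t r) b = endp (t r') b' → r = r' ∧ b = b' := by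
        intro r b r' b' h
        have hrr : r = r' := by
          by_contra hne
          obtain ⟨s, rfl⟩ := Fin.exists_succAbove_eq (Ne.symm hne)
          exact hno r s b b' h
        refine ⟨hrr, ?_⟩
        subst hrr
        have hlt := (mem_filter.1 (htE r)).2.1
        cases b <;> cases b' <;> simp [endp] at h ⊢
        · exact hlt.ne h
        · exact hlt.ne h.symm
      obtain ⟨r, code, hB⟩ := five hf hpt (fun r b => endp (t r) b) he
        (fun r => (mem_filter.1 (htE r)).2.2)
      refine ⟨(r, code), mem_univ _, mem_filter.2 ⟨ht, ?_, ?_, hB⟩⟩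
      · intro c h
        exact hno r c.1 false c.2 h.symm
      · intro c h
        exact hno r c.1 true c.2 h.symm
  have h5 : M ^ 5 = TT.card := by
    rw [hTT, Fintype.card_piFinset]; simp [hM]
  have c1 : (univ.biUnion N).card ≤ 80 * (n * M ^ 4) := by
    refine (card_biUnion_le_card_mul _ _ (n * M ^ 4) ?_).trans ?_
    · intro z _
      exact count (EE g) z.1 _ n (boundN _ _ _ _)
    · rw [card_univ]
      simp only [Fintype.card_prod, Fintype.card_fin, Fintype.card_bool]
      apply le_of_eq; ring
  have c2 : (univ.biUnion GG').card ≤ (5 * Fintype.card Code) * (14 * n * M ^ 4) := by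
    refine (card_biUnion_le_card_mul _ _ (14 * n * M ^ 4) ?_).trans ?_
    · intro z _
      exact count (EE g) z.1 _ (14 * n) (boundG hf _)
    · rw [card_univ, Fintype.card_prod, Fintype.card_fin]
  have tot : M ^ 5 ≤ (80 + 70 * Fintype.card Code) * n * M ^ 4 := by
    rw [h5]
    refine (card_le_card hcover).trans ((card_union_le _ _).trans ((add_le_add c1 c2).trans ?_))
    apply le_of_eq; ring
  rcases Nat.eq_zero_or_pos M with h0 | h0
  · rw [h0]; exact Nat.zero_le _
  · have : M * M ^ 4 ≤ (80 + 70 * Fintype.card Code) * n * M ^ 4 := by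
      rw [← pow_succ']; exact tot
    exact Nat.le_of_mul_le_mul_right this (pow_pos h0 4)

end count

lemma exists_two {S : Set ℂ} (h : AtMost2 S) : ∃ f : Bool → ℂ, ∀ x ∈ S, ∃ β, f β = x := by
  by_cases h1 : ∃ x ∈ S, ∃ y ∈ S, x ≠ y
  · obtain ⟨x, hx, y, hy, hxy⟩ := h1
    refine ⟨fun b => if b then x else y, fun z hz => ?_⟩
    rcases h x hx y hy z hz with e | e | e
    · exact absurd e hxy
    · exact ⟨true, by simp [e]⟩
    · exact ⟨false, by simp [e]⟩
  · push Not at h1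
    by_cases h2 : ∃ x, x ∈ S
    · obtain ⟨x, hx⟩ := h2
      exact ⟨fun _ => x, fun z hz => ⟨true, h1 x hx z hz⟩⟩
    · exact ⟨fun _ => 0, fun z hz => absurd ⟨z, hz⟩ h2⟩

lemma main_C {n : ℕ} {g : Fin n → ℝ → ℂ} (hf : Fam g) :
    (EE g).card ≤ (80 + 70 * Fintype.card Code) * n := by
  have : ∀ i j, ∃ f : Bool → ℂ, i ≠ j → ∀ x ∈ Set.range (g i) ∩ Set.range (g j), ∃ β, f β = x := by
    intro i j
    by_cases hij : i = j
    · exact ⟨fun _ => 0, fun h => absurd hij h⟩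
    · obtain ⟨f, h⟩ := exists_two (hf.two i j hij)
      exact ⟨f, fun _ => h⟩
  choose pt hpt using this
  exact main_count hf hpt

end PC

namespace PC
open Set

abbrev LL : ℂ ≃ₗᵢ[ℝ] Plane := Complex.orthonormalBasisOneI.repr

lemma ee_real_norm (t : ℝ) : ‖ee (t : ℂ)‖ = 1 := by
  unfold ee
  rw [show (2 * Real.pi * Complex.I * (t:ℂ)) = ((2 * Real.pi * t : ℝ) : ℂ) * Complex.I by push_cast; ring]
  exact Complex.norm_exp_ofReal_mul_I _

lemma ee_real_surj {z : ℂ} (hz : ‖z‖ = 1) : ∃ t : ℝ, ee (t : ℂ) = z := by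
  refine ⟨z.arg / (2 * Real.pi), ?_⟩
  have hpi : (Real.pi : ℂ) ≠ 0 := by exact_mod_cast Real.pi_ne_zero
  have := Complex.norm_mul_exp_arg_mul_I z
  rw [hz] at this
  simp only [Complex.ofReal_one, one_mul] at this
  unfold ee
  rw [← this]
  congr 1
  rw [this]
  push_cast
  field_simp

lemma exists_param {γ : Set Plane} (h : IsJordanCurve γ) : ∃ g, JC g ∧ range g = LL ⁻¹' γ := by
  obtain ⟨h⟩ := h
  have hs : ∀ t : ℝ, LL (ee (t:ℂ)) ∈ Metric.sphere (0 : Plane) 1 := by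
    intro t
    rw [mem_sphere_zero_iff_norm, LinearIsometryEquiv.norm_map, ee_real_norm]
  have hc : Continuous fun t : ℝ => (⟨LL (ee (t:ℂ)), hs t⟩ : Metric.sphere (0 : Plane) 1) := by
    apply Continuous.subtype_mk
    apply LL.continuous.comp
    unfold ee
    fun_prop
  refine ⟨fun t => LL.symm (h.symm ⟨LL (ee (t:ℂ)), hs t⟩ : Plane), ⟨?_, ?_, ?_⟩, ?_⟩
  · exact LL.symm.continuous.comp (continuous_subtype_val.comp (h.symm.continuous.comp hc))
  · intro t
    have : ee ((t + 1 : ℝ) : ℂ) = ee (t : ℂ) := (ee_eq_iff _ _).2 ⟨1, by push_cast; ring⟩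
    simp only [this]
  · intro s t hst
    have h1 := LL.symm.injective hst
    have h2 := h.symm.injective (Subtype.ext h1)
    have h3 := LL.injective (congrArg Subtype.val h2)
    obtain ⟨m, hm⟩ := (ee_eq_iff _ _).1 h3
    exact ⟨m, by exact_mod_cast hm⟩
  · ext z
    constructor
    · rintro ⟨t, rfl⟩
      show LL (LL.symm _) ∈ γ
      rw [LinearIsometryEquiv.apply_symm_apply]
      exact Subtype.coe_prop _
    · intro hz
      have hz' : LL z ∈ γ := hz
      obtain ⟨t, ht⟩ := ee_real_surj (z := LL.symm (h ⟨LL z, hz'⟩ : Plane)) (by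
        rw [LinearIsometryEquiv.norm_map]
        exact mem_sphere_zero_iff_norm.1 (h ⟨LL z, hz'⟩).2)
      refine ⟨t, ?_⟩
      have : (⟨LL (ee (t:ℂ)), hs t⟩ : Metric.sphere (0 : Plane) 1) = h ⟨LL z, hz'⟩ := by
        apply Subtype.ext
        show LL (ee (t:ℂ)) = _
        rw [ht, LinearIsometryEquiv.apply_symm_apply]
      simp only [this, Homeomorph.symm_apply_apply]
      simp

lemma atMost2_of {S : Set Plane} (hfin : S.Finite) (h : S.ncard ≤ 2) : AtMost2 (LL ⁻¹' S) := by
  intro x hx y hy z hz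
  by_contra hc
  push Not at hc
  obtain ⟨h1, h2, h3⟩ := hc
  have hsub : ({LL x, LL y, LL z} : Set Plane) ⊆ S := by
    rintro _ (rfl | rfl | rfl)
    · exact hx
    · exact hy
    · exact hz
  have h4 := Set.ncard_le_ncard hsub hfin
  rw [Set.ncard_eq_three.2 ⟨LL x, LL y, LL z, LL.injective.ne h1, LL.injective.ne h2,
    LL.injective.ne h3, rfl⟩] at h4
  omega

end PC

theorem pseudo_circles_linear_touchings :
    ∃ C : ℝ, 0 < C ∧
      ∀ (n : ℕ) (γ : Fin n → Set Plane),
        Function.Injective γ →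
        (∀ i, IsJordanCurve (γ i)) →
        GenPos γ →
        MIntersecting 2 γ →
        (∀ i j : Fin n, i ≠ j → (γ i ∩ γ j).Nonempty) →
        (touchingPairs γ : ℝ) ≤ C * (n : ℝ) := by
  classical
  refine ⟨((80 + 70 * Fintype.card PC.Code : ℕ) : ℝ), by positivity, ?_⟩
  intro n γ _ hJ hG h2 hne
  choose g hg hr using fun i => PC.exists_param (hJ i)
  have hf : PC.Fam g := by
    refine ⟨hg, ?_, ?_, ?_⟩
    · intro i j hij
      rw [hr, hr, ← Set.preimage_inter]
      exact PC.atMost2_of (hG.1 i j hij) (h2 i j hij)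
    · intro i j hij
      rw [hr, hr, ← Set.preimage_inter]
      obtain ⟨x, hx⟩ := hne i j hij
      refine ⟨PC.LL.symm x, ?_⟩
      rw [Set.mem_preimage, LinearIsometryEquiv.apply_symm_apply]
      exact hx
    · intro x i j k
      rw [hr, hr, hr]
      exact hG.2 (PC.LL x) i j k
  have hT : ∀ i j, Touches (γ i) (γ j) → PC.Tch (g i) (g j) := by
    rintro i j ⟨x, hx⟩
    refine ⟨PC.LL.symm x, ?_⟩
    rw [hr, hr, ← Set.preimage_inter, hx]
    ext z
    simp only [Set.mem_preimage, Set.mem_singleton_iff]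
    exact (LinearIsometryEquiv.eq_symm_apply _).symm
  have hle : touchingPairs γ ≤ (PC.EE g).card := by
    unfold touchingPairs
    rw [← Set.ncard_coe_finset]
    apply Set.ncard_le_ncard _ (Finset.finite_toSet _)
    rintro p ⟨h1, h2⟩
    rw [Finset.mem_coe]
    unfold PC.EE
    rw [Finset.mem_filter]
    exact ⟨Finset.mem_univ _, h1, hT _ _ h2⟩
  have := hle.trans (PC.main_C hf)
  exact_mod_cast this
end
end

section
/- Let m ≥ 1 be an integer and let γ₁ and γ₂ be two distinct closed Jordan curves in the plane whose intersection γ₁ ∩ γ₂ is a finite set of at most m points. Then the complement ℝ² \ (γ₁ ∪ γ₂) has at most m + 2 connected components. -/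
noncomputable section

open Complex Set in
theorem jc_log_lift {X : Type*} [TopologicalSpace X] [LocallyPathConnectedSpace X]
    [SimplyConnectedSpace X] (h : X → ℂ) (hc : Continuous h) (h0 : ∀ x, h x ≠ 0) :
    ∃ F : X → ℂ, Continuous F ∧ ∀ x, exp (F x) = h x := by
  obtain ⟨x₀⟩ : Nonempty X := inferInstance
  rcases isCoveringMapOn_exp.existsUnique_continuousMap_lifts
    (⟨h, hc⟩ : C(X, ℂ)) (a₀ := x₀) (exp_log (h0 x₀)) (fun x ↦ by simpa using h0 x) with ⟨f, ⟨-, hf⟩, -⟩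
  exact ⟨f, f.continuous, fun x => congrFun hf x⟩

open Complex Set in
theorem jc_curve {ι : Type*} [Fintype ι] (γ : Set ℂ) (φ : AddCircle (2 * Real.pi) ≃ₜ γ)
    (a : ι → ℂ) (ha : ∀ i, a i ∉ γ) :
    ∃ (w : ι → ℤ) (L : ι → ℂ → ℂ), (∀ i, ∀ z ∈ γ, exp (L i z) = z - a i) ∧
      ∀ c : ι → ℤ, ∑ i, c i * w i = 0 → ContinuousOn (fun z => ∑ i, (c i : ℂ) * L i z) γ := by
  classical
  have : Fact (0 < 2 * Real.pi) := ⟨by positivity⟩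
  have h1 : ∀ i, ∃ F : ℝ → ℂ, Continuous F ∧
      ∀ t : ℝ, exp (F t) = (φ (t : AddCircle (2 * Real.pi)) : ℂ) - a i := by
    intro i
    apply jc_log_lift
    · have : Continuous (fun t : ℝ => (t : AddCircle (2 * Real.pi))) :=
        AddCircle.continuous_mk' _
      fun_prop
    · intro t ht
      apply ha i
      rw [← sub_eq_zero.mp ht]
      exact (φ _).2
  choose F hF hexp using h1
  have h2 : ∀ i, ∃ n : ℤ, F i (2 * Real.pi) = F i 0 + n * (2 * Real.pi * I) := by
    intro i
    rw [← exp_eq_exp_iff_exists_int, hexp, hexp, AddCircle.coe_period]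
    simp
  choose w hw using h2
  refine ⟨w, fun i z => if h : z ∈ γ then
    AddCircle.liftIco (2 * Real.pi) 0 (F i) (φ.symm ⟨z, h⟩) else 0, ?_, ?_⟩
  · intro i z hz
    simp only [hz, dite_true]
    obtain ⟨t, ht, hte⟩ : ∃ t ∈ Ico (0:ℝ) (0 + 2 * Real.pi),
        (t : AddCircle (2 * Real.pi)) = φ.symm ⟨z, hz⟩ := by
      have := AddCircle.coe_image_Ico_eq (2 * Real.pi) 0
      have h3 : φ.symm ⟨z, hz⟩ ∈ (univ : Set (AddCircle (2 * Real.pi))) := mem_univ _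
      rw [← this] at h3
      exact h3
    rw [← hte, AddCircle.liftIco_coe_apply ht, hexp, hte]
    simp
  · intro c hc
    rw [continuousOn_iff_continuous_domRestrict]
    have h4 : Continuous (AddCircle.liftIco (2 * Real.pi) 0
        (fun t => ∑ i, (c i : ℂ) * F i t)) := by
      apply AddCircle.liftIco_continuous
      · rw [zero_add]
        simp only [hw, mul_add, Finset.sum_add_distrib]
        have : ∑ i, (c i : ℂ) * (w i * (2 * Real.pi * I)) =
            ((∑ i, c i * w i : ℤ) : ℂ) * (2 * Real.pi * I) := by
          push_cast
          rw [Finset.sum_mul]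
          exact Finset.sum_congr rfl fun i _ => by ring
        rw [this, hc]
        simp
      · exact Continuous.continuousOn (by fun_prop)
    convert h4.comp φ.symm.continuous using 1
    ext z
    simp [domRestrict, AddCircle.liftIco]

open Complex Set in
theorem jc_relation (m : ℕ) (hm : 1 ≤ m) (γ₁ γ₂ : Set ℂ) (φ₁ : AddCircle (2 * Real.pi) ≃ₜ γ₁)
    (φ₂ : AddCircle (2 * Real.pi) ≃ₜ γ₂) (hc1 : IsClosed γ₁) (hc2 : IsClosed γ₂)
    (hfin : (γ₁ ∩ γ₂).Finite) (hcard : (γ₁ ∩ γ₂).ncard ≤ m)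
    (a : Fin (m + 2) → ℂ) (ha : ∀ i, a i ∉ γ₁ ∪ γ₂) :
    ∃ c : Fin (m + 2) → ℤ, c ≠ 0 ∧ ∃ g : ℂ → ℂ, Continuous g ∧
      ∀ z ∈ γ₁ ∪ γ₂, exp (g z) = ∏ i, (z - a i) ^ c i := by
  classical
  obtain ⟨w1, L1, hL1, hC1⟩ := jc_curve γ₁ φ₁ a (fun i h => ha i (Or.inl h))
  obtain ⟨w2, L2, hL2, hC2⟩ := jc_curve γ₂ φ₂ a (fun i h => ha i (Or.inr h))
  have hD : ∃ D : Fin m → Fin (m + 2) → ℤ, ∀ z ∈ γ₁ ∩ γ₂, ∃ j, ∀ i,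
      L1 i z = L2 i z + D j i * (2 * Real.pi * I) := by
    have h1 : ∀ z ∈ γ₁ ∩ γ₂, ∀ i, ∃ n : ℤ, L1 i z = L2 i z + n * (2 * Real.pi * I) := by
      intro z hz i
      rw [← exp_eq_exp_iff_exists_int, hL1 i z hz.1, hL2 i z hz.2]
    choose! d hd using h1
    have := hfin.fintype
    have hle : Fintype.card ↥(γ₁ ∩ γ₂) ≤ Fintype.card (Fin m) := by
      rw [Fintype.card_fin, ← Nat.card_eq_fintype_card]
      exact hcard
    obtain ⟨f⟩ := Function.Embedding.nonempty_of_card_le hle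
    refine ⟨fun j => if h : ∃ z, f z = j then d (h.choose) else 0, fun z hz => ⟨f ⟨z, hz⟩, fun i => ?_⟩⟩
    have h : ∃ z', f z' = f ⟨z, hz⟩ := ⟨_, rfl⟩
    have h' := f.injective h.choose_spec
    simp only [h, dite_true, h']
    exact hd z hz i
  obtain ⟨D, hD⟩ := hD
  let A : Matrix (Fin m ⊕ Bool) (Option (Fin (m + 2))) ℤ := fun r s =>
    match r, s with
    | Sum.inl _, none => -1
    | Sum.inl j, some i => D j i
    | Sum.inr _, none => 0
    | Sum.inr true, some i => w1 i
    | Sum.inr false, some i => w2 i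
  have hA : ∃ v, v ≠ 0 ∧ A.mulVec v = 0 := by
    by_contra! hcon
    have hinj : Function.Injective A.mulVecLin := by
      rw [← LinearMap.ker_eq_bot, LinearMap.ker_eq_bot']
      intro v hv
      by_contra hv0
      exact hcon v hv0 hv
    have := card_le_of_injective ℤ A.mulVecLin hinj
    simp at this
  obtain ⟨v, hv0, hv⟩ := hA
  have e1 : ∑ i, v (some i) * w1 i = 0 := by
    have := congrFun hv (Sum.inr true)
    simp [Matrix.mulVec, dotProduct, A] at this
    rw [← this]
    exact Finset.sum_congr rfl fun i _ => mul_comm _ _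
  have e2 : ∑ i, v (some i) * w2 i = 0 := by
    have := congrFun hv (Sum.inr false)
    simp [Matrix.mulVec, dotProduct, A] at this
    rw [← this]
    exact Finset.sum_congr rfl fun i _ => mul_comm _ _
  have e3 : ∀ j, ∑ i, v (some i) * D j i = v none := by
    intro j
    have := congrFun hv (Sum.inl j)
    simp [Matrix.mulVec, dotProduct, A] at this
    rw [neg_add_eq_zero] at this
    rw [this]
    exact Finset.sum_congr rfl fun i _ => mul_comm _ _
  have hcne : (fun i => v (some i)) ≠ 0 := by
    intro h0
    have h0' : ∀ i, v (some i) = 0 := fun i => congrFun h0 i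
    apply hv0
    funext s
    cases s with
    | none => rw [← e3 ⟨0, hm⟩]; simp [h0']
    | some i => exact h0' i
  set c : Fin (m + 2) → ℤ := fun i => v (some i) with hc
  let G1 : ℂ → ℂ := fun z => ∑ i, (c i : ℂ) * L1 i z
  let G2 : ℂ → ℂ := fun z => ∑ i, (c i : ℂ) * L2 i z + v none * (2 * Real.pi * I)
  have hG1 : ContinuousOn G1 γ₁ := hC1 c e1
  have hG2 : ContinuousOn G2 γ₂ := (hC2 c e2).add continuousOn_const
  have hagree : ∀ z ∈ γ₁ ∩ γ₂, G1 z = G2 z := by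
    intro z hz
    obtain ⟨j, hj⟩ := hD z hz
    simp only [G1, G2, hj, mul_add, Finset.sum_add_distrib, ← e3 j]
    congr 1
    push_cast
    rw [Finset.sum_mul]
    exact Finset.sum_congr rfl fun i _ => by ring
  have hE1 : ∀ z ∈ γ₁, exp (G1 z) = ∏ i, (z - a i) ^ c i := by
    intro z hz
    simp only [G1, exp_sum, exp_int_mul]
    exact Finset.prod_congr rfl fun i _ => by rw [hL1 i z hz]
  have hE2 : ∀ z ∈ γ₂, exp (G2 z) = ∏ i, (z - a i) ^ c i := by
    intro z hz
    simp only [G2, exp_add, exp_sum, exp_int_mul, exp_two_pi_mul_I, one_zpow, mul_one]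
    exact Finset.prod_congr rfl fun i _ => by rw [hL2 i z hz]
  let G : ℂ → ℂ := fun z => if z ∈ γ₁ then G1 z else G2 z
  have hGG1 : EqOn G G1 γ₁ := fun z hz => by simp [G, hz]
  have hGG2 : EqOn G G2 γ₂ := fun z hz => by
    by_cases h : z ∈ γ₁
    · simp [G, h, hagree z ⟨h, hz⟩]
    · simp [G, h]
  have hG : ContinuousOn G (γ₁ ∪ γ₂) :=
    (hG1.congr hGG1).union_of_isClosed (hG2.congr hGG2) hc1 hc2
  obtain ⟨g, hg⟩ := ContinuousMap.exists_restrict_eq (hc1.union hc2)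
    (⟨(γ₁ ∪ γ₂).domRestrict G, continuousOn_iff_continuous_domRestrict.mp hG⟩ : C(↥(γ₁ ∪ γ₂), ℂ))
  refine ⟨c, hcne, g, g.continuous, fun z hz => ?_⟩
  have : g z = G z := congrArg (fun f : C(↥(γ₁ ∪ γ₂), ℂ) => f ⟨z, hz⟩) hg
  rw [this]
  rcases hz with hz | hz
  · rw [hGG1 hz, hE1 z hz]
  · rw [hGG2 hz, hE2 z hz]

open Complex Set in
theorem jc_borsuk {ι : Type*} [Fintype ι] (K : Set ℂ) (hK : IsClosed K) (a : ι → ℂ)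
    (ha : ∀ i, a i ∉ K)
    (hdist : ∀ i j, connectedComponentIn Kᶜ (a i) = connectedComponentIn Kᶜ (a j) → i = j)
    (hbd : ∀ i, Bornology.IsBounded (connectedComponentIn Kᶜ (a i)))
    (c : ι → ℤ) (g : ℂ → ℂ) (hg : Continuous g)
    (hgK : ∀ z ∈ K, exp (g z) = ∏ i, (z - a i) ^ c i) : c = 0 := by
  classical
  funext i
  set U := connectedComponentIn Kᶜ (a i) with hU
  have hUo : IsOpen U := hK.isOpen_compl.connectedComponentIn
  have hfr : frontier U ⊆ K := by
    intro x hx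
    by_contra hxK
    have hV : IsOpen (connectedComponentIn Kᶜ x) := hK.isOpen_compl.connectedComponentIn
    have hxV : x ∈ connectedComponentIn Kᶜ x := mem_connectedComponentIn hxK
    rw [hUo.frontier_eq] at hx
    obtain ⟨y, hyV, hyU⟩ := mem_closure_iff.mp hx.1 _ hV hxV
    have h1 := connectedComponentIn_eq hyV
    have h2 := connectedComponentIn_eq hyU
    exact hx.2 (by rw [hU, h2, ← h1]; exact hxV)
  have haU : a i ∈ U := mem_connectedComponentIn (ha i)
  have hcl : ∀ j, j ≠ i → a j ∉ closure U := by
    intro j hj h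
    rw [closure_eq_self_union_frontier] at h
    rcases h with h | h
    · exact hj (hdist i j (connectedComponentIn_eq h)).symm
    · exact ha j (hfr h)
  let q : ℂ → ℂ := fun z => ∏ j ∈ Finset.univ.erase i, (z - a j) ^ c j
  have hq0 : ∀ z ∈ closure U, q z ≠ 0 := by
    intro z hz
    refine Finset.prod_ne_zero_iff.mpr fun j hj => zpow_ne_zero _ (sub_ne_zero.mpr ?_)
    rintro rfl
    exact hcl j (Finset.ne_of_mem_erase hj) hz
  have hqc : ContinuousOn q (closure U) := by
    refine continuousOn_finsetProd _ fun j hj => ?_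
    refine ContinuousOn.zpow₀ (by fun_prop) _ fun z hz => Or.inl (sub_ne_zero.mpr ?_)
    rintro rfl
    exact hcl j (Finset.ne_of_mem_erase hj) hz
  let p : ℂ → ℂ := U.piecewise (fun z => exp (g z) / q z) (fun z => (z - a i) ^ c i)
  have hpc : Continuous p := by
    refine continuous_piecewise ?_ ?_ ?_
    · intro z hz
      have hzc : z ∈ closure U := frontier_subset_closure hz
      rw [hgK z (hfr hz), div_eq_iff (hq0 z hzc)]
      exact (Finset.mul_prod_erase Finset.univ (fun j => (z - a j) ^ c j) (Finset.mem_univ i)).symm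
    · exact ContinuousOn.div (by fun_prop) hqc hq0
    · rw [hUo.isClosed_compl.closure_eq]
      refine ContinuousOn.zpow₀ (by fun_prop) _ fun z hz => Or.inl (sub_ne_zero.mpr ?_)
      rintro rfl
      exact hz haU
  have hp0 : ∀ z, p z ≠ 0 := by
    intro z
    by_cases h : z ∈ U
    · simp only [p, piecewise_eq_of_mem _ _ _ h]
      exact div_ne_zero (exp_ne_zero _) (hq0 z (subset_closure h))
    · simp only [p, piecewise_eq_of_notMem _ _ _ h]
      refine zpow_ne_zero _ (sub_ne_zero.mpr ?_)
      rintro rfl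
      exact h haU
  obtain ⟨l, hl, hle⟩ := jc_log_lift p hpc hp0
  obtain ⟨R, hR0, hR⟩ := (hbd i).subset_ball_lt 0 (a i)
  let ψ : ℝ → ℂ := fun t => l (a i + R * exp (t * I)) - c i * (Real.log R + t * I)
  have hψc : Continuous ψ := by fun_prop
  have hψ : ∀ t, exp (ψ t) = 1 := by
    intro t
    have hout : a i + R * exp (t * I) ∉ U := by
      intro h
      have := hR h
      simp [Complex.norm_exp_ofReal_mul_I, abs_of_pos hR0] at this
    have hp : p (a i + R * exp (t * I)) = (R * exp (t * I)) ^ c i := by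
      simp only [p, piecewise_eq_of_notMem _ _ _ hout]
      simp
    have hRe : exp (Real.log R : ℂ) = R := by
      rw [← ofReal_exp, Real.exp_log hR0]
    simp only [ψ]
    rw [exp_sub, hle, hp, exp_int_mul, exp_add, hRe, div_self]
    exact zpow_ne_zero _ (mul_ne_zero (by exact_mod_cast hR0.ne') (exp_ne_zero _))
  have hconst : ψ (2 * Real.pi) = ψ 0 := by
    refine isCoveringMap_exp.const_of_comp hψc ?_ _ _
    intro t s
    simp [hψ]
  simp only [ψ] at hconst
  push_cast at hconst
  rw [exp_two_pi_mul_I] at hconst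
  simp at hconst
  simpa [Real.pi_ne_zero] using hconst

open Complex Set in
theorem jc_unbounded (K : Set ℂ) (hK : IsCompact K) (p q : ℂ)
    (hp : ¬ Bornology.IsBounded (connectedComponentIn Kᶜ p))
    (hq : ¬ Bornology.IsBounded (connectedComponentIn Kᶜ q)) :
    connectedComponentIn Kᶜ p = connectedComponentIn Kᶜ q := by
  obtain ⟨R, hR0, hR⟩ := hK.isBounded.subset_closedBall_lt 0 0
  have hS : IsPreconnected (Metric.closedBall (0 : ℂ) R)ᶜ := by
    have h1 : (Metric.closedBall (0 : ℂ) R)ᶜ =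
        (fun x : ℝ × ℝ => (x.1 : ℂ) * exp (x.2 * I)) '' (Ioi R ×ˢ univ) := by
      ext z
      simp only [mem_compl_iff, Metric.mem_closedBall, dist_zero_right, not_le, mem_image,
        mem_prod, mem_Ioi, mem_univ, and_true, Prod.exists]
      constructor
      · intro hz
        exact ⟨‖z‖, arg z, hz, norm_mul_exp_arg_mul_I z⟩
      · rintro ⟨r, t, hr, rfl⟩
        rw [norm_mul, norm_exp_ofReal_mul_I, mul_one, norm_real]
        exact hr.trans_le (le_abs_self r)
    rw [h1]
    exact (isPreconnected_Ioi.prod isPreconnected_univ).image _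
      (Continuous.continuousOn (by fun_prop))
  have hSK : (Metric.closedBall (0 : ℂ) R)ᶜ ⊆ Kᶜ := compl_subset_compl.mpr hR
  have hex : ∀ p, ¬ Bornology.IsBounded (connectedComponentIn Kᶜ p) →
      ∃ x ∈ connectedComponentIn Kᶜ p, x ∈ (Metric.closedBall (0 : ℂ) R)ᶜ := by
    intro p hp
    by_contra! h
    exact hp (Metric.isBounded_closedBall.subset fun x hx => not_not.mp (h x hx))
  obtain ⟨x, hx, hxS⟩ := hex p hp
  obtain ⟨y, hy, hyS⟩ := hex q hq
  rw [connectedComponentIn_eq hx, connectedComponentIn_eq hy]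
  exact connectedComponentIn_eq (hS.subset_connectedComponentIn hxS hSK hyS)

open Complex Set in
theorem jc_complex (m : ℕ) (hm : 1 ≤ m) (γ₁ γ₂ : Set ℂ) (φ₁ : AddCircle (2 * Real.pi) ≃ₜ γ₁)
    (φ₂ : AddCircle (2 * Real.pi) ≃ₜ γ₂)
    (hfin : (γ₁ ∩ γ₂).Finite) (hcard : (γ₁ ∩ γ₂).ncard ≤ m)
    (a : Fin (m + 3) → ℂ) (ha : ∀ i, a i ∉ γ₁ ∪ γ₂)
    (hdist : ∀ i j, connectedComponentIn (γ₁ ∪ γ₂)ᶜ (a i) =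
      connectedComponentIn (γ₁ ∪ γ₂)ᶜ (a j) → i = j) : False := by
  have : Fact (0 < 2 * Real.pi) := ⟨by positivity⟩
  have hk1 : IsCompact γ₁ := isCompact_iff_compactSpace.mpr φ₁.compactSpace
  have hk2 : IsCompact γ₂ := isCompact_iff_compactSpace.mpr φ₂.compactSpace
  have hK := hk1.union hk2
  obtain ⟨f, hf, hb⟩ : ∃ f : Fin (m + 2) → Fin (m + 3), Function.Injective f ∧
      ∀ i, Bornology.IsBounded (connectedComponentIn (γ₁ ∪ γ₂)ᶜ (a (f i))) := by
    by_cases h : ∃ i, ¬ Bornology.IsBounded (connectedComponentIn (γ₁ ∪ γ₂)ᶜ (a i))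
    · obtain ⟨i, hi⟩ := h
      refine ⟨i.succAbove, Fin.succAbove_right_injective, fun j => ?_⟩
      by_contra hj
      exact Fin.succAbove_ne i j (hdist _ _ (jc_unbounded _ hK _ _ hj hi))
    · push Not at h
      exact ⟨Fin.castSucc, Fin.castSucc_injective _, fun i => h _⟩
  obtain ⟨c, hc0, g, hg, hgK⟩ := jc_relation m hm γ₁ γ₂ φ₁ φ₂ hk1.isClosed hk2.isClosed hfin hcard
    (a ∘ f) (fun i => ha _)
  exact hc0 (jc_borsuk _ hK.isClosed (a ∘ f) (fun i => ha _)
    (fun i j h => hf (hdist _ _ h)) hb c g hg hgK)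

theorem jc_param (e : Plane ≃ₗᵢ[ℝ] ℂ) (γ : Set Plane) (h : IsJordanCurve γ) :
    Nonempty (AddCircle (2 * Real.pi) ≃ₜ ↥(e '' γ)) := by
  obtain ⟨φ⟩ := h
  have s : Metric.sphere (0 : Plane) 1 ≃ₜ ↥(e '' Metric.sphere (0 : Plane) 1) :=
    e.toHomeomorph.image _
  have hs : e '' Metric.sphere (0 : Plane) 1 = Metric.sphere (0 : ℂ) 1 := by
    simp [LinearIsometryEquiv.image_sphere]
  rw [hs] at s
  have t : Circle ≃ₜ Metric.sphere (0 : ℂ) 1 :=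
    { toFun := fun z => ⟨(z : ℂ), by rw [mem_sphere_zero_iff_norm]; exact Circle.norm_coe z⟩
      invFun := fun z => ⟨z, by
        have := z.2
        simpa [Submonoid.unitSphere] using this⟩
      left_inv := fun z => rfl
      right_inv := fun z => rfl
      continuous_toFun := by fun_prop
      continuous_invFun := by fun_prop }
  exact ⟨((AddCircle.homeomorphCircle'.trans t).trans s.symm).trans
    (φ.symm.trans (e.toHomeomorph.image γ))⟩

/-- Two distinct closed Jordan curves intersecting in at most `m` points (with `m ≥ 1`)
cut the plane into at most `m + 2` connected components. -/
theorem complement_two_jordan_curves_components (m : ℕ) (hm : 1 ≤ m)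
    (γ₁ γ₂ : Set Plane)
    (h₁ : IsJordanCurve γ₁) (h₂ : IsJordanCurve γ₂) (hne : γ₁ ≠ γ₂)
    (hfin : (γ₁ ∩ γ₂).Finite) (hcard : (γ₁ ∩ γ₂).ncard ≤ m) :
    {Δ : Set Plane | ∃ p ∈ (γ₁ ∪ γ₂)ᶜ, Δ = connectedComponentIn ((γ₁ ∪ γ₂)ᶜ) p}.Finite ∧
    {Δ : Set Plane | ∃ p ∈ (γ₁ ∪ γ₂)ᶜ, Δ = connectedComponentIn ((γ₁ ∪ γ₂)ᶜ) p}.ncard ≤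
      m + 2 := by
  set S := {Δ : Set Plane | ∃ p ∈ (γ₁ ∪ γ₂)ᶜ, Δ = connectedComponentIn ((γ₁ ∪ γ₂)ᶜ) p} with hS
  suffices h : S.encard ≤ ((m + 2 : ℕ) : ℕ∞) by
    have hf : S.Finite := Set.finite_of_encard_le_coe h
    refine ⟨hf, ?_⟩
    rw [← hf.cast_ncard_eq] at h
    exact_mod_cast h
  by_contra hcon
  have hge : ((m + 3 : ℕ) : ℕ∞) ≤ S.encard := by
    have := Order.add_one_le_of_lt (not_le.mp hcon)
    exact_mod_cast this
  obtain ⟨T, hTS, hT⟩ := Set.exists_subset_encard_eq hge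
  have hTf : T.Finite := Set.finite_of_encard_eq_coe hT
  have hTn : Nat.card T = m + 3 := by
    have : T.ncard = m + 3 := by
      rw [← hTf.cast_ncard_eq] at hT
      exact_mod_cast hT
    exact this
  have := hTf.to_subtype
  let f := (Finite.equivFinOfCardEq hTn).symm
  have hp : ∀ i, ∃ p ∈ (γ₁ ∪ γ₂)ᶜ, (f i : Set Plane) = connectedComponentIn ((γ₁ ∪ γ₂)ᶜ) p :=
    fun i => hTS (f i).2
  choose p hpK hpc using hp
  let e : Plane ≃ₗᵢ[ℝ] ℂ := Complex.orthonormalBasisOneI.repr.symm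
  obtain ⟨φ₁⟩ := jc_param e γ₁ h₁
  obtain ⟨φ₂⟩ := jc_param e γ₂ h₂
  have hint : e '' γ₁ ∩ e '' γ₂ = e '' (γ₁ ∩ γ₂) := (Set.image_inter e.injective).symm
  have hcomp : (e '' γ₁ ∪ e '' γ₂)ᶜ = e '' (γ₁ ∪ γ₂)ᶜ := by
    rw [← Set.image_union, Set.image_compl_eq e.bijective]
  refine jc_complex m hm (e '' γ₁) (e '' γ₂) φ₁ φ₂ ?_ ?_ (fun i => e (p i)) ?_ ?_
  · rw [hint]; exact hfin.image _
  · rw [hint, Set.ncard_image_of_injective _ e.injective]; exact hcard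
  · intro i
    rw [← Set.image_union, e.injective.mem_set_image]
    exact hpK i
  · intro i j hij
    have h3 : ∀ i, connectedComponentIn (e '' (γ₁ ∪ γ₂)ᶜ) (e (p i)) = e '' (f i : Set Plane) := by
      intro i
      rw [hpc i]
      exact (e.toHomeomorph.image_connectedComponentIn (hpK i)).symm
    simp only [hcomp, h3] at hij
    exact f.injective (Subtype.ext (e.injective.image_injective hij))
end
end
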